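/- Fix a real number u. As x → ∞, (1/x)·#{n : 1 < n ≤ x and ω(n − τ(n)) − log log x ≤ u·√(log log x)} tends to (1/√(2π)) ∫_{−∞}^{u} e^{−t²/2} dt (where the finitely many n with n − τ(n) ≤ 0 may be ignored or assigned ω = 0 without affecting the limit). -/

import Mathlib

open Filter

namespace DivisorShift

open Finset Real

lemma log_factorial_eq_sum_primesLE (N : ℕ) :
    log (N.factorial : ℝ) = ∑ p ∈ Nat.primesLE N, (N.factorial.factorization p : ℝ) * log p := by
  rw [log_nat_eq_sum_factorization, Finsupp.sum]
  refine Finset.sum_subset (fun p hp => ?_) (fun p _ hp => ?_)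
  · have hp' := Nat.support_factorization N.factorial ▸ hp
    rw [Nat.mem_primeFactors] at hp'
    exact Nat.mem_primesLE.2 ⟨(hp'.1.dvd_factorial).1 hp'.2.1, hp'.1⟩
  · rw [Finsupp.notMem_support_iff.1 hp]; simp

lemma div_sub_one_le_factorization_factorial {N p : ℕ} (hp : p.Prime) :
    (N : ℝ) / p - 1 ≤ (N.factorial.factorization p : ℝ) := by
  have h1 : N / p ≤ N.factorial.factorization p := by
    rw [Nat.factorization_factorial hp (Nat.lt_add_one (Nat.log p N))]
    by_cases h : Nat.log p N = 0
    · have : N < p := by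
        rcases (Nat.log_eq_zero_iff).1 h with h | h
        · exact h
        · exact absurd hp.two_le (by omega)
      rw [Nat.div_eq_of_lt this]; exact Nat.zero_le _
    · have : N / p ^ 1 ≤ ∑ i ∈ Finset.Ico 1 (Nat.log p N + 1), N / p ^ i :=
        Finset.single_le_sum (f := fun i => N / p ^ i) (fun _ _ => Nat.zero_le _)
          (Finset.mem_Ico.2 ⟨le_rfl, by omega⟩)
      simpa using this
  have h2 : (N : ℝ) / p < (N / p : ℕ) + 1 := by
    have := Nat.lt_floor_add_one ((N : ℝ) / p)
    rwa [Nat.floor_div_eq_div] at this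
  have h3 : ((N / p : ℕ) : ℝ) ≤ (N.factorial.factorization p : ℝ) := by exact_mod_cast h1
  linarith

lemma factorization_factorial_le_div {N p : ℕ} (hp : p.Prime) :
    (N.factorial.factorization p : ℝ) ≤ N / p + N * (1 / (p * (p - 1 : ℝ))) := by
  have h1 := Nat.factorization_factorial_le_div_pred hp N
  have h2 : ((N / (p - 1) : ℕ) : ℝ) ≤ (N : ℝ) / ((p - 1 : ℕ) : ℝ) := Nat.cast_div_le
  have hp2 : (2 : ℝ) ≤ p := by exact_mod_cast hp.two_le
  rw [Nat.cast_sub hp.one_le, Nat.cast_one] at h2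
  have h3 : (N.factorial.factorization p : ℝ) ≤ (N : ℝ) / (p - 1) :=
    le_trans (by exact_mod_cast h1) h2
  refine h3.trans (le_of_eq ?_)
  have : (p : ℝ) - 1 ≠ 0 := by linarith
  field_simp
  ring

lemma exists_sum_log_div_mul_le :
    ∃ C : ℝ, 0 ≤ C ∧ ∀ s : Finset ℕ, (∀ p ∈ s, 2 ≤ p) →
      ∑ p ∈ s, log p * (1 / (p * (p - 1 : ℝ))) ≤ C := by
  have hs : Summable (fun n : ℕ => 4 * (1 / (n : ℝ) ^ (3 / 2 : ℝ))) :=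
    (Real.summable_one_div_nat_rpow.2 (by norm_num)).mul_left 4
  refine ⟨∑' n : ℕ, 4 * (1 / (n : ℝ) ^ (3 / 2 : ℝ)), tsum_nonneg fun n => by positivity, ?_⟩
  intro s h
  refine (Finset.sum_le_sum fun p hp => ?_).trans
    (hs.sum_le_tsum s (fun n _ => by positivity))
  have hp2 : (2 : ℝ) ≤ p := by exact_mod_cast h p hp
  have h1 : log p ≤ (p : ℝ) ^ (1 / 2 : ℝ) / (1 / 2) := log_le_rpow_div (by linarith) (by norm_num)
  have h2 : (p : ℝ) ^ (1 / 2 : ℝ) * (p : ℝ) ^ (3 / 2 : ℝ) = p ^ 2 := by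
    rw [← rpow_add (by linarith), ← rpow_natCast]; norm_num
  have h3 : 0 < (p : ℝ) ^ (3 / 2 : ℝ) := by positivity
  have h4 : 0 < (p : ℝ) ^ (1 / 2 : ℝ) := by positivity
  have h5 : (0 : ℝ) < p * (p - 1) := by nlinarith
  rw [mul_one_div, mul_one_div, div_le_div_iff₀ h5 h3]
  nlinarith [mul_le_mul_of_nonneg_right h1 h3.le]

lemma exists_abs_sum_log_div_sub_log_le :
    ∃ C : ℝ, 0 ≤ C ∧ ∀ N : ℕ, 1 ≤ N →
      |∑ p ∈ Nat.primesLE N, log p / p - log N| ≤ C := by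
  obtain ⟨C, hC, h⟩ := exists_sum_log_div_mul_le
  refine ⟨C + log 4 + 1, by have := log_nonneg (show (1 : ℝ) ≤ 4 by norm_num); linarith, ?_⟩
  intro N hN
  have hN' : (0 : ℝ) < N := by exact_mod_cast hN
  have hlog4 := log_nonneg (show (1 : ℝ) ≤ 4 by norm_num)
  have hlow : N * ∑ p ∈ Nat.primesLE N, log p / p - log 4 * N ≤ log (N.factorial : ℝ) := by
    rw [log_factorial_eq_sum_primesLE]
    have h1 := Chebyshev.theta_le_log4_mul_x hN'.le
    rw [Chebyshev.theta_eq_sum_primesLE_log] at h1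
    rw [Finset.mul_sum]
    have h2 : ∑ p ∈ Nat.primesLE N, ((N : ℝ) * (log p / p) - log p) ≤
        ∑ p ∈ Nat.primesLE N, (N.factorial.factorization p : ℝ) * log p := by
      refine Finset.sum_le_sum fun p hp => ?_
      have hp' := Nat.prime_of_mem_primesLE hp
      have h3 := mul_le_mul_of_nonneg_right (div_sub_one_le_factorization_factorial (N := N) hp')
        (log_natCast_nonneg p)
      calc (N : ℝ) * (log p / p) - log p = (N / p - 1) * log p := by ring
        _ ≤ _ := h3
    rw [Finset.sum_sub_distrib] at h2
    linarith
  have hup : log (N.factorial : ℝ) ≤ N * ∑ p ∈ Nat.primesLE N, log p / p + N * C := by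
    rw [log_factorial_eq_sum_primesLE]
    have h1 := h (Nat.primesLE N) (fun p hp => Nat.two_le_of_mem_primesLE hp)
    have h2 : ∑ p ∈ Nat.primesLE N, (N.factorial.factorization p : ℝ) * log p ≤
        ∑ p ∈ Nat.primesLE N, ((N : ℝ) * (log p / p) +
          N * (log p * (1 / (p * (p - 1 : ℝ))))) := by
      refine Finset.sum_le_sum fun p hp => ?_
      have hp' := Nat.prime_of_mem_primesLE hp
      have h3 := mul_le_mul_of_nonneg_right (factorization_factorial_le_div (N := N) hp')
        (log_natCast_nonneg p)
      refine h3.trans (le_of_eq (by ring))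
    rw [Finset.sum_add_distrib, ← Finset.mul_sum, ← Finset.mul_sum] at h2
    nlinarith
  have hfac1 : log (N.factorial : ℝ) ≤ N * log N := by
    rw [← log_pow]
    exact log_le_log (by exact_mod_cast N.factorial_pos) (by exact_mod_cast N.factorial_le_pow)
  have hfac2 : N * log N - N ≤ log (N.factorial : ℝ) := by
    have h1 := Stirling.le_log_factorial_stirling (n := N) (by omega)
    have h2 : 0 ≤ log (N : ℝ) := log_natCast_nonneg N
    have h3 : 0 ≤ log (2 * π) := log_nonneg (by nlinarith [pi_gt_three])
    linarith
  rw [abs_le]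
  constructor
  · have : N * (log N - 1 - C) ≤ N * ∑ p ∈ Nat.primesLE N, log p / p := by nlinarith
    have := le_of_mul_le_mul_left this hN'
    linarith
  · have : N * ∑ p ∈ Nat.primesLE N, log p / p ≤ N * (log N + log 4) := by nlinarith
    have := le_of_mul_le_mul_left this hN'
    linarith

lemma sum_primesLE_succ (f : ℕ → ℝ) (N : ℕ) :
    ∑ p ∈ Nat.primesLE (N + 1), f p =
      ∑ p ∈ Nat.primesLE N, f p + if (N + 1).Prime then f (N + 1) else 0 := by
  rw [Nat.primesLE_eq_filter_range, Nat.primesLE_eq_filter_range, Finset.sum_filter,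
    Finset.sum_range_succ, Finset.sum_filter]

lemma exists_abs_sum_one_div_sub_loglog_le_nat :
    ∃ C : ℝ, 0 ≤ C ∧ ∀ N : ℕ, 2 ≤ N →
      |∑ p ∈ Nat.primesLE N, (1 : ℝ) / p - log (log N)| ≤ C := by
  obtain ⟨C, hC, h⟩ := exists_abs_sum_log_div_sub_log_le
  set E : ℕ → ℝ := fun N => ∑ p ∈ Nat.primesLE N, log p / p - log N with hE
  set Φ : ℕ → ℝ := fun N => ∑ p ∈ Nat.primesLE N, (1 : ℝ) / p - log (log N) - E N / log N with hΦ
  have key : ∀ N : ℕ, 2 ≤ N → |Φ N - Φ 2| ≤ (C + 1) * (1 / log 2 - 1 / log N) := by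
    intro N hN
    induction N, hN using Nat.le_induction with
    | base => simp
    | succ N hN ih =>
      have hN2 : (2 : ℝ) ≤ N := by exact_mod_cast hN
      have hl : 0 < log (N : ℝ) := log_pos (by linarith)
      have hl' : log (N : ℝ) ≤ log (N + 1 : ℝ) := log_le_log (by linarith) (by linarith)
      have hl1 : log (N + 1 : ℝ) ≤ log N + 1 := by
        have : log (N + 1 : ℝ) - log N = log ((N + 1) / N) := by
          rw [log_div (by linarith) (by linarith)]
        have h2 := log_le_sub_one_of_pos (show (0 : ℝ) < (N + 1) / N by positivity)
        have h3 : ((N : ℝ) + 1) / N - 1 ≤ 1 := by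
          rw [sub_le_iff_le_add, div_le_iff₀ (by linarith)]; linarith
        linarith
      have hstep : |Φ (N + 1) - Φ N| ≤ (C + 1) * (1 / log N - 1 / log (N + 1 : ℝ)) := by
        set a := log (N : ℝ) with ha
        set b := log (N + 1 : ℝ) with hb
        have hb0 : 0 < b := lt_of_lt_of_le hl hl'
        have e1 : E (N + 1) = E N + (if (N + 1).Prime then b / (N + 1) else 0) - (b - a) := by
          simp only [hE]
          rw [sum_primesLE_succ (fun p => log p / p)]
          push_cast
          rw [← ha, ← hb]; ring
        have e2 : Φ (N + 1) - Φ N =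
            (1 - a / b - (log b - log a)) + E N * (1 / a - 1 / b) := by
          simp only [hΦ]
          rw [e1, sum_primesLE_succ (fun p => (1 : ℝ) / p)]
          push_cast
          rw [← ha, ← hb]
          split_ifs <;> field_simp <;> ring
        have hd : 0 ≤ 1 / a - 1 / b := sub_nonneg.2 (one_div_le_one_div_of_le hl hl')
        have hE' : |E N| ≤ C := h N (by omega)
        have u1 : log (b / a) ≤ b / a - 1 := log_le_sub_one_of_pos (by positivity)
        have u2 : log (a / b) ≤ a / b - 1 := log_le_sub_one_of_pos (by positivity)
        rw [log_div hb0.ne' hl.ne'] at u1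
        rw [log_div hl.ne' hb0.ne'] at u2
        have u3 : b / a + a / b - 2 ≤ 1 / a - 1 / b := by
          have : b / a + a / b - 2 = (b - a) * (1 / a - 1 / b) := by field_simp; ring
          rw [this]
          exact mul_le_of_le_one_left hd (by linarith)
        rw [e2]
        have w1 : |1 - a / b - (log b - log a)| ≤ 1 / a - 1 / b := by
          rw [abs_le]; constructor <;> linarith
        have w2 : |E N * (1 / a - 1 / b)| ≤ C * (1 / a - 1 / b) := by
          rw [abs_mul, abs_of_nonneg hd]
          exact mul_le_mul_of_nonneg_right hE' hd
        refine (abs_add_le _ _).trans ?_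
        linarith
      have : Φ (N + 1) - Φ 2 = (Φ (N + 1) - Φ N) + (Φ N - Φ 2) := by ring
      rw [this]
      push_cast
      refine (abs_add_le _ _).trans ((add_le_add hstep ih).trans (le_of_eq (by ring)))
  have hlog2 : 0 < log (2 : ℝ) := log_pos (by norm_num)
  refine ⟨|Φ 2| + (C + 1) * (1 / log 2) + C / log 2, by positivity, fun N hN => ?_⟩
  have hN2 : (2 : ℝ) ≤ N := by exact_mod_cast hN
  have hlN : log 2 ≤ log (N : ℝ) := log_le_log (by norm_num) hN2
  have hlN0 : 0 < log (N : ℝ) := by linarith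
  have h1 := key N hN
  have h2 : |E N / log N| ≤ C / log 2 := by
    rw [abs_div, abs_of_pos hlN0]
    exact div_le_div₀ hC (h N (by omega)) hlog2 hlN
  have h3 : ∑ p ∈ Nat.primesLE N, (1 : ℝ) / p - log (log N) =
      Φ 2 + (Φ N - Φ 2) + E N / log N := by simp only [hΦ]; ring
  rw [h3]
  have h4 : (C + 1) * (1 / log 2 - 1 / log N) ≤ (C + 1) * (1 / log 2) := by
    have : 0 ≤ 1 / log (N : ℝ) := by positivity
    exact mul_le_mul_of_nonneg_left (by linarith) (by linarith)
  have h5 := abs_add_le (Φ 2 + (Φ N - Φ 2)) (E N / log N)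
  have h6 := abs_add_le (Φ 2) (Φ N - Φ 2)
  linarith

/-- **Mertens' second theorem**, with an unspecified constant. -/
lemma exists_abs_sum_one_div_sub_loglog_le :
    ∃ C : ℝ, 0 ≤ C ∧ ∀ y : ℝ, 2 ≤ y →
      |∑ p ∈ Nat.primesLE ⌊y⌋₊, (1 : ℝ) / p - log (log y)| ≤ C := by
  obtain ⟨C, hC, h⟩ := exists_abs_sum_one_div_sub_loglog_le_nat
  have hlog2 : 0 < log (2 : ℝ) := log_pos (by norm_num)
  refine ⟨C + log 2, by linarith, fun y hy => ?_⟩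
  have hN : 2 ≤ ⌊y⌋₊ := Nat.le_floor (by exact_mod_cast hy)
  have hN2 : (2 : ℝ) ≤ (⌊y⌋₊ : ℝ) := by exact_mod_cast hN
  have h1 := h _ hN
  have hl0 : log 2 ≤ log (⌊y⌋₊ : ℝ) := log_le_log (by norm_num) hN2
  have hl1 : log (⌊y⌋₊ : ℝ) ≤ log y := log_le_log (by linarith) (Nat.floor_le (by linarith))
  have hl2 : log y ≤ 2 * log (⌊y⌋₊ : ℝ) := by
    have : y ≤ (⌊y⌋₊ : ℝ) ^ 2 := by nlinarith [Nat.lt_floor_add_one y]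
    calc log y ≤ log ((⌊y⌋₊ : ℝ) ^ 2) := log_le_log (by linarith) this
      _ = _ := by rw [log_pow]; norm_num
  have h2 : log (log (⌊y⌋₊ : ℝ)) ≤ log (log y) := log_le_log (by linarith) hl1
  have h3 : log (log y) ≤ log 2 + log (log (⌊y⌋₊ : ℝ)) := by
    rw [← log_mul (by norm_num) (by linarith)]
    exact log_le_log (by linarith) hl2
  rw [abs_le] at h1 ⊢
  constructor <;> linarith [h1.1, h1.2]

/-- The `j`-th elementary symmetric sum of the weights `u p`, `p ∈ P`. -/
noncomputable def esum (P : Finset ℕ) (j : ℕ) (u : ℕ → ℝ) : ℝ :=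
  ∑ s ∈ P.powersetCard j, ∏ p ∈ s, u p

lemma esum_zero (P : Finset ℕ) (u : ℕ → ℝ) : esum P 0 u = 1 := by
  simp [esum]

lemma esum_one (P : Finset ℕ) (u : ℕ → ℝ) : esum P 1 u = ∑ p ∈ P, u p := by
  simp [esum, Finset.powersetCard_one, Finset.sum_map]

lemma esum_empty_succ (j : ℕ) (u : ℕ → ℝ) : esum ∅ (j + 1) u = 0 := by
  rw [esum, Finset.powersetCard_eq_empty.2 (by simp), Finset.sum_empty]

lemma esum_insert {P : Finset ℕ} {p : ℕ} (hp : p ∉ P) (j : ℕ) (u : ℕ → ℝ) :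
    esum (insert p P) (j + 1) u = esum P (j + 1) u + u p * esum P j u := by
  unfold esum
  rw [Finset.powersetCard_succ_insert hp, Finset.sum_union, Finset.sum_image, Finset.mul_sum]
  · congr 1
    refine Finset.sum_congr rfl fun s hs => ?_
    rw [Finset.prod_insert]
    exact fun h => hp ((Finset.mem_powersetCard.1 hs).1 h)
  · intro s hs t ht hst
    have hs' : p ∉ s := fun h => hp ((Finset.mem_powersetCard.1 hs).1 h)
    have ht' : p ∉ t := fun h => hp ((Finset.mem_powersetCard.1 ht).1 h)
    have := congrArg (fun a => Finset.erase a p) hst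
    simpa [hs', ht'] using this
  · rw [Finset.disjoint_left]
    intro s hs hs'
    obtain ⟨t, _, rfl⟩ := Finset.mem_image.1 hs'
    exact hp ((Finset.mem_powersetCard.1 hs).1 (Finset.mem_insert_self _ _))

lemma esum_nonneg {P : Finset ℕ} {u : ℕ → ℝ} (hu : ∀ p, 0 ≤ u p) (j : ℕ) : 0 ≤ esum P j u :=
  Finset.sum_nonneg fun _ _ => Finset.prod_nonneg fun p _ => hu p

lemma add_pow_succ_ge {a b : ℝ} (ha : 0 ≤ a) (hb : 0 ≤ b) (n : ℕ) :
    a ^ (n + 1) + (n + 1) * b * a ^ n ≤ (a + b) ^ (n + 1) := by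
  induction n with
  | zero => simp
  | succ n ih =>
    have h1 : (a ^ (n + 1) + (n + 1) * b * a ^ n) * (a + b) ≤ (a + b) ^ (n + 1 + 1) := by
      rw [pow_succ (a + b) (n + 1)]
      exact mul_le_mul_of_nonneg_right ih (by linarith)
    refine le_trans ?_ h1
    push_cast
    have : 0 ≤ ((n : ℝ) + 1) * b * a ^ n * b := by positivity
    ring_nf at this ⊢
    linarith

lemma esum_le_pow_div_factorial {u : ℕ → ℝ} (hu : ∀ p, 0 ≤ u p) (P : Finset ℕ) (j : ℕ) :
    esum P j u ≤ (∑ p ∈ P, u p) ^ j / j.factorial := by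
  induction P using Finset.induction_on generalizing j with
  | empty =>
    cases j with
    | zero => simp [esum]
    | succ j => simp [esum_empty_succ]
  | insert p P hp ih =>
    cases j with
    | zero => simp [esum_zero]
    | succ j =>
      rw [esum_insert hp, Finset.sum_insert hp]
      set σ := ∑ p ∈ P, u p with hσ
      have hσ0 : 0 ≤ σ := Finset.sum_nonneg fun p _ => hu p
      have h1 := ih (j + 1)
      have h2 := mul_le_mul_of_nonneg_left (ih j) (hu p)
      have h3 := add_pow_succ_ge hσ0 (hu p) j
      have hf : (0 : ℝ) < (j + 1).factorial := by positivity
      have h4 : σ ^ (j + 1) / (j + 1).factorial + u p * (σ ^ j / j.factorial) ≤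
          (u p + σ) ^ (j + 1) / (j + 1).factorial := by
        have : σ ^ (j + 1) / (j + 1).factorial + u p * (σ ^ j / j.factorial) =
            (σ ^ (j + 1) + (j + 1) * u p * σ ^ j) / (j + 1).factorial := by
          rw [Nat.factorial_succ]
          push_cast
          field_simp
        rw [this, add_comm (u p)]
        exact div_le_div_of_nonneg_right h3 hf.le
      linarith

lemma norm_one_add_mul_le_one {ξ : ℂ} (hξ : ‖1 + ξ‖ ≤ 1) {r : ℝ} (h0 : 0 ≤ r) (h1 : r ≤ 1) :
    ‖1 + ξ * r‖ ≤ 1 := by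
  have : 1 + ξ * r = ((1 - r : ℝ) : ℂ) + (r : ℂ) * (1 + ξ) := by push_cast; ring
  rw [this]
  refine (norm_add_le _ _).trans ?_
  rw [norm_mul, Complex.norm_real, Complex.norm_real, Real.norm_of_nonneg h0,
    Real.norm_of_nonneg (by linarith)]
  nlinarith [mul_le_mul_of_nonneg_left hξ h0]

/-- Truncation of the expansion of `∏ (1 + ξ u p)`: the error is at most the first omitted term. -/
lemma norm_prod_sub_sum_esum_le {ξ : ℂ} (hξ : ‖1 + ξ‖ ≤ 1) {u : ℕ → ℝ}
    (hu0 : ∀ p, 0 ≤ u p) (hu1 : ∀ p, u p ≤ 1) (P : Finset ℕ) (J : ℕ) :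
    ‖∏ p ∈ P, (1 + ξ * u p) - ∑ j ∈ Finset.range J, ξ ^ j * (esum P j u : ℂ)‖ ≤
      ‖ξ‖ ^ J * esum P J u := by
  induction P using Finset.induction_on with
  | empty =>
    cases J with
    | zero => simp [esum]
    | succ J =>
      rw [Finset.sum_range_succ']
      simp [esum_empty_succ, esum_zero]
  | insert p P hp ih =>
    rw [Finset.prod_insert hp]
    have hp1 := norm_one_add_mul_le_one hξ (hu0 p) (hu1 p)
    cases J with
    | zero =>
      simp only [Finset.range_zero, Finset.sum_empty, sub_zero, pow_zero, esum_zero, mul_one] at ih ⊢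
      rw [norm_mul]
      exact mul_le_one₀ hp1 (norm_nonneg _) ih
    | succ J =>
      have hsum : ∑ j ∈ Finset.range (J + 1), ξ ^ j * (esum (insert p P) j u : ℂ) =
          (1 + ξ * u p) * ∑ j ∈ Finset.range (J + 1), ξ ^ j * (esum P j u : ℂ) -
            ξ ^ (J + 1) * (u p * esum P J u : ℝ) := by
        have e1 : ∑ j ∈ Finset.range (J + 1), ξ ^ j * (esum (insert p P) j u : ℂ) =
            ∑ j ∈ Finset.range (J + 1), ξ ^ j * (esum P j u : ℂ) +
              ξ * u p * ∑ j ∈ Finset.range J, ξ ^ j * (esum P j u : ℂ) := by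
          rw [Finset.sum_range_succ', Finset.sum_range_succ' (fun j => ξ ^ j * (esum P j u : ℂ)),
            Finset.mul_sum]
          simp only [esum_insert hp, esum_zero]
          push_cast
          simp only [mul_add, Finset.sum_add_distrib]
          have : ∑ j ∈ Finset.range J, ξ ^ (j + 1) * ((u p : ℂ) * (esum P j u : ℂ)) =
              ∑ j ∈ Finset.range J, ξ * u p * (ξ ^ j * (esum P j u : ℂ)) :=
            Finset.sum_congr rfl fun j _ => by ring
          rw [this]; ring
        rw [e1, Finset.sum_range_succ]
        push_cast
        ring
      rw [hsum]
      have e2 : (1 + ξ * u p) * ∏ p ∈ P, (1 + ξ * u p) -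
          ((1 + ξ * u p) * ∑ j ∈ Finset.range (J + 1), ξ ^ j * (esum P j u : ℂ) -
            ξ ^ (J + 1) * (u p * esum P J u : ℝ)) =
          (1 + ξ * u p) * (∏ p ∈ P, (1 + ξ * u p) -
            ∑ j ∈ Finset.range (J + 1), ξ ^ j * (esum P j u : ℂ)) +
            ξ ^ (J + 1) * (u p * esum P J u : ℝ) := by ring
      rw [e2, esum_insert hp]
      refine (norm_add_le _ _).trans ?_
      rw [norm_mul, norm_mul, norm_pow, Complex.norm_real, mul_add,
        Real.norm_of_nonneg (mul_nonneg (hu0 p) (esum_nonneg hu0 J))]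
      refine add_le_add ?_ le_rfl
      calc _ ≤ 1 * _ := mul_le_mul_of_nonneg_right hp1 (norm_nonneg _)
        _ ≤ _ := by rw [one_mul]; exact ih

/-- Indicator of divisibility, as a real number. -/
noncomputable def dvdInd (z : ℤ) (d : ℕ) : ℝ := if (d : ℤ) ∣ z then 1 else 0

lemma dvdInd_nonneg (z : ℤ) (d : ℕ) : 0 ≤ dvdInd z d := by unfold dvdInd; split_ifs <;> norm_num

lemma dvdInd_le_one (z : ℤ) (d : ℕ) : dvdInd z d ≤ 1 := by unfold dvdInd; split_ifs <;> norm_num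

lemma prod_dvd_int_of_primes {s : Finset ℕ} (hs : ∀ p ∈ s, p.Prime) {z : ℤ}
    (h : ∀ p ∈ s, (p : ℤ) ∣ z) : ((∏ p ∈ s, p : ℕ) : ℤ) ∣ z := by
  rw [Int.natCast_dvd]
  refine Finset.prod_primes_dvd _ (fun p hp => (hs p hp).prime) fun p hp => ?_
  exact Int.natCast_dvd.1 (h p hp)

lemma prod_dvdInd {s : Finset ℕ} (hs : ∀ p ∈ s, p.Prime) (z : ℤ) :
    ∏ p ∈ s, dvdInd z p = dvdInd z (∏ p ∈ s, p) := by
  by_cases h : ∀ p ∈ s, (p : ℤ) ∣ z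
  · have h1 := prod_dvd_int_of_primes hs h
    rw [Finset.prod_eq_one (fun p hp => by simp [dvdInd, h p hp])]
    simp only [dvdInd, if_pos h1]
  · push Not at h
    obtain ⟨p, hp, hpz⟩ := h
    rw [Finset.prod_eq_zero hp (by simp [dvdInd, hpz])]
    have : ¬ ((∏ p ∈ s, p : ℕ) : ℤ) ∣ z := fun hd =>
      hpz (dvd_trans (by exact_mod_cast Finset.dvd_prod_of_mem (fun p => p) hp) hd)
    simp only [dvdInd, if_neg this]

lemma sum_powerset_prod_union (P : Finset ℕ) (f : ℕ → ℝ) :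
    ∑ s ∈ P.powerset, ∑ t ∈ P.powerset, ∏ p ∈ s ∪ t, f p = ∏ p ∈ P, (1 + 3 * f p) := by
  induction P using Finset.induction_on with
  | empty => simp
  | insert p P hp ih =>
    rw [Finset.prod_insert hp, ← ih, Finset.sum_powerset_insert hp]
    have hmem : ∀ s ∈ P.powerset, p ∉ s := fun s hs h => hp (Finset.mem_powerset.1 hs h)
    have e1 : ∀ s ∈ P.powerset, ∑ t ∈ (insert p P).powerset, ∏ p ∈ s ∪ t, f p =
        (1 + f p) * ∑ t ∈ P.powerset, ∏ p ∈ s ∪ t, f p := by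
      intro s hs
      rw [Finset.sum_powerset_insert hp, add_mul, one_mul, Finset.mul_sum]
      congr 1
      refine Finset.sum_congr rfl fun t ht => ?_
      rw [Finset.union_insert, Finset.prod_insert]
      simp [hmem s hs, hmem t ht]
    have e2 : ∀ s ∈ P.powerset, ∑ t ∈ (insert p P).powerset, ∏ p ∈ insert p s ∪ t, f p =
        (2 * f p) * ∑ t ∈ P.powerset, ∏ p ∈ s ∪ t, f p := by
      intro s hs
      rw [Finset.sum_powerset_insert hp, two_mul, add_mul, Finset.mul_sum]
      congr 1 <;>
      · refine Finset.sum_congr rfl fun t ht => ?_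
        have : insert p s ∪ insert p t = insert p (s ∪ t) := by grind
        try rw [this]
        try rw [Finset.insert_union]
        rw [Finset.prod_insert]
        simp [hmem s hs, hmem t ht]
    rw [Finset.sum_congr rfl e1, Finset.sum_congr rfl e2, ← Finset.mul_sum, ← Finset.mul_sum]
    ring

lemma sum_powersetCard_prod_union_le {P : Finset ℕ} {f : ℕ → ℝ} (hf : ∀ p, 0 ≤ f p) (j : ℕ) :
    ∑ s ∈ P.powersetCard j, ∑ t ∈ P.powersetCard j, ∏ p ∈ s ∪ t, f p ≤
      exp (3 * ∑ p ∈ P, f p) := by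
  have hsub : P.powersetCard j ⊆ P.powerset := fun s hs =>
    Finset.mem_powerset.2 (Finset.mem_powersetCard.1 hs).1
  have hn : ∀ s : Finset ℕ, 0 ≤ ∏ p ∈ s, f p := fun s => Finset.prod_nonneg fun p _ => hf p
  calc _ ≤ ∑ s ∈ P.powerset, ∑ t ∈ P.powersetCard j, ∏ p ∈ s ∪ t, f p :=
        Finset.sum_le_sum_of_subset_of_nonneg hsub
          fun s _ _ => Finset.sum_nonneg fun t _ => hn _
    _ ≤ ∑ s ∈ P.powerset, ∑ t ∈ P.powerset, ∏ p ∈ s ∪ t, f p :=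
        Finset.sum_le_sum fun s _ =>
          Finset.sum_le_sum_of_subset_of_nonneg hsub fun t _ _ => hn _
    _ = ∏ p ∈ P, (1 + 3 * f p) := sum_powerset_prod_union P f
    _ ≤ ∏ p ∈ P, exp (3 * f p) :=
        Finset.prod_le_prod (fun p _ => by have := hf p; positivity)
          fun p _ => by rw [add_comm]; exact add_one_le_exp _
    _ = _ := by rw [← exp_sum, Finset.mul_sum]

lemma card_Ioc_filter_modEq_bounds {d : ℕ} (hd : 0 < d) (K r : ℕ) :
    (K : ℝ) / d - 1 ≤ (((Finset.Ioc 0 K).filter (fun m => m ≡ r [MOD d])).card : ℝ) ∧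
    (((Finset.Ioc 0 K).filter (fun m => m ≡ r [MOD d])).card : ℝ) ≤ K / d + 1 := by
  have h := Nat.Ioc_filter_modEq_card 0 K hd r
  have hd' : (0 : ℚ) < d := by exact_mod_cast hd
  have a1 := Int.floor_le (((K : ℚ) - r) / d)
  have a2 := Int.lt_floor_add_one (((K : ℚ) - r) / d)
  have b1 := Int.floor_le ((((0 : ℕ) : ℚ) - r) / d)
  have b2 := Int.lt_floor_add_one ((((0 : ℕ) : ℚ) - r) / d)
  have e : ((K : ℚ) - r) / d - (((0 : ℕ) : ℚ) - r) / d = K / d := by push_cast; ring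
  have hK : (0 : ℚ) ≤ (K : ℚ) / d := by positivity
  have hQ : ((((Finset.Ioc 0 K).filter (fun m => m ≡ r [MOD d])).card : ℤ) : ℚ) =
      max ((⌊((K : ℚ) - r) / d⌋ : ℚ) - ⌊(((0 : ℕ) : ℚ) - r) / d⌋) 0 := by
    rw [h]; push_cast; rfl
  have c1 : (K : ℚ) / d - 1 ≤ ((((Finset.Ioc 0 K).filter (fun m => m ≡ r [MOD d])).card : ℤ) : ℚ) := by
    rw [hQ]
    refine le_max_of_le_left ?_
    linarith
  have c2 : ((((Finset.Ioc 0 K).filter (fun m => m ≡ r [MOD d])).card : ℤ) : ℚ) ≤ K / d + 1 := by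
    rw [hQ]
    refine max_le ?_ ?_ <;> linarith
  constructor
  · have := (Rat.cast_le (K := ℝ)).2 c1
    push_cast at this
    exact this
  · have := (Rat.cast_le (K := ℝ)).2 c2
    push_cast at this
    exact this

lemma card_filter_le_of_dvd_sub {d : ℕ} (hd : 0 < d) (K : ℕ) (A : ℕ → Prop) [DecidablePred A]
    (hA : ∀ m n, A m → A n → (d : ℤ) ∣ (m : ℤ) - n) :
    (((Finset.Ioc 0 K).filter A).card : ℝ) ≤ K / d + 1 := by
  rcases Finset.eq_empty_or_nonempty ((Finset.Ioc 0 K).filter A) with h | ⟨r, hr⟩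
  · rw [h]; simp; positivity
  · refine le_trans ?_ (card_Ioc_filter_modEq_bounds hd K r).2
    have hr' := (Finset.mem_filter.1 hr).2
    exact_mod_cast Finset.card_le_card fun m hm => by
      rw [Finset.mem_filter] at hm ⊢
      refine ⟨hm.1, ?_⟩
      rw [← Int.natCast_modEq_iff]
      exact Int.modEq_iff_dvd.2 (hA r m hr' hm.2)

lemma le_card_filter_dvd {d q : ℕ} (hd : 0 < d) (hq : Nat.Coprime q d) (K v : ℕ) :
    (K : ℝ) / d - 1 ≤
      (((Finset.Ioc 0 K).filter (fun m : ℕ => (d : ℤ) ∣ (q : ℤ) * m - v)).card : ℝ) := by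
  obtain ⟨b, hb⟩ := Int.mod_coprime hq
  set r : ℕ := (b * v % d).toNat with hr
  have hr' : (r : ℤ) = b * v % d :=
    Int.toNat_of_nonneg (Int.emod_nonneg _ (by exact_mod_cast hd.ne'))
  refine (card_Ioc_filter_modEq_bounds hd K r).1.trans ?_
  refine Nat.cast_le.2 (Finset.card_le_card fun m hm => ?_)
  · rw [Finset.mem_filter] at hm ⊢
    refine ⟨hm.1, ?_⟩
    have h1 : (m : ℤ) ≡ b * v [ZMOD d] := by
      have := (Int.natCast_modEq_iff).2 hm.2
      rw [hr'] at this
      exact this.trans (Int.mod_modEq _ _)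
    have h2 : (q : ℤ) * m ≡ v [ZMOD d] := by
      calc (q : ℤ) * m ≡ q * (b * v) [ZMOD d] := h1.mul_left _
        _ = q * b * v := by ring
        _ ≡ 1 * v [ZMOD d] := hb.mul_right _
        _ = v := one_mul _
    exact (Int.modEq_iff_dvd.1 h2.symm)

/-- Centred indicator of divisibility. -/
noncomputable def dvdDev (z : ℤ) (d : ℕ) : ℝ := dvdInd z d - 1 / d

/-- Deviation of the elementary symmetric sum of divisibility indicators from its mean. -/
noncomputable def esumDev (P : Finset ℕ) (j : ℕ) (z : ℤ) : ℝ :=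
  esum P j (dvdInd z) - esum P j (fun p => 1 / (p : ℝ))

lemma esumDev_eq {P : Finset ℕ} (hP : ∀ p ∈ P, p.Prime) (j : ℕ) (z : ℤ) :
    esumDev P j z = ∑ s ∈ P.powersetCard j, dvdDev z (∏ p ∈ s, p) := by
  unfold esumDev esum dvdDev
  rw [Finset.sum_sub_distrib]
  congr 1
  · refine Finset.sum_congr rfl fun s hs => prod_dvdInd (fun p hp => hP p ?_) z
    exact (Finset.mem_powersetCard.1 hs).1 hp
  · refine Finset.sum_congr rfl fun s _ => ?_
    push_cast
    simp

lemma sum_dvdDev_mul_le {a b q q' : ℕ} (ha : 0 < a) (hb : 0 < b) (hqa : Nat.Coprime q a)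
    (hqb : Nat.Coprime q' b) (K v : ℕ) :
    ∑ m ∈ Finset.Ioc 0 K, dvdDev ((q : ℤ) * m - v) a * dvdDev ((q' : ℤ) * m - v) b ≤
      (((Finset.Ioc 0 K).filter (fun m : ℕ =>
        (a : ℤ) ∣ (q : ℤ) * m - v ∧ (b : ℤ) ∣ (q' : ℤ) * m - v)).card : ℝ) +
      2 - K / (a * b) := by
  have e : ∀ m : ℕ, dvdDev ((q : ℤ) * m - v) a * dvdDev ((q' : ℤ) * m - v) b =
      (if (a : ℤ) ∣ (q : ℤ) * m - v ∧ (b : ℤ) ∣ (q' : ℤ) * m - v then (1 : ℝ) else 0) -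
      (if (a : ℤ) ∣ (q : ℤ) * m - v then (1 : ℝ) else 0) * (1 / b) -
      (if (b : ℤ) ∣ (q' : ℤ) * m - v then (1 : ℝ) else 0) * (1 / a) + 1 / (a * b) := by
    intro m
    unfold dvdDev dvdInd
    have hab : (1 : ℝ) / (a * b) = 1 / a * (1 / b) := by rw [one_div_mul_one_div]
    rw [hab]
    by_cases h1 : (a : ℤ) ∣ (q : ℤ) * m - v <;> by_cases h2 : (b : ℤ) ∣ (q' : ℤ) * m - v <;>
      simp only [h1, h2, and_self, and_true, and_false, if_true, if_false] <;> ring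
  rw [Finset.sum_congr rfl fun m _ => e m, Finset.sum_add_distrib, Finset.sum_sub_distrib,
    Finset.sum_sub_distrib, ← Finset.sum_mul, ← Finset.sum_mul, Finset.sum_boole, Finset.sum_boole,
    Finset.sum_boole, Finset.sum_const, Nat.card_Ioc, nsmul_eq_mul, Nat.sub_zero]
  have h1 := le_card_filter_dvd ha hqa K v
  have h2 := le_card_filter_dvd hb hqb K v
  have ha' : (1 : ℝ) ≤ a := by exact_mod_cast ha
  have hb' : (1 : ℝ) ≤ b := by exact_mod_cast hb
  have ia : 1 / (a : ℝ) ≤ 1 := by rw [div_le_one (by linarith)]; exact ha'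
  have ib : 1 / (b : ℝ) ≤ 1 := by rw [div_le_one (by linarith)]; exact hb'
  have h1' := mul_le_mul_of_nonneg_right h1 (show 0 ≤ 1 / (b : ℝ) by positivity)
  have h2' := mul_le_mul_of_nonneg_right h2 (show 0 ≤ 1 / (a : ℝ) by positivity)
  have e1 : ((K : ℝ) / a - 1) * (1 / b) = K / (a * b) - 1 / b := by
    field_simp
  have e2 : ((K : ℝ) / b - 1) * (1 / a) = K / (a * b) - 1 / a := by
    field_simp
  have e3 : (K : ℝ) * (1 / (a * b)) = K / (a * b) := by ring
  rw [e1] at h1'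
  rw [e2] at h2'
  rw [e3]
  linarith

section correlation

variable {P : Finset ℕ} {w : ℕ}

lemma coprime_prod_of_le {s : Finset ℕ} (hs : ∀ p ∈ s, p.Prime ∧ w < p) {q : ℕ} (hq0 : 0 < q)
    (hq : q ≤ w) : Nat.Coprime q (∏ p ∈ s, p) := by
  refine Nat.Coprime.prod_right fun p hp => ?_
  refine ((Nat.Prime.coprime_iff_not_dvd (hs p hp).1).2 fun h => ?_).symm
  have := Nat.le_of_dvd hq0 h
  have := (hs p hp).2
  omega

lemma card_joint_le {s t : Finset ℕ} (hs : ∀ p ∈ s, p.Prime ∧ w < p)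
    (ht : ∀ p ∈ t, p.Prime ∧ w < p) {q q' : ℕ} (hq0 : 0 < q) (hq : q ≤ w) (hq0' : 0 < q')
    (hq' : q' ≤ w) (K v : ℕ) :
    (((Finset.Ioc 0 K).filter (fun m : ℕ => ((∏ p ∈ s, p : ℕ) : ℤ) ∣ (q : ℤ) * m - v ∧
      ((∏ p ∈ t, p : ℕ) : ℤ) ∣ (q' : ℤ) * m - v)).card : ℝ) ≤ K / (∏ p ∈ s ∪ t, p : ℕ) + 1 := by
  have hst : ∀ p ∈ s ∪ t, p.Prime ∧ w < p := fun p hp => by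
    rcases Finset.mem_union.1 hp with h | h
    exacts [hs p h, ht p h]
  have key : ∀ (s : Finset ℕ) (q m n p : ℕ), 0 < q → q ≤ w → p.Prime ∧ w < p → p ∈ s →
      ((∏ p ∈ s, p : ℕ) : ℤ) ∣ (q : ℤ) * m - v → ((∏ p ∈ s, p : ℕ) : ℤ) ∣ (q : ℤ) * n - v →
      (p : ℤ) ∣ (m : ℤ) - n := by
    intro s q m n p hq0 hq hp hps h1 h2
    have hps' : (p : ℤ) ∣ ((∏ p ∈ s, p : ℕ) : ℤ) := by
      exact_mod_cast Finset.dvd_prod_of_mem (fun p => p) hps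
    have h3 : (p : ℤ) ∣ (q : ℤ) * ((m : ℤ) - n) := by
      have := dvd_sub (hps'.trans h1) (hps'.trans h2)
      have e : (q : ℤ) * m - v - ((q : ℤ) * n - v) = q * ((m : ℤ) - n) := by ring
      rwa [e] at this
    rcases (Nat.prime_iff_prime_int.1 hp.1).dvd_or_dvd h3 with h | h
    · have := Nat.le_of_dvd hq0 (Int.natCast_dvd_natCast.1 h)
      have := hp.2
      omega
    · exact h
  refine card_filter_le_of_dvd_sub (Finset.prod_pos fun p hp => (hst p hp).1.pos) K _ ?_
  rintro m n ⟨h1, h2⟩ ⟨h3, h4⟩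
  refine prod_dvd_int_of_primes (fun p hp => (hst p hp).1) fun p hp => ?_
  rcases Finset.mem_union.1 hp with h | h
  · exact key s q m n p hq0 hq (hs p h) h h1 h3
  · exact key t q' m n p hq0' hq' (ht p h) h h2 h4

lemma card_joint_eq_zero {s t : Finset ℕ} (hs : ∀ p ∈ s, p.Prime ∧ w < p)
    (hst : ¬ Disjoint s t) {q q' : ℕ} (hq : q ≤ w)
    (hq' : q' ≤ w) (hne : q ≠ q') (K : ℕ) {v : ℕ} (hv0 : 0 < v) (hv : v ≤ w) :
    ((Finset.Ioc 0 K).filter (fun m : ℕ => ((∏ p ∈ s, p : ℕ) : ℤ) ∣ (q : ℤ) * m - v ∧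
      ((∏ p ∈ t, p : ℕ) : ℤ) ∣ (q' : ℤ) * m - v)).card = 0 := by
  rw [Finset.card_eq_zero, Finset.filter_eq_empty_iff]
  rintro m - ⟨h1, h2⟩
  obtain ⟨p, hps, hpt⟩ := Finset.not_disjoint_iff.1 hst
  have hps' : (p : ℤ) ∣ ((∏ p ∈ s, p : ℕ) : ℤ) := by
    exact_mod_cast Finset.dvd_prod_of_mem (fun p => p) hps
  have hpt' : (p : ℤ) ∣ ((∏ p ∈ t, p : ℕ) : ℤ) := by
    exact_mod_cast Finset.dvd_prod_of_mem (fun p => p) hpt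
  have h3 : (p : ℤ) ∣ ((q : ℤ) - q') * v := by
    have := dvd_sub ((hps'.trans h1).mul_left q') ((hpt'.trans h2).mul_left q)
    have e : (q' : ℤ) * ((q : ℤ) * m - v) - q * ((q' : ℤ) * m - v) = ((q : ℤ) - q') * v := by ring
    rwa [e] at this
  have hpw := (hs p hps).2
  rcases (Nat.prime_iff_prime_int.1 (hs p hps).1).dvd_or_dvd h3 with h | h
  · have h5 : ((q : ℤ) - q') ≠ 0 := by omega
    have := Int.le_of_dvd (abs_pos.2 h5) ((dvd_abs _ _).2 h)
    have h6 : |(q : ℤ) - q'| ≤ w := by rw [abs_le]; omega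
    omega
  · have := Nat.le_of_dvd hv0 (Int.natCast_dvd_natCast.1 h)
    omega

lemma sum_dvdDev_mul_le_of_ne {s t : Finset ℕ} (hs : ∀ p ∈ s, p.Prime ∧ w < p)
    (ht : ∀ p ∈ t, p.Prime ∧ w < p) {q q' : ℕ} (hq0 : 0 < q) (hq : q ≤ w) (hq0' : 0 < q')
    (hq' : q' ≤ w) (hne : q ≠ q') (K : ℕ) {v : ℕ} (hv0 : 0 < v) (hv : v ≤ w) :
    ∑ m ∈ Finset.Ioc 0 K, dvdDev ((q : ℤ) * m - v) (∏ p ∈ s, p) *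
      dvdDev ((q' : ℤ) * m - v) (∏ p ∈ t, p) ≤ 3 := by
  refine (sum_dvdDev_mul_le (Finset.prod_pos fun p hp => (hs p hp).1.pos)
    (Finset.prod_pos fun p hp => (ht p hp).1.pos) (coprime_prod_of_le hs hq0 hq)
    (coprime_prod_of_le ht hq0' hq') K v).trans ?_
  by_cases hd : Disjoint s t
  · have := card_joint_le hs ht hq0 hq hq0' hq' K v
    rw [Finset.prod_union hd, Nat.cast_mul] at this
    linarith
  · rw [card_joint_eq_zero hs hd hq hq' hne K hv0 hv]
    have : (0 : ℝ) ≤ K / ((∏ p ∈ s, p : ℕ) * (∏ p ∈ t, p : ℕ)) := by positivity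
    push_cast at this ⊢
    linarith

lemma sum_dvdDev_mul_le_self {s t : Finset ℕ} (hs : ∀ p ∈ s, p.Prime ∧ w < p)
    (ht : ∀ p ∈ t, p.Prime ∧ w < p) {q : ℕ} (hq0 : 0 < q) (hq : q ≤ w) (K v : ℕ) :
    ∑ m ∈ Finset.Ioc 0 K, dvdDev ((q : ℤ) * m - v) (∏ p ∈ s, p) *
      dvdDev ((q : ℤ) * m - v) (∏ p ∈ t, p) ≤ 3 + K * ∏ p ∈ s ∪ t, (1 / (p : ℝ)) := by
  refine (sum_dvdDev_mul_le (Finset.prod_pos fun p hp => (hs p hp).1.pos)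
    (Finset.prod_pos fun p hp => (ht p hp).1.pos) (coprime_prod_of_le hs hq0 hq)
    (coprime_prod_of_le ht hq0 hq) K v).trans ?_
  have h1 := card_joint_le hs ht hq0 hq hq0 hq K v
  have : (0 : ℝ) ≤ K / ((∏ p ∈ s, p : ℕ) * (∏ p ∈ t, p : ℕ)) := by positivity
  have e : (K : ℝ) * ∏ p ∈ s ∪ t, (1 / (p : ℝ)) = K / (∏ p ∈ s ∪ t, p : ℕ) := by
    push_cast
    simp [div_eq_mul_inv]
  rw [e]
  linarith

lemma card_powersetCard_le_pow (P : Finset ℕ) (j : ℕ) :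
    ((P.powersetCard j).card : ℝ) ≤ (P.card : ℝ) ^ j := by
  rw [Finset.card_powersetCard]
  exact_mod_cast Nat.choose_le_pow _ _

/-- The sum over `q ∈ R` of the deviations along `n = q m ≤ N`. -/
noncomputable def devSum (R P : Finset ℕ) (N j v m : ℕ) : ℝ :=
  ∑ q ∈ R, if q * m ≤ N then esumDev P j ((q : ℤ) * m - v) else 0

lemma sum_ite_esumDev_mul_le (hP : ∀ p ∈ P, p.Prime ∧ w < p) {q q' : ℕ} (hq0 : 0 < q) (hq : q ≤ w)
    (hq0' : 0 < q') (hq' : q' ≤ w) (M N j : ℕ) {v : ℕ} (hv0 : 0 < v) (hv : v ≤ w) :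
    ∑ m ∈ Finset.Ioc 0 M, (if q * m ≤ N then esumDev P j ((q : ℤ) * m - v) else 0) *
      (if q' * m ≤ N then esumDev P j ((q' : ℤ) * m - v) else 0) ≤
    3 * ((P.card : ℝ) ^ j) ^ 2 +
      if q = q' then N * (1 / (q : ℝ)) * exp (3 * ∑ p ∈ P, 1 / (p : ℝ)) else 0 := by
  set K := min M (min (N / q) (N / q')) with hK
  have hPp : ∀ p ∈ P, p.Prime := fun p hp => (hP p hp).1
  have e1 : ∑ m ∈ Finset.Ioc 0 M, (if q * m ≤ N then esumDev P j ((q : ℤ) * m - v) else 0) *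
      (if q' * m ≤ N then esumDev P j ((q' : ℤ) * m - v) else 0) =
      ∑ m ∈ Finset.Ioc 0 K, esumDev P j ((q : ℤ) * m - v) * esumDev P j ((q' : ℤ) * m - v) := by
    have hsub : Finset.Ioc 0 K ⊆ Finset.Ioc 0 M :=
      Finset.Ioc_subset_Ioc_right (min_le_left _ _)
    rw [← Finset.sum_subset hsub]
    · refine Finset.sum_congr rfl fun m hm => ?_
      have hm' := (Finset.mem_Ioc.1 hm).2
      have h1 : m ≤ N / q := hm'.trans ((min_le_right _ _).trans (min_le_left _ _))
      have h2 : m ≤ N / q' := hm'.trans ((min_le_right _ _).trans (min_le_right _ _))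
      rw [Nat.le_div_iff_mul_le hq0, mul_comm] at h1
      rw [Nat.le_div_iff_mul_le hq0', mul_comm] at h2
      rw [if_pos h1, if_pos h2]
    · intro m hm hmK
      rw [Finset.mem_Ioc] at hm hmK
      by_cases h1 : q * m ≤ N
      · by_cases h2 : q' * m ≤ N
        · exfalso
          refine hmK ⟨hm.1, le_min hm.2 (le_min ?_ ?_)⟩
          · rw [Nat.le_div_iff_mul_le hq0, mul_comm]; exact h1
          · rw [Nat.le_div_iff_mul_le hq0', mul_comm]; exact h2
        · rw [if_neg h2, mul_zero]
      · rw [if_neg h1, zero_mul]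
  rw [e1]
  have e2 : ∑ m ∈ Finset.Ioc 0 K, esumDev P j ((q : ℤ) * m - v) * esumDev P j ((q' : ℤ) * m - v) =
      ∑ s ∈ P.powersetCard j, ∑ t ∈ P.powersetCard j, ∑ m ∈ Finset.Ioc 0 K,
        dvdDev ((q : ℤ) * m - v) (∏ p ∈ s, p) * dvdDev ((q' : ℤ) * m - v) (∏ p ∈ t, p) := by
    simp_rw [esumDev_eq hPp, Finset.sum_mul_sum]
    rw [Finset.sum_comm]
    refine Finset.sum_congr rfl fun s _ => Finset.sum_comm
  rw [e2]
  have hmem : ∀ s ∈ P.powersetCard j, ∀ p ∈ s, p.Prime ∧ w < p := fun s hs p hp =>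
    hP p ((Finset.mem_powersetCard.1 hs).1 hp)
  have hC : ∑ s ∈ P.powersetCard j, ∑ t ∈ P.powersetCard j, (3 : ℝ) ≤
      3 * ((P.card : ℝ) ^ j) ^ 2 := by
    simp only [Finset.sum_const, nsmul_eq_mul]
    have := card_powersetCard_le_pow P j
    have h0 : (0 : ℝ) ≤ ((P.powersetCard j).card : ℝ) := by positivity
    nlinarith
  by_cases hqq : q = q'
  · subst hqq
    rw [if_pos rfl]
    calc _ ≤ ∑ s ∈ P.powersetCard j, ∑ t ∈ P.powersetCard j,
          (3 + K * ∏ p ∈ s ∪ t, (1 / (p : ℝ))) :=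
          Finset.sum_le_sum fun s hs => Finset.sum_le_sum fun t ht =>
            sum_dvdDev_mul_le_self (hmem s hs) (hmem t ht) hq0 hq K v
      _ = ∑ s ∈ P.powersetCard j, ∑ t ∈ P.powersetCard j, (3 : ℝ) +
          K * ∑ s ∈ P.powersetCard j, ∑ t ∈ P.powersetCard j, ∏ p ∈ s ∪ t, (1 / (p : ℝ)) := by
          simp only [Finset.sum_add_distrib, Finset.mul_sum]
      _ ≤ _ := by
          refine add_le_add hC ?_
          have hKN : (K : ℝ) ≤ N * (1 / (q : ℝ)) := by
            have : K ≤ N / q := (min_le_right _ _).trans (min_le_left _ _)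
            calc (K : ℝ) ≤ ((N / q : ℕ) : ℝ) := by exact_mod_cast this
              _ ≤ (N : ℝ) / q := Nat.cast_div_le
              _ = _ := by ring
          refine mul_le_mul hKN (sum_powersetCard_prod_union_le (fun p => by positivity) j) ?_
            (by positivity)
          exact Finset.sum_nonneg fun s _ => Finset.sum_nonneg fun t _ =>
            Finset.prod_nonneg fun p _ => by positivity
  · rw [if_neg hqq, add_zero]
    refine le_trans ?_ hC
    exact Finset.sum_le_sum fun s hs => Finset.sum_le_sum fun t ht =>
      sum_dvdDev_mul_le_of_ne (hmem s hs) (hmem t ht) hq0 hq hq0' hq' hqq K hv0 hv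

lemma sq_sum_abs_devSum_le {R : Finset ℕ} (hP : ∀ p ∈ P, p.Prime ∧ w < p)
    (hR : ∀ q ∈ R, 0 < q ∧ q ≤ w) (M N j : ℕ) {v : ℕ} (hv0 : 0 < v) (hv : v ≤ w) :
    (∑ m ∈ Finset.Ioc 0 M, |devSum R P N j v m|) ^ 2 ≤
      M * (3 * (R.card : ℝ) ^ 2 * ((P.card : ℝ) ^ j) ^ 2 +
        N * (∑ q ∈ R, 1 / (q : ℝ)) * exp (3 * ∑ p ∈ P, 1 / (p : ℝ))) := by
  refine (sq_sum_le_card_mul_sum_sq).trans ?_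
  rw [Nat.card_Ioc, Nat.sub_zero]
  refine mul_le_mul_of_nonneg_left ?_ (by positivity)
  have e : ∑ m ∈ Finset.Ioc 0 M, |devSum R P N j v m| ^ 2 =
      ∑ q ∈ R, ∑ q' ∈ R, ∑ m ∈ Finset.Ioc 0 M,
        (if q * m ≤ N then esumDev P j ((q : ℤ) * m - v) else 0) *
        (if q' * m ≤ N then esumDev P j ((q' : ℤ) * m - v) else 0) := by
    simp_rw [sq_abs, sq, devSum, Finset.sum_mul_sum]
    rw [Finset.sum_comm]
    refine Finset.sum_congr rfl fun s _ => Finset.sum_comm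
  rw [e]
  calc _ ≤ ∑ q ∈ R, ∑ q' ∈ R, (3 * ((P.card : ℝ) ^ j) ^ 2 +
      if q = q' then N * (1 / (q : ℝ)) * exp (3 * ∑ p ∈ P, 1 / (p : ℝ)) else 0) :=
        Finset.sum_le_sum fun q hq => Finset.sum_le_sum fun q' hq' =>
          sum_ite_esumDev_mul_le hP (hR q hq).1 (hR q hq).2 (hR q' hq').1 (hR q' hq').2 M N j hv0 hv
    _ = _ := by
      simp only [Finset.sum_add_distrib, Finset.sum_const, nsmul_eq_mul, Finset.sum_ite_eq]
      rw [Finset.sum_ite_mem, Finset.inter_self, ← Finset.sum_mul, ← Finset.mul_sum]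
      ring

end correlation

lemma sum_card_divisors_le (K : ℕ) :
    ∑ m ∈ Finset.Ioc 0 K, (m.divisors.card : ℝ) ≤ K * (1 + log K) := by
  have h := ArithmeticFunction.sum_Ioc_sigma0_eq_sum_div K
  simp only [ArithmeticFunction.sigma_zero_apply] at h
  have h' : ∑ m ∈ Finset.Ioc 0 K, (m.divisors.card : ℝ) =
      ∑ m ∈ Finset.Ioc 0 K, ((K / m : ℕ) : ℝ) := by exact_mod_cast h
  rw [h']
  calc _ ≤ ∑ m ∈ Finset.Ioc 0 K, (K : ℝ) * (m : ℝ)⁻¹ :=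
        Finset.sum_le_sum fun m _ => by rw [← div_eq_mul_inv]; exact Nat.cast_div_le
    _ = K * ((harmonic K : ℚ) : ℝ) := by
        rw [harmonic_eq_sum_Icc, ← Finset.mul_sum]
        push_cast
        rfl
    _ ≤ _ := mul_le_mul_of_nonneg_left (harmonic_le_one_add_log K) (by positivity)

/-- Few integers have many divisors. -/
lemma card_filter_lt_card_divisors_mul_le (K V : ℕ) :
    (((Finset.Ioc 0 K).filter (fun m => V < 2 * m.divisors.card)).card : ℝ) * V ≤
      2 * (K * (1 + log K)) := by
  calc _ = ∑ m ∈ (Finset.Ioc 0 K).filter (fun m => V < 2 * m.divisors.card), (V : ℝ) := by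
        rw [Finset.sum_const, nsmul_eq_mul]
    _ ≤ ∑ m ∈ (Finset.Ioc 0 K).filter (fun m => V < 2 * m.divisors.card),
          2 * (m.divisors.card : ℝ) := Finset.sum_le_sum fun m hm => by
        exact_mod_cast (Finset.mem_filter.1 hm).2.le
    _ ≤ ∑ m ∈ Finset.Ioc 0 K, 2 * (m.divisors.card : ℝ) :=
        Finset.sum_le_sum_of_subset_of_nonneg (Finset.filter_subset _ _) fun _ _ _ => by positivity
    _ ≤ _ := by
        rw [← Finset.mul_sum]
        exact mul_le_mul_of_nonneg_left (sum_card_divisors_le K) (by norm_num)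

lemma sum_dvdInd_mul_eq {q : ℕ} (hq : 0 < q) {N M : ℕ} (hM : N / q ≤ M) (g : ℕ → ℂ) :
    ∑ n ∈ Finset.Ioc 0 N, (dvdInd n q : ℂ) * g n =
      ∑ m ∈ Finset.Ioc 0 M, if q * m ≤ N then g (q * m) else 0 := by
  have e1 : ∀ n ∈ Finset.Ioc 0 N, (dvdInd n q : ℂ) * g n = if q ∣ n then g n else 0 := by
    intro n _
    unfold dvdInd
    simp only [Int.natCast_dvd_natCast]
    split_ifs <;> simp
  rw [Finset.sum_congr rfl e1, ← Finset.sum_filter, ← Finset.sum_filter]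
  refine Finset.sum_nbij' (fun n => n / q) (fun m => q * m) ?_ ?_ ?_ ?_ ?_
  · intro n hn
    simp only [Finset.mem_filter, Finset.mem_Ioc] at hn ⊢
    obtain ⟨⟨h0, hN⟩, k, rfl⟩ := hn
    rw [Nat.mul_div_cancel_left _ hq]
    refine ⟨⟨Nat.pos_of_mul_pos_left h0, ?_⟩, hN⟩
    refine le_trans ?_ hM
    rw [Nat.le_div_iff_mul_le hq, mul_comm]
    exact hN
  · intro m hm
    simp only [Finset.mem_filter, Finset.mem_Ioc] at hm ⊢
    exact ⟨⟨Nat.mul_pos hq hm.1.1, hm.2⟩, dvd_mul_right _ _⟩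
  · intro n hn
    exact Nat.mul_div_cancel' (Finset.mem_filter.1 hn).2
  · intro m _
    exact Nat.mul_div_cancel_left _ hq
  · intro n hn
    rw [Nat.mul_div_cancel' (Finset.mem_filter.1 hn).2]

lemma sum_dvdInd (N q : ℕ) : ∑ n ∈ Finset.Ioc 0 N, dvdInd n q = ((N / q : ℕ) : ℝ) := by
  unfold dvdInd
  rw [Finset.sum_boole]
  simp only [Int.natCast_dvd_natCast]
  rw [Nat.Ioc_filter_dvd_card_eq_div]

lemma dvdInd_mul_of_ne {q q' : ℕ} (hq : q.Prime) (hq' : q'.Prime) (h : q ≠ q') (z : ℤ) :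
    dvdInd z q * dvdInd z q' = dvdInd z (q * q') := by
  have := prod_dvdInd (s := {q, q'}) (by simp [hq, hq']) z
  simpa [Finset.prod_pair h] using this

/-- Turán's variance bound for the number of prime factors in a set `R`. -/
lemma sum_sq_sub_le {R : Finset ℕ} (hR : ∀ q ∈ R, q.Prime) {N : ℕ} (hRN : R.card ≤ N) :
    ∑ n ∈ Finset.Ioc 0 N, (∑ q ∈ R, dvdInd n q - ∑ q ∈ R, 1 / (q : ℝ)) ^ 2 ≤
      3 * N * ∑ q ∈ R, 1 / (q : ℝ) := by
  set S := ∑ q ∈ R, 1 / (q : ℝ) with hS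
  have hS0 : 0 ≤ S := Finset.sum_nonneg fun q _ => by positivity
  have e : ∀ n ∈ Finset.Ioc 0 N, (∑ q ∈ R, dvdInd n q - S) ^ 2 =
      (∑ q ∈ R, ∑ q' ∈ R, dvdInd n q * dvdInd n q') - 2 * S * ∑ q ∈ R, dvdInd n q + S ^ 2 := by
    intro n _
    rw [← Finset.sum_mul_sum]
    ring
  rw [Finset.sum_congr rfl e, Finset.sum_add_distrib, Finset.sum_sub_distrib, ← Finset.mul_sum,
    Finset.sum_const, Nat.card_Ioc, Nat.sub_zero, nsmul_eq_mul]
  have h1 : ∑ n ∈ Finset.Ioc 0 N, ∑ q ∈ R, dvdInd n q ≥ N * S - R.card := by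
    rw [Finset.sum_comm, hS, Finset.mul_sum]
    have : (R.card : ℝ) = ∑ q ∈ R, (1 : ℝ) := by simp
    rw [this, ← Finset.sum_sub_distrib]
    refine Finset.sum_le_sum fun q hq => ?_
    rw [sum_dvdInd]
    have := Nat.lt_floor_add_one ((N : ℝ) / q)
    rw [Nat.floor_div_eq_div] at this
    have e : (N : ℝ) * (1 / q) = N / q := by ring
    rw [e]
    linarith
  have h2 : ∑ n ∈ Finset.Ioc 0 N, ∑ q ∈ R, ∑ q' ∈ R, dvdInd n q * dvdInd n q' ≤
      N * S ^ 2 + N * S := by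
    have e1 : ∑ n ∈ Finset.Ioc 0 N, ∑ q ∈ R, ∑ q' ∈ R, dvdInd n q * dvdInd n q' =
        ∑ q ∈ R, ∑ q' ∈ R, ∑ n ∈ Finset.Ioc 0 N, dvdInd n q * dvdInd n q' := by
      rw [Finset.sum_comm]
      exact Finset.sum_congr rfl fun q _ => Finset.sum_comm
    rw [e1]
    calc _ ≤ ∑ q ∈ R, ∑ q' ∈ R, (N * (1 / (q : ℝ) * (1 / (q' : ℝ))) +
          if q = q' then N * (1 / (q : ℝ)) else 0) := by
          refine Finset.sum_le_sum fun q hq => Finset.sum_le_sum fun q' hq' => ?_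
          by_cases h : q = q'
          · subst h
            rw [if_pos rfl]
            have : ∑ n ∈ Finset.Ioc 0 N, dvdInd n q * dvdInd n q ≤ N / q := by
              calc _ = ∑ n ∈ Finset.Ioc 0 N, dvdInd n q := by
                    refine Finset.sum_congr rfl fun n _ => ?_
                    unfold dvdInd; split_ifs <;> simp
                _ ≤ _ := by rw [sum_dvdInd]; exact Nat.cast_div_le
            have h3 : 0 ≤ (N : ℝ) * (1 / (q : ℝ) * (1 / (q : ℝ))) := by positivity
            have e : (N : ℝ) * (1 / q) = N / q := by ring
            linarith
          · rw [if_neg h, add_zero]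
            simp_rw [dvdInd_mul_of_ne (hR q hq) (hR q' hq') h]
            rw [sum_dvdInd]
            refine Nat.cast_div_le.trans (le_of_eq ?_)
            push_cast
            field_simp
      _ = _ := by
          simp only [Finset.sum_add_distrib, Finset.sum_ite_eq]
          rw [Finset.sum_ite_mem, Finset.inter_self, hS, sq, Finset.sum_mul_sum]
          simp only [Finset.mul_sum]
  have hRN' : (R.card : ℝ) ≤ N := by exact_mod_cast hRN
  have h3 := mul_le_mul_of_nonneg_left h1 (show 0 ≤ 2 * S by positivity)
  have h4 := mul_le_mul_of_nonneg_left hRN' (show 0 ≤ 2 * S by positivity)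
  nlinarith

/-- Transfer of a mean value to multiples of the primes in `R`. -/
lemma norm_sum_mul_le {R : Finset ℕ} (hR : ∀ q ∈ R, q.Prime) {N M : ℕ} (hRN : R.card ≤ N)
    (hM : ∀ q ∈ R, N / q ≤ M) {g : ℕ → ℂ} {c : ℝ} (hg : ∀ n, ‖g n‖ ≤ c) :
    (∑ q ∈ R, 1 / (q : ℝ)) * ‖∑ n ∈ Finset.Ioc 0 N, g n‖ ≤
      ‖∑ q ∈ R, ∑ m ∈ Finset.Ioc 0 M, if q * m ≤ N then g (q * m) else 0‖ +
        c * (N * √(3 * ∑ q ∈ R, 1 / (q : ℝ))) := by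
  set S := ∑ q ∈ R, 1 / (q : ℝ) with hS
  have hS0 : 0 ≤ S := Finset.sum_nonneg fun q _ => by positivity
  have hc : 0 ≤ c := (norm_nonneg _).trans (hg 0)
  have e1 : ∑ q ∈ R, ∑ m ∈ Finset.Ioc 0 M, (if q * m ≤ N then g (q * m) else 0) =
      ∑ n ∈ Finset.Ioc 0 N, ((∑ q ∈ R, dvdInd n q : ℝ) : ℂ) * g n := by
    rw [Finset.sum_congr rfl fun q hq => (sum_dvdInd_mul_eq (hR q hq).pos (hM q hq) g).symm,
      Finset.sum_comm]
    refine Finset.sum_congr rfl fun n _ => ?_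
    push_cast
    rw [Finset.sum_mul]
  have e2 : (S : ℂ) * ∑ n ∈ Finset.Ioc 0 N, g n =
      ∑ n ∈ Finset.Ioc 0 N, ((∑ q ∈ R, dvdInd n q : ℝ) : ℂ) * g n -
      ∑ n ∈ Finset.Ioc 0 N, ((∑ q ∈ R, dvdInd n q - S : ℝ) : ℂ) * g n := by
    rw [← Finset.sum_sub_distrib, Finset.mul_sum]
    refine Finset.sum_congr rfl fun n _ => ?_
    push_cast
    ring
  have e3 : S * ‖∑ n ∈ Finset.Ioc 0 N, g n‖ = ‖(S : ℂ) * ∑ n ∈ Finset.Ioc 0 N, g n‖ := by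
    rw [norm_mul, Complex.norm_real, Real.norm_of_nonneg hS0]
  rw [e3, e2, e1]
  refine (norm_sub_le _ _).trans (add_le_add le_rfl ?_)
  have h1 : (∑ n ∈ Finset.Ioc 0 N, |∑ q ∈ R, dvdInd n q - S|) ≤ N * √(3 * S) := by
    refine abs_le_of_sq_le_sq' ?_ (by positivity) |>.2
    refine (sq_sum_le_card_mul_sum_sq).trans ?_
    rw [Nat.card_Ioc, Nat.sub_zero, mul_pow, Real.sq_sqrt (by positivity), sq, mul_assoc]
    refine mul_le_mul_of_nonneg_left ?_ (by positivity)
    simp_rw [sq_abs]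
    have := sum_sq_sub_le hR hRN
    rw [← hS] at this
    linarith
  calc _ ≤ ∑ n ∈ Finset.Ioc 0 N, ‖((∑ q ∈ R, dvdInd n q - S : ℝ) : ℂ) * g n‖ := norm_sum_le _ _
    _ ≤ ∑ n ∈ Finset.Ioc 0 N, |∑ q ∈ R, dvdInd n q - S| * c := by
        refine Finset.sum_le_sum fun n _ => ?_
        rw [norm_mul, Complex.norm_real, Real.norm_eq_abs]
        exact mul_le_mul_of_nonneg_left (hg n) (abs_nonneg _)
    _ ≤ _ := by
        rw [← Finset.sum_mul, mul_comm]
        exact mul_le_mul_of_nonneg_left h1 hc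

/-- The multiplicative weight `∏ (1 + ξ [p ∣ z])`. -/
noncomputable def divWeight (P : Finset ℕ) (ξ : ℂ) (z : ℤ) : ℂ :=
  ∏ p ∈ P, (1 + ξ * (dvdInd z p : ℂ))

/-- The expected mean value of `divWeight`. -/
noncomputable def divMean (P : Finset ℕ) (ξ : ℂ) : ℂ :=
  ∏ p ∈ P, (1 + ξ * ((1 / (p : ℝ) : ℝ) : ℂ))

lemma one_div_natCast_le_one (p : ℕ) : 1 / (p : ℝ) ≤ 1 := by
  rcases Nat.eq_zero_or_pos p with rfl | h
  · simp
  · rw [div_le_one (by exact_mod_cast h)]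
    exact_mod_cast h

lemma norm_divWeight_le_one {ξ : ℂ} (hξ : ‖1 + ξ‖ ≤ 1) (P : Finset ℕ) (z : ℤ) :
    ‖divWeight P ξ z‖ ≤ 1 := by
  rw [divWeight, norm_prod]
  exact Finset.prod_le_one (fun _ _ => norm_nonneg _)
    fun p _ => norm_one_add_mul_le_one hξ (dvdInd_nonneg z p) (dvdInd_le_one z p)

lemma norm_divMean_le_one {ξ : ℂ} (hξ : ‖1 + ξ‖ ≤ 1) (P : Finset ℕ) : ‖divMean P ξ‖ ≤ 1 := by
  rw [divMean, norm_prod]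
  exact Finset.prod_le_one (fun _ _ => norm_nonneg _)
    fun p _ => norm_one_add_mul_le_one hξ (by positivity) (one_div_natCast_le_one p)

lemma norm_divWeight_sub_divMean_le_two {ξ : ℂ} (hξ : ‖1 + ξ‖ ≤ 1) (P : Finset ℕ) (z : ℤ) :
    ‖divWeight P ξ z - divMean P ξ‖ ≤ 2 := by
  have h1 := norm_divWeight_le_one hξ P z
  have h2 := norm_divMean_le_one hξ P
  have := norm_sub_le (divWeight P ξ z) (divMean P ξ)
  linarith

lemma norm_divWeight_sub_sum_le {ξ : ℂ} (hξ : ‖1 + ξ‖ ≤ 1) (P : Finset ℕ) (J : ℕ) (z : ℤ) :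
    ‖divWeight P ξ z - divMean P ξ - ∑ j ∈ Finset.range J, ξ ^ j * (esumDev P j z : ℂ)‖ ≤
      ‖ξ‖ ^ J * (esumDev P J z + 2 * esum P J (fun p => 1 / (p : ℝ))) := by
  have h1 := norm_prod_sub_sum_esum_le hξ (u := dvdInd z) (dvdInd_nonneg z) (dvdInd_le_one z) P J
  have h2 := norm_prod_sub_sum_esum_le hξ (u := fun p => 1 / (p : ℝ)) (fun p => by positivity)
    one_div_natCast_le_one P J
  have e : divWeight P ξ z - divMean P ξ - ∑ j ∈ Finset.range J, ξ ^ j * (esumDev P j z : ℂ) =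
      (∏ p ∈ P, (1 + ξ * (dvdInd z p : ℂ)) -
        ∑ j ∈ Finset.range J, ξ ^ j * (esum P j (dvdInd z) : ℂ)) -
      (∏ p ∈ P, (1 + ξ * ((1 / (p : ℝ) : ℝ) : ℂ)) -
        ∑ j ∈ Finset.range J, ξ ^ j * (esum P j (fun p => 1 / (p : ℝ)) : ℂ)) := by
    unfold divWeight divMean esumDev
    have : ∑ j ∈ Finset.range J, ξ ^ j *
        ((esum P j (dvdInd z) - esum P j (fun p => 1 / (p : ℝ)) : ℝ) : ℂ) =
        ∑ j ∈ Finset.range J, ξ ^ j * (esum P j (dvdInd z) : ℂ) -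
        ∑ j ∈ Finset.range J, ξ ^ j * (esum P j (fun p => 1 / (p : ℝ)) : ℂ) := by
      rw [← Finset.sum_sub_distrib]
      refine Finset.sum_congr rfl fun j _ => ?_
      rw [Complex.ofReal_sub]
      ring
    rw [this]
    ring
  rw [e]
  refine (norm_sub_le _ _).trans ((add_le_add h1 h2).trans (le_of_eq ?_))
  unfold esumDev
  ring

lemma norm_sum_ite_le {ξ : ℂ} (hξ : ‖1 + ξ‖ ≤ 1) (hξ1 : ‖ξ‖ ≤ 1) (R P : Finset ℕ)
    (N J v m : ℕ) :
    ‖∑ q ∈ R, if q * m ≤ N then divWeight P ξ ((q : ℤ) * m - v) - divMean P ξ else 0‖ ≤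
      ∑ j ∈ Finset.range (J + 1), |devSum R P N j v m| +
      2 * ‖ξ‖ ^ J * esum P J (fun p => 1 / (p : ℝ)) * ∑ q ∈ R, if q * m ≤ N then (1 : ℝ) else 0 := by
  set c := esum P J (fun p => 1 / (p : ℝ)) with hc
  have e : ∑ q ∈ R, (if q * m ≤ N then divWeight P ξ ((q : ℤ) * m - v) - divMean P ξ else 0) =
      ∑ j ∈ Finset.range J, ξ ^ j * (devSum R P N j v m : ℂ) +
      ∑ q ∈ R, (if q * m ≤ N then divWeight P ξ ((q : ℤ) * m - v) - divMean P ξ -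
        ∑ j ∈ Finset.range J, ξ ^ j * (esumDev P j ((q : ℤ) * m - v) : ℂ) else 0) := by
    have : ∑ j ∈ Finset.range J, ξ ^ j * (devSum R P N j v m : ℂ) =
        ∑ q ∈ R, (if q * m ≤ N then
          ∑ j ∈ Finset.range J, ξ ^ j * (esumDev P j ((q : ℤ) * m - v) : ℂ) else 0) := by
      unfold devSum
      simp_rw [Complex.ofReal_sum, Finset.mul_sum]
      rw [Finset.sum_comm]
      refine Finset.sum_congr rfl fun q _ => ?_
      split_ifs <;> simp
    rw [this, ← Finset.sum_add_distrib]
    refine Finset.sum_congr rfl fun q _ => ?_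
    split_ifs <;> ring
  rw [e]
  have h1 : ‖∑ j ∈ Finset.range J, ξ ^ j * (devSum R P N j v m : ℂ)‖ ≤
      ∑ j ∈ Finset.range J, |devSum R P N j v m| := by
    refine norm_sum_le_of_le _ fun j _ => ?_
    rw [norm_mul, norm_pow, Complex.norm_real, Real.norm_eq_abs]
    exact mul_le_of_le_one_left (abs_nonneg _) (pow_le_one₀ (norm_nonneg _) hξ1)
  have h2 : ‖∑ q ∈ R, (if q * m ≤ N then divWeight P ξ ((q : ℤ) * m - v) - divMean P ξ -
        ∑ j ∈ Finset.range J, ξ ^ j * (esumDev P j ((q : ℤ) * m - v) : ℂ) else 0)‖ ≤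
      ‖ξ‖ ^ J * devSum R P N J v m +
        2 * ‖ξ‖ ^ J * c * ∑ q ∈ R, if q * m ≤ N then (1 : ℝ) else 0 := by
    unfold devSum
    rw [Finset.mul_sum, Finset.mul_sum, ← Finset.sum_add_distrib]
    refine norm_sum_le_of_le _ fun q _ => ?_
    split_ifs
    · refine (norm_divWeight_sub_sum_le hξ P J _).trans (le_of_eq ?_)
      ring
    · simp
  have h3 : ‖ξ‖ ^ J * devSum R P N J v m ≤ |devSum R P N J v m| :=
    (mul_le_mul_of_nonneg_left (le_abs_self _) (by positivity)).trans
      (mul_le_of_le_one_left (abs_nonneg _) (pow_le_one₀ (norm_nonneg _) hξ1))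
  rw [Finset.sum_range_succ]
  refine (norm_add_le _ _).trans ?_
  linarith

lemma card_divisors_prime_mul {q m : ℕ} (hq : q.Prime) (h : ¬ q ∣ m) :
    (q * m).divisors.card = 2 * m.divisors.card := by
  rw [Nat.Coprime.card_divisors_mul ((Nat.Prime.coprime_iff_not_dvd hq).2 h), hq.divisors,
    Finset.card_pair hq.one_lt.ne]

lemma sum_card_filter_mul_le {R : Finset ℕ} (hR : ∀ q ∈ R, 0 < q) (N M : ℕ) :
    ∑ m ∈ Finset.Ioc 0 M, ∑ q ∈ R, (if q * m ≤ N then (1 : ℝ) else 0) ≤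
      N * ∑ q ∈ R, 1 / (q : ℝ) := by
  rw [Finset.sum_comm, Finset.mul_sum]
  refine Finset.sum_le_sum fun q hq => ?_
  rw [Finset.sum_boole]
  have : (Finset.Ioc 0 M).filter (fun m => q * m ≤ N) ⊆ Finset.Ioc 0 (N / q) := by
    intro m hm
    simp only [Finset.mem_filter, Finset.mem_Ioc] at hm ⊢
    refine ⟨hm.1.1, ?_⟩
    rw [Nat.le_div_iff_mul_le (hR q hq), mul_comm]
    exact hm.2
  calc _ ≤ ((Finset.Ioc 0 (N / q)).card : ℝ) := by exact_mod_cast Finset.card_le_card this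
    _ = ((N / q : ℕ) : ℝ) := by simp
    _ ≤ N / q := Nat.cast_div_le
    _ = _ := by ring

/-- Mean value of `divWeight P ξ (n - τ(n))` over `n ≤ N`, with an explicit error term. -/
theorem norm_sum_divWeight_sub_le {P R : Finset ℕ} {w N V J Q : ℕ} {X : ℝ} {ξ : ℂ}
    (hξ : ‖1 + ξ‖ ≤ 1) (hξ1 : ‖ξ‖ ≤ 1) (hP : ∀ p ∈ P, p.Prime ∧ w < p)
    (hR : ∀ q ∈ R, q.Prime ∧ Q < q ∧ q ≤ w) (hQ : 0 < Q) (hRN : R.card ≤ N)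
    (hV : 0 < V) (hVw : V ≤ w) (hX : ∀ j ≤ J, (P.card : ℝ) ^ j ≤ X) :
    (∑ q ∈ R, 1 / (q : ℝ)) * ‖∑ n ∈ Finset.Ioc 0 N,
      (divWeight P ξ ((n : ℤ) - n.divisors.card) - divMean P ξ)‖ ≤
    4 * (N * ∑ q ∈ R, 1 / (q : ℝ)) / Q + 4 * (N * (∑ q ∈ R, 1 / (q : ℝ)) * (1 + log N)) / V +
    2 * ‖ξ‖ ^ J * esum P J (fun p => 1 / (p : ℝ)) * (N * ∑ q ∈ R, 1 / (q : ℝ)) +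
    (J + 1) * (V * √((N / Q) * (3 * (R.card : ℝ) ^ 2 * X ^ 2 +
      N * (∑ q ∈ R, 1 / (q : ℝ)) * exp (3 * ∑ p ∈ P, 1 / (p : ℝ))))) +
    2 * (N * √(3 * ∑ q ∈ R, 1 / (q : ℝ))) := by
  set S := ∑ q ∈ R, 1 / (q : ℝ) with hS
  have hS0 : 0 ≤ S := Finset.sum_nonneg fun q _ => by positivity
  set M := N / Q with hM
  have hRpos : ∀ q ∈ R, 0 < q := fun q hq => (hR q hq).1.pos
  have hMq : ∀ q ∈ R, N / q ≤ M := fun q hq => Nat.div_le_div_left (hR q hq).2.1.le hQ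
  refine (norm_sum_mul_le (fun q hq => (hR q hq).1) hRN hMq
    (fun n => norm_divWeight_sub_divMean_le_two hξ P ((n : ℤ) - n.divisors.card))).trans ?_
  rw [← hS]
  refine add_le_add ?_ le_rfl
  set H : ℕ → ℕ → ℂ := fun q m => if q * m ≤ N then
    divWeight P ξ ((q : ℤ) * m - (2 * m.divisors.card : ℕ)) - divMean P ξ else 0 with hH
  have hH2 : ∀ q m, ‖H q m‖ ≤ 2 * (if q * m ≤ N then (1 : ℝ) else 0) := by
    intro q m
    simp only [hH]
    split_ifs
    · rw [mul_one]; exact norm_divWeight_sub_divMean_le_two hξ P _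
    · simp
  have hsplit : ∑ q ∈ R, ∑ m ∈ Finset.Ioc 0 M, (if q * m ≤ N then
      (divWeight P ξ (((q * m : ℕ) : ℤ) - (q * m).divisors.card) - divMean P ξ) else 0) =
      ∑ q ∈ R, ∑ m ∈ Finset.Ioc 0 M, ((if q * m ≤ N then
      (divWeight P ξ (((q * m : ℕ) : ℤ) - (q * m).divisors.card) - divMean P ξ) else 0) - H q m) +
      (∑ m ∈ (Finset.Ioc 0 M).filter (fun m => V < 2 * m.divisors.card), ∑ q ∈ R, H q m +
      ∑ m ∈ (Finset.Ioc 0 M).filter (fun m => ¬ V < 2 * m.divisors.card), ∑ q ∈ R, H q m) := by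
    rw [Finset.sum_filter_add_sum_filter_not, Finset.sum_comm (s := Finset.Ioc 0 M),
      ← Finset.sum_add_distrib]
    refine Finset.sum_congr rfl fun q _ => ?_
    rw [← Finset.sum_add_distrib]
    exact Finset.sum_congr rfl fun m _ => by ring
  rw [hsplit]
  have b1 : ‖∑ q ∈ R, ∑ m ∈ Finset.Ioc 0 M, ((if q * m ≤ N then
      (divWeight P ξ (((q * m : ℕ) : ℤ) - (q * m).divisors.card) - divMean P ξ) else 0) - H q m)‖ ≤
      4 * (N * S) / Q := by
    have : 4 * (N * S) / Q = ∑ q ∈ R, 4 * (N * (1 / (q : ℝ)) / Q) := by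
      rw [hS, Finset.mul_sum, Finset.mul_sum, Finset.sum_div]
      exact Finset.sum_congr rfl fun q _ => by ring
    rw [this]
    refine norm_sum_le_of_le _ fun q hq => ?_
    have hq0 := hRpos q hq
    calc _ ≤ ∑ m ∈ Finset.Ioc 0 M, if (q * m ≤ N ∧ q ∣ m) then (4 : ℝ) else 0 := by
          refine norm_sum_le_of_le _ fun m _ => ?_
          simp only [hH]
          by_cases h1 : q * m ≤ N
          · by_cases h2 : q ∣ m
            · rw [if_pos h1, if_pos h1, if_pos ⟨h1, h2⟩]
              refine (norm_sub_le _ _).trans ?_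
              have := norm_divWeight_sub_divMean_le_two hξ P
                (((q * m : ℕ) : ℤ) - (q * m).divisors.card)
              have := norm_divWeight_sub_divMean_le_two hξ P
                ((q : ℤ) * m - (2 * m.divisors.card : ℕ))
              linarith
            · rw [if_pos h1, if_pos h1, if_neg (fun h => h2 h.2),
                card_divisors_prime_mul (hR q hq).1 h2, Nat.cast_mul, sub_self, norm_zero]
          · simp [h1]
      _ = 4 * (((Finset.Ioc 0 M).filter (fun m => q * m ≤ N ∧ q ∣ m)).card : ℝ) := by
          rw [← Finset.sum_filter, Finset.sum_const, nsmul_eq_mul, mul_comm]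
      _ ≤ 4 * ((N / q / q : ℕ) : ℝ) := by
          rw [← Nat.Ioc_filter_dvd_card_eq_div]
          refine mul_le_mul_of_nonneg_left (Nat.cast_le.2 (Finset.card_le_card fun m hm => ?_))
            (by norm_num)
          simp only [Finset.mem_filter, Finset.mem_Ioc] at hm ⊢
          refine ⟨⟨hm.1.1, ?_⟩, hm.2.2⟩
          rw [Nat.le_div_iff_mul_le hq0, mul_comm]
          exact hm.2.1
      _ ≤ 4 * (N * (1 / (q : ℝ)) / Q) := by
          refine mul_le_mul_of_nonneg_left ?_ (by norm_num)
          have hQq : (Q : ℝ) ≤ q := by exact_mod_cast (hR q hq).2.1.le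
          have hQ' : (0 : ℝ) < Q := by exact_mod_cast hQ
          calc ((N / q / q : ℕ) : ℝ) ≤ ((N / q : ℕ) : ℝ) / q := Nat.cast_div_le
            _ ≤ ((N : ℝ) / q) / q := div_le_div_of_nonneg_right Nat.cast_div_le (by positivity)
            _ ≤ ((N : ℝ) / q) / Q := div_le_div_of_nonneg_left (by positivity) hQ' hQq
            _ = _ := by ring
  have b2 : ‖∑ m ∈ (Finset.Ioc 0 M).filter (fun m => V < 2 * m.divisors.card),
      ∑ q ∈ R, H q m‖ ≤ 4 * (N * S * (1 + log N)) / V := by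
    rw [Finset.sum_comm]
    have : 4 * (N * S * (1 + log N)) / V =
        ∑ q ∈ R, 4 * (N * (1 / (q : ℝ)) * (1 + log N)) / V := by
      rw [hS, Finset.mul_sum, Finset.sum_mul, Finset.mul_sum, Finset.sum_div]
    rw [this]
    refine norm_sum_le_of_le _ fun q hq => ?_
    have hq0 := hRpos q hq
    have hV' : (0 : ℝ) < V := by exact_mod_cast hV
    calc _ ≤ ∑ m ∈ (Finset.Ioc 0 M).filter (fun m => V < 2 * m.divisors.card),
          2 * (if q * m ≤ N then (1 : ℝ) else 0) := norm_sum_le_of_le _ fun m _ => hH2 q m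
      _ = 2 * ((((Finset.Ioc 0 M).filter (fun m => V < 2 * m.divisors.card)).filter
          (fun m => q * m ≤ N)).card : ℝ) := by
          rw [← Finset.mul_sum, Finset.sum_boole]
      _ ≤ 2 * (((Finset.Ioc 0 (N / q)).filter (fun m => V < 2 * m.divisors.card)).card : ℝ) := by
          refine mul_le_mul_of_nonneg_left (Nat.cast_le.2 (Finset.card_le_card fun m hm => ?_))
            (by norm_num)
          simp only [Finset.mem_filter, Finset.mem_Ioc] at hm ⊢
          refine ⟨⟨hm.1.1.1, ?_⟩, hm.1.2⟩
          rw [Nat.le_div_iff_mul_le hq0, mul_comm]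
          exact hm.2
      _ ≤ 2 * (2 * (N * (1 / (q : ℝ)) * (1 + log N)) / V) := by
          refine mul_le_mul_of_nonneg_left ?_ (by norm_num)
          rw [le_div_iff₀ hV']
          refine (card_filter_lt_card_divisors_mul_le _ _).trans ?_
          refine mul_le_mul_of_nonneg_left ?_ (by norm_num)
          rcases Nat.eq_zero_or_pos (N / q) with h0 | h0
          · rw [h0]
            have : 0 ≤ log (N : ℝ) := Real.log_natCast_nonneg N
            simp only [Nat.cast_zero, zero_mul]
            positivity
          · have h1 : ((N / q : ℕ) : ℝ) ≤ N * (1 / (q : ℝ)) := by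
              refine Nat.cast_div_le.trans (le_of_eq (by ring))
            have h2 : log ((N / q : ℕ) : ℝ) ≤ log N :=
              Real.log_le_log (by exact_mod_cast h0) (by exact_mod_cast Nat.div_le_self _ _)
            have h3 : 0 ≤ log ((N / q : ℕ) : ℝ) := Real.log_natCast_nonneg _
            exact mul_le_mul h1 (by linarith) (by linarith) (by positivity)
      _ = _ := by ring
  have b3 : ‖∑ m ∈ (Finset.Ioc 0 M).filter (fun m => ¬ V < 2 * m.divisors.card),
      ∑ q ∈ R, H q m‖ ≤ 2 * ‖ξ‖ ^ J * esum P J (fun p => 1 / (p : ℝ)) * (N * S) +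
        (J + 1) * (V * √((N / Q) * (3 * (R.card : ℝ) ^ 2 * X ^ 2 +
          N * S * exp (3 * ∑ p ∈ P, 1 / (p : ℝ))))) := by
    set c := esum P J (fun p => 1 / (p : ℝ)) with hc
    have hc0 : 0 ≤ c := esum_nonneg (fun p => by positivity) J
    set B := √((N / Q) * (3 * (R.card : ℝ) ^ 2 * X ^ 2 +
      N * S * exp (3 * ∑ p ∈ P, 1 / (p : ℝ)))) with hB
    have hdisp : ∀ j ∈ Finset.range (J + 1), ∀ v ∈ Finset.Ioc 0 V,
        ∑ m ∈ Finset.Ioc 0 M, |devSum R P N j v m| ≤ B := by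
      intro j hj v hv
      rw [Finset.mem_Ioc] at hv
      refine Real.le_sqrt_of_sq_le ?_
      refine (sq_sum_abs_devSum_le hP (fun q hq => ⟨hRpos q hq, (hR q hq).2.2⟩) M N j hv.1
        (hv.2.trans hVw)).trans ?_
      have h1 : ((P.card : ℝ) ^ j) ^ 2 ≤ X ^ 2 :=
        pow_le_pow_left₀ (by positivity) (hX j (Nat.lt_succ_iff.1 (Finset.mem_range.1 hj))) 2
      have h2 : (M : ℝ) ≤ N / Q := Nat.cast_div_le
      refine mul_le_mul h2 (add_le_add (mul_le_mul_of_nonneg_left h1 (by positivity)) le_rfl)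
        (by positivity) (by positivity)
    calc _ ≤ ∑ m ∈ (Finset.Ioc 0 M).filter (fun m => ¬ V < 2 * m.divisors.card),
          (∑ j ∈ Finset.range (J + 1), ∑ v ∈ Finset.Ioc 0 V, |devSum R P N j v m| +
            2 * ‖ξ‖ ^ J * c * ∑ q ∈ R, if q * m ≤ N then (1 : ℝ) else 0) := by
          refine norm_sum_le_of_le _ fun m hm => ?_
          rw [Finset.mem_filter, Finset.mem_Ioc, not_lt] at hm
          refine (norm_sum_ite_le hξ hξ1 R P N J (2 * m.divisors.card) m).trans ?_
          refine add_le_add (Finset.sum_le_sum fun j _ => ?_) le_rfl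
          refine Finset.single_le_sum (f := fun v => |devSum R P N j v m|)
            (fun v _ => abs_nonneg _) ?_
          rw [Finset.mem_Ioc]
          refine ⟨?_, hm.2⟩
          have : 0 < m.divisors.card := Finset.card_pos.2 ⟨1, by simp; omega⟩
          omega
      _ ≤ ∑ m ∈ Finset.Ioc 0 M,
          (∑ j ∈ Finset.range (J + 1), ∑ v ∈ Finset.Ioc 0 V, |devSum R P N j v m| +
            2 * ‖ξ‖ ^ J * c * ∑ q ∈ R, if q * m ≤ N then (1 : ℝ) else 0) :=
          Finset.sum_le_sum_of_subset_of_nonneg (Finset.filter_subset _ _) fun m _ _ => by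
            refine add_nonneg (Finset.sum_nonneg fun _ _ => Finset.sum_nonneg fun _ _ =>
              abs_nonneg _) (mul_nonneg (by positivity) (Finset.sum_nonneg fun _ _ => ?_))
            split_ifs <;> norm_num
      _ = ∑ j ∈ Finset.range (J + 1), ∑ v ∈ Finset.Ioc 0 V, ∑ m ∈ Finset.Ioc 0 M,
            |devSum R P N j v m| +
          2 * ‖ξ‖ ^ J * c * ∑ m ∈ Finset.Ioc 0 M, ∑ q ∈ R, (if q * m ≤ N then (1 : ℝ) else 0) := by
          rw [Finset.sum_add_distrib, ← Finset.mul_sum, Finset.sum_comm]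
          congr 1
          exact Finset.sum_congr rfl fun j _ => Finset.sum_comm
      _ ≤ ∑ j ∈ Finset.range (J + 1), ∑ v ∈ Finset.Ioc 0 V, B +
          2 * ‖ξ‖ ^ J * c * (N * S) := by
          refine add_le_add (Finset.sum_le_sum fun j hj => Finset.sum_le_sum fun v hv =>
            hdisp j hj v hv) (mul_le_mul_of_nonneg_left (sum_card_filter_mul_le hRpos N M)
              (by positivity))
      _ = _ := by
          simp only [Finset.sum_const, Finset.card_range, Nat.card_Ioc, Nat.sub_zero, nsmul_eq_mul]
          push_cast
          ring
  refine (norm_add_le _ _).trans ?_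
  have := norm_add_le (∑ m ∈ (Finset.Ioc 0 M).filter (fun m => V < 2 * m.divisors.card),
    ∑ q ∈ R, H q m) (∑ m ∈ (Finset.Ioc 0 M).filter (fun m => ¬ V < 2 * m.divisors.card),
    ∑ q ∈ R, H q m)
  linarith

/-- The normalising parameter `log log x`. -/
noncomputable def ll (x : ℝ) : ℝ := log (log x)

/-- Lower end of the range of auxiliary primes. -/
noncomputable def auxLow (x : ℝ) : ℕ := ⌈exp (10 * ll x)⌉₊

/-- Upper end of the range of auxiliary primes. -/
noncomputable def auxHigh (x : ℝ) : ℕ := ⌊exp (ll x ^ 2)⌋₊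

/-- Typical bound for the number of divisors. -/
noncomputable def divBound (x : ℝ) : ℕ := ⌊exp (2 * ll x)⌋₊

/-- The auxiliary primes. -/
noncomputable def auxPrimes (x : ℝ) : Finset ℕ :=
  (Nat.primesLE (auxHigh x)).filter (fun q => auxLow x < q)

lemma tendsto_ll : Tendsto ll atTop atTop := tendsto_log_atTop.comp tendsto_log_atTop

lemma eventually_exp_ll : ∀ᶠ x : ℝ in atTop, exp (ll x) = log x := by
  filter_upwards [eventually_gt_atTop 1] with x hx
  rw [ll, exp_log (log_pos hx)]

lemma mem_auxPrimes {x : ℝ} {q : ℕ} (hq : q ∈ auxPrimes x) :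
    q.Prime ∧ auxLow x < q ∧ q ≤ auxHigh x := by
  rw [auxPrimes, Finset.mem_filter, Nat.mem_primesLE] at hq
  exact ⟨hq.1.2, hq.2, hq.1.1⟩

lemma auxLow_pos (x : ℝ) : 0 < auxLow x := Nat.ceil_pos.2 (exp_pos _)

lemma card_primesLE_le (n : ℕ) : (Nat.primesLE n).card ≤ n := by
  calc _ ≤ (Finset.Ioc 0 n).card := Finset.card_le_card fun p hp => by
        rw [Nat.mem_primesLE] at hp
        exact Finset.mem_Ioc.2 ⟨hp.2.pos, hp.1⟩
    _ = n := by simp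

lemma card_auxPrimes_le (x : ℝ) : ((auxPrimes x).card : ℝ) ≤ exp (ll x ^ 2) := by
  refine le_trans ?_ (Nat.floor_le (exp_pos _).le)
  exact Nat.cast_le.2 ((Finset.card_filter_le _ _).trans (card_primesLE_le _))

lemma tendsto_sum_auxPrimes :
    Tendsto (fun x => ∑ q ∈ auxPrimes x, 1 / (q : ℝ)) atTop atTop := by
  obtain ⟨C, hC0, hC⟩ := exists_abs_sum_one_div_sub_loglog_le
  have h : Tendsto (fun x => log (ll x) - (log 20 + 2 * C)) atTop atTop :=
    tendsto_atTop_add_const_right _ _ (tendsto_log_atTop.comp tendsto_ll)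
  refine tendsto_atTop_mono' _ ?_ h
  filter_upwards [tendsto_ll.eventually_ge_atTop 1] with x hx
  have h1 := hC (exp (ll x ^ 2)) (by
    have := add_one_le_exp (ll x ^ 2)
    nlinarith)
  have hlow : (2 : ℝ) ≤ auxLow x := by
    have h1 : exp (10 * ll x) ≤ auxLow x := Nat.le_ceil _
    have h2 := add_one_le_exp (10 * ll x)
    linarith
  have h2 := hC (auxLow x) hlow
  rw [Nat.floor_natCast] at h2
  have h3 : log (log (auxLow x)) ≤ log (20 * ll x) := by
    refine log_le_log (log_pos (by linarith)) ?_
    rw [log_le_iff_le_exp (by linarith)]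
    have h1 : (auxLow x : ℝ) < exp (10 * ll x) + 1 := Nat.ceil_lt_add_one (exp_pos _).le
    have h2 : exp (20 * ll x) = exp (10 * ll x) * exp (10 * ll x) := by rw [← exp_add]; ring_nf
    have h3 := add_one_le_exp (10 * ll x)
    nlinarith
  rw [log_mul (by norm_num) (by linarith)] at h3
  rw [log_exp, log_pow] at h1
  have h4 : ∑ p ∈ Nat.primesLE (auxHigh x), (1 : ℝ) / p ≤
      ∑ q ∈ auxPrimes x, 1 / (q : ℝ) + ∑ p ∈ Nat.primesLE (auxLow x), (1 : ℝ) / p := by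
    rw [← Finset.sum_filter_add_sum_filter_not _ (fun q => auxLow x < q)]
    refine add_le_add le_rfl (Finset.sum_le_sum_of_subset_of_nonneg (fun p hp => ?_)
      fun _ _ _ => by positivity)
    rw [Finset.mem_filter, Nat.mem_primesLE] at hp
    rw [Nat.mem_primesLE]
    exact ⟨not_lt.1 hp.2, hp.1.2⟩
  have h5 := (abs_le.1 h1).1
  have h6 := (abs_le.1 h2).2
  push_cast at h5
  change _ ≤ ∑ p ∈ Nat.primesLE (auxHigh x), (1 : ℝ) / p - _ at h5
  linarith

lemma tendsto_exp_sub_sq : Tendsto (fun L : ℝ => (3 / 4) * exp L - 2 * L ^ 2) atTop atTop := by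
  have h1 : Tendsto (fun L : ℝ => L ^ 2 * (3 / 4 * (exp L / L ^ 2) - 2)) atTop atTop := by
    refine (tendsto_pow_atTop (by norm_num)).atTop_mul_atTop₀ ?_
    exact tendsto_atTop_add_const_right _ _
      ((tendsto_exp_div_pow_atTop 2).const_mul_atTop (by norm_num))
  refine h1.congr' ?_
  filter_upwards [eventually_gt_atTop 0] with L hL
  field_simp

lemma eventually_floor_ge_half : ∀ᶠ x : ℝ in atTop, x / 2 ≤ (⌊x⌋₊ : ℝ) ∧ 0 < (⌊x⌋₊ : ℝ) := by
  filter_upwards [eventually_ge_atTop 2] with x hx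
  have := Nat.lt_floor_add_one x
  constructor <;> linarith

lemma eventually_exp_sq_div_le :
    ∀ᶠ x : ℝ in atTop, 3 * exp (ll x ^ 2) ^ 2 * (x ^ (1 / 8 : ℝ)) ^ 2 / (⌊x⌋₊ : ℝ) ≤ 1 := by
  filter_upwards [eventually_floor_ge_half, eventually_exp_ll, eventually_gt_atTop 1,
    (tendsto_exp_sub_sq.comp tendsto_ll).eventually_ge_atTop 6] with x ⟨h1, h0⟩ h2 h3 h4
  simp only [Function.comp] at h4
  rw [div_le_one h0]
  have hx : x = exp (exp (ll x)) := by rw [h2, exp_log (by linarith)]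
  have e1 : x ^ (1 / 8 : ℝ) = exp (exp (ll x) / 8) := by
    conv_lhs => rw [hx]
    rw [← exp_mul]
    ring_nf
  have e2 : exp (ll x ^ 2) ^ 2 * (x ^ (1 / 8 : ℝ)) ^ 2 =
      exp (2 * ll x ^ 2 + exp (ll x) / 4) := by
    rw [e1, ← exp_nat_mul, ← exp_nat_mul, ← exp_add]
    push_cast
    ring_nf
  have e3 : x = exp (2 * ll x ^ 2 + exp (ll x) / 4) *
      exp (3 / 4 * exp (ll x) - 2 * ll x ^ 2) := by
    rw [← exp_add]
    conv_lhs => rw [hx]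
    ring_nf
  have h5 := add_one_le_exp (3 / 4 * exp (ll x) - 2 * ll x ^ 2)
  have h6 := exp_pos (2 * ll x ^ 2 + exp (ll x) / 4)
  rw [mul_assoc, e2]
  nlinarith

lemma eventually_card_auxPrimes_le : ∀ᶠ x : ℝ in atTop, (auxPrimes x).card ≤ ⌊x⌋₊ := by
  filter_upwards [eventually_exp_sq_div_le, eventually_floor_ge_half, eventually_ge_atTop 1]
    with x h1 ⟨h2, h0⟩ h3
  rw [div_le_one h0] at h1
  have h4 : (1 : ℝ) ≤ x ^ (1 / 8 : ℝ) := one_le_rpow h3 (by norm_num)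
  have h5 : (1 : ℝ) ≤ exp (ll x ^ 2) := one_le_exp (by positivity)
  have h6 := card_auxPrimes_le x
  have h7 : exp (ll x ^ 2) ≤ exp (ll x ^ 2) ^ 2 := by nlinarith
  have h8 : exp (ll x ^ 2) ^ 2 * 1 ≤ exp (ll x ^ 2) ^ 2 * (x ^ (1 / 8 : ℝ)) ^ 2 :=
    mul_le_mul_of_nonneg_left (one_le_pow₀ h4) (by positivity)
  have : ((auxPrimes x).card : ℝ) ≤ (⌊x⌋₊ : ℝ) := by nlinarith [sq_nonneg (exp (ll x ^ 2))]
  exact_mod_cast this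

lemma tendsto_mul_exp_mul_sqrt (C : ℝ) : Tendsto (fun L : ℝ => (L + 3) * (exp (2 * L) *
    √(exp (-10 * L) * (1 + exp (3 * (L + C)))))) atTop (nhds 0) := by
  have h1 : Tendsto (fun L : ℝ => (L ^ 1 * exp (-L) + 3 * exp (-L)) * √(1 + exp (3 * C)))
      atTop (nhds 0) := by
    have a := tendsto_pow_mul_exp_neg_atTop_nhds_zero 1
    have b : Tendsto (fun L : ℝ => 3 * exp (-L)) atTop (nhds (3 * 0)) :=
      (tendsto_exp_neg_atTop_nhds_zero).const_mul 3
    simpa using (a.add b).mul_const (√(1 + exp (3 * C)))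
  refine squeeze_zero' ?_ ?_ h1
  · filter_upwards [eventually_ge_atTop 0] with L hL
    positivity
  · filter_upwards [eventually_ge_atTop 0] with L hL
    have h2 : √(exp (-10 * L) * (1 + exp (3 * (L + C)))) ≤
        exp (-3 * L) * √(1 + exp (3 * C)) := by
      refine (Real.sqrt_le_sqrt (y := exp (-3 * L) ^ 2 * (1 + exp (3 * C))) ?_).trans (le_of_eq ?_)
      · have e : exp (-3 * L) ^ 2 = exp (-10 * L) * exp (4 * L) := by
          rw [← exp_nat_mul, ← exp_add]; push_cast; ring_nf
        rw [e, mul_assoc]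
        refine mul_le_mul_of_nonneg_left ?_ (exp_pos _).le
        have e2 : exp (3 * (L + C)) = exp (3 * L) * exp (3 * C) := by rw [← exp_add]; ring_nf
        rw [e2, mul_add, mul_one]
        refine add_le_add (one_le_exp (by linarith)) (mul_le_mul_of_nonneg_right ?_ (exp_pos _).le)
        exact exp_le_exp.2 (by linarith)
      · rw [Real.sqrt_mul (by positivity), Real.sqrt_sq (exp_pos _).le]
    calc _ ≤ (L + 3) * (exp (2 * L) * (exp (-3 * L) * √(1 + exp (3 * C)))) := by gcongr
      _ = _ := by
        rw [← mul_assoc (exp (2 * L)), ← exp_add, pow_one]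
        ring_nf

lemma tendsto_one_add_exp_div : Tendsto (fun L : ℝ => 4 * (1 + exp L) / (exp (2 * L) - 1))
    atTop (nhds 0) := by
  have h1 : Tendsto (fun L : ℝ => 16 * exp (-L)) atTop (nhds 0) := by
    simpa using (tendsto_exp_neg_atTop_nhds_zero).const_mul 16
  refine squeeze_zero' ?_ ?_ h1
  · filter_upwards [eventually_ge_atTop 1] with L hL
    have := add_one_le_exp (2 * L)
    exact div_nonneg (by positivity) (by linarith)
  · filter_upwards [eventually_ge_atTop 1] with L hL
    have h2 := add_one_le_exp L
    have e : exp (2 * L) = exp L * exp L := by rw [← exp_add]; ring_nf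
    have e2 : exp (-L) * exp L = 1 := by rw [← exp_add]; simp
    rw [e, div_le_iff₀ (by nlinarith)]
    have : 16 * exp (-L) * (exp L * exp L - 1) = 16 * exp L - 16 * exp (-L) := by
      linear_combination (16 * exp L) * e2
    rw [this]
    have : exp (-L) ≤ 1 := exp_le_one_iff.2 (by linarith)
    nlinarith

lemma mul_sqrt_dispersion_le {J V N Q r S E X L C : ℝ} (hJ0 : 0 ≤ J) (hV0 : 0 ≤ V) (hN0 : 0 < N)
    (hQ0 : 0 < Q) (hS : 1 ≤ S) (hE0 : 0 ≤ E) (hJ : J ≤ L + 2) (hV : V ≤ exp (2 * L))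
    (hQ : 1 / Q ≤ exp (-(10 * L))) (hr : 3 * r ^ 2 * X ^ 2 ≤ N) (hE : E ≤ exp (3 * (L + C))) :
    (J + 1) * (V * √((N / Q) * (3 * r ^ 2 * X ^ 2 + N * S * E))) ≤
      N * S * ((L + 3) * (exp (2 * L) * √(exp (-10 * L) * (1 + exp (3 * (L + C)))))) := by
  have hNS : 0 < N * S := by positivity
  have hs : √((N / Q) * (3 * r ^ 2 * X ^ 2 + N * S * E)) ≤
      N * S * √(exp (-10 * L) * (1 + exp (3 * (L + C)))) := by
    refine (Real.sqrt_le_sqrt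
      (y := (N * S) ^ 2 * (exp (-10 * L) * (1 + exp (3 * (L + C))))) ?_).trans (le_of_eq ?_)
    · have a2 : 3 * r ^ 2 * X ^ 2 + N * S * E ≤ N * S ^ 2 * (1 + exp (3 * (L + C))) := by
        have b1 : N ≤ N * S ^ 2 := le_mul_of_one_le_right hN0.le (one_le_pow₀ hS)
        have b2 : N * S * E ≤ N * S ^ 2 * exp (3 * (L + C)) := by
          refine mul_le_mul ?_ hE hE0 (by positivity)
          nlinarith
        linarith
      have a3 : N / Q ≤ N * exp (-10 * L) := by
        have e : -10 * L = -(10 * L) := by ring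
        rw [e, div_eq_mul_one_div]
        exact mul_le_mul_of_nonneg_left hQ hN0.le
      calc _ ≤ (N * exp (-10 * L)) * (N * S ^ 2 * (1 + exp (3 * (L + C)))) :=
            mul_le_mul a3 a2 (by positivity) (by positivity)
        _ = _ := by ring
    · rw [Real.sqrt_mul (by positivity), Real.sqrt_sq hNS.le]
  calc _ ≤ (L + 3) * (exp (2 * L) *
      (N * S * √(exp (-10 * L) * (1 + exp (3 * (L + C)))))) := by
        refine mul_le_mul (by linarith) (mul_le_mul hV hs (by positivity) (by positivity))
          (by positivity) (by linarith)
    _ = _ := by ring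

/-- Asymptotic form of the mean value theorem for `divWeight P ξ (n - τ(n))`. -/
theorem tendsto_norm_sum_divWeight_sub {P : ℝ → Finset ℕ} {ξ : ℝ → ℂ} {J : ℝ → ℕ}
    (hξ : ∀ᶠ x in atTop, ‖1 + ξ x‖ ≤ 1) (hξ1 : ∀ᶠ x in atTop, ‖ξ x‖ ≤ 1)
    (hP : ∀ᶠ x in atTop, ∀ p ∈ P x, p.Prime ∧ auxHigh x < p ∧ (p : ℝ) ≤ x)
    (hJ : ∀ᶠ x in atTop, (J x : ℝ) ≤ ll x + 2)
    (hX : ∀ᶠ x in atTop, ∀ j ≤ J x, ((P x).card : ℝ) ^ j ≤ x ^ (1 / 8 : ℝ))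
    (hc : Tendsto (fun x => ‖ξ x‖ ^ (J x) * esum (P x) (J x) (fun p => 1 / (p : ℝ)))
      atTop (nhds 0)) :
    Tendsto (fun x => ‖∑ n ∈ Finset.Ioc 0 ⌊x⌋₊,
      (divWeight (P x) (ξ x) ((n : ℤ) - n.divisors.card) - divMean (P x) (ξ x))‖ / (⌊x⌋₊ : ℝ))
      atTop (nhds 0) := by
  obtain ⟨C, hC0, hC⟩ := exists_abs_sum_one_div_sub_loglog_le
  have t1 : Tendsto (fun x => 4 * exp (-(10 * ll x))) atTop (nhds 0) := by
    have := (tendsto_exp_neg_atTop_nhds_zero.comp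
      (tendsto_ll.const_mul_atTop (show (0 : ℝ) < 10 by norm_num))).const_mul 4
    simpa using this
  have t2 := tendsto_one_add_exp_div.comp tendsto_ll
  have t3 := hc.const_mul 2
  have t4 := (tendsto_mul_exp_mul_sqrt C).comp tendsto_ll
  have t5 : Tendsto (fun x => 2 * √(3 / ∑ q ∈ auxPrimes x, 1 / (q : ℝ))) atTop (nhds 0) := by
    have := ((tendsto_sum_auxPrimes.const_div_atTop 3).sqrt).const_mul 2
    simpa using this
  have tt := (((t1.add t2).add t3).add t4).add t5
  simp only [mul_zero, add_zero] at tt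
  refine squeeze_zero' (Eventually.of_forall fun x => by positivity) ?_ tt
  filter_upwards [hξ, hξ1, hP, hJ, hX, eventually_card_auxPrimes_le, eventually_exp_sq_div_le,
    eventually_floor_ge_half, tendsto_sum_auxPrimes.eventually_ge_atTop 1,
    tendsto_ll.eventually_ge_atTop 2, eventually_exp_ll, eventually_ge_atTop 2]
    with x hξ hξ1 hP hJ hX hcard hsq hN hS hL hexp hx
  obtain ⟨-, hN0⟩ := hN
  have hVw : divBound x ≤ auxHigh x := Nat.floor_le_floor (exp_le_exp.2 (by nlinarith))
  have hVlow : exp (2 * ll x) - 1 < divBound x := by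
    have := Nat.lt_floor_add_one (exp (2 * ll x))
    unfold divBound
    linarith
  have hVup : (divBound x : ℝ) ≤ exp (2 * ll x) := Nat.floor_le (exp_pos _).le
  have hV1 : 0 < exp (2 * ll x) - 1 := by have := add_one_le_exp (2 * ll x); linarith
  have hV0 : (0 : ℝ) < divBound x := by linarith
  have main := norm_sum_divWeight_sub_le (V := divBound x) (J := J x) (N := ⌊x⌋₊) hξ hξ1
    (fun p hp => ⟨(hP p hp).1, (hP p hp).2.1⟩) (fun q hq => mem_auxPrimes hq) (auxLow_pos x)
    hcard (by exact_mod_cast hV0) hVw hX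
  set S := ∑ q ∈ auxPrimes x, 1 / (q : ℝ) with hSdef
  set N : ℝ := (⌊x⌋₊ : ℝ) with hNdef
  set c := esum (P x) (J x) (fun p => 1 / (p : ℝ)) with hcdef
  set E := exp (3 * ∑ p ∈ P x, 1 / (p : ℝ)) with hE
  have hQ : exp (10 * ll x) ≤ auxLow x := Nat.le_ceil _
  have hQ0 : (0 : ℝ) < auxLow x := lt_of_lt_of_le (exp_pos _) hQ
  have hQinv : 1 / (auxLow x : ℝ) ≤ exp (-(10 * ll x)) := by
    rw [exp_neg, ← one_div]
    exact one_div_le_one_div_of_le (exp_pos _) hQ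
  have hEle : E ≤ exp (3 * (ll x + C)) := by
    refine exp_le_exp.2 (mul_le_mul_of_nonneg_left ?_ (by norm_num))
    have h1 := (abs_le.1 (hC x hx)).2
    have h2 : ∑ p ∈ P x, 1 / (p : ℝ) ≤ ∑ p ∈ Nat.primesLE ⌊x⌋₊, (1 : ℝ) / p := by
      refine Finset.sum_le_sum_of_subset_of_nonneg (fun p hp => ?_) fun _ _ _ => by positivity
      rw [Nat.mem_primesLE]
      exact ⟨Nat.le_floor (hP p hp).2.2, (hP p hp).1⟩
    unfold ll
    linarith
  have hE0 : 0 < E := exp_pos _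
  have hS0 : 0 < S := by linarith
  have hNS : 0 < N * S := by positivity
  have hlogN : log N ≤ exp (ll x) := by
    rw [hexp]
    exact log_le_log hN0 (Nat.floor_le (by linarith))
  have hlogN0 : 0 ≤ log N := Real.log_natCast_nonneg _
  have p1 : 4 * (N * S) / (auxLow x) ≤ N * S * (4 * exp (-(10 * ll x))) := by
    calc _ = N * S * (4 * (1 / (auxLow x : ℝ))) := by ring
      _ ≤ _ := by gcongr
  have p2 : 4 * (N * S * (1 + log N)) / (divBound x) ≤
      N * S * (4 * (1 + exp (ll x)) / (exp (2 * ll x) - 1)) := by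
    calc _ = N * S * (4 * (1 + log N) / (divBound x)) := by ring
      _ ≤ _ := by
        refine mul_le_mul_of_nonneg_left ?_ hNS.le
        exact div_le_div₀ (by positivity) (by linarith) hV1 hVlow.le
  have p4 : ((J x : ℝ) + 1) * (divBound x * √((N / auxLow x) * (3 * ((auxPrimes x).card : ℝ) ^ 2 *
      (x ^ (1 / 8 : ℝ)) ^ 2 + N * S * E))) ≤ N * S * ((ll x + 3) * (exp (2 * ll x) *
        √(exp (-10 * ll x) * (1 + exp (3 * (ll x + C)))))) := by
    refine mul_sqrt_dispersion_le (by positivity) hV0.le hN0 hQ0 hS hE0.le hJ hVup hQinv ?_ hEle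
    rw [div_le_one hN0] at hsq
    refine le_trans ?_ hsq
    have := card_auxPrimes_le x
    gcongr
  have p5 : 2 * (N * √(3 * S)) = N * S * (2 * √(3 / S)) := by
    have : √(3 * S) = S * √(3 / S) := by
      have e : 3 * S = S ^ 2 * (3 / S) := by field_simp
      rw [e, Real.sqrt_mul (by positivity), Real.sqrt_sq hS0.le]
    rw [this]
    ring
  have p3 : 2 * ‖ξ x‖ ^ J x * c * (N * S) = N * S * (2 * (‖ξ x‖ ^ J x * c)) := by ring
  simp only [Function.comp]
  rw [div_le_iff₀ hN0]
  refine le_of_mul_le_mul_left (main.trans ?_) hS0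
  rw [p3, p5]
  linarith

/-- The order of truncation. -/
noncomputable def truncOrder (x : ℝ) : ℕ := ⌈ll x⌉₊

/-- Upper end of the range of main primes. -/
noncomputable def mainEnd (x : ℝ) : ℝ := x ^ (1 / (8 * (truncOrder x : ℝ)))

/-- The main primes, which carry the Gaussian behaviour. -/
noncomputable def mainPrimes (x : ℝ) : Finset ℕ :=
  (Nat.primesLE ⌊mainEnd x⌋₊).filter (fun p => auxHigh x < p)

/-- The primes between the main primes and `x ^ (1 / 8)`. -/
noncomputable def midPrimes (x : ℝ) : Finset ℕ :=
  (Nat.primesLE ⌊x ^ (1 / 8 : ℝ)⌋₊).filter (fun p => auxHigh x < p ∧ ⌊mainEnd x⌋₊ < p)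

lemma eventually_truncOrder : ∀ᶠ x : ℝ in atTop,
    ll x ≤ truncOrder x ∧ (truncOrder x : ℝ) ≤ ll x + 1 ∧ 1 ≤ truncOrder x := by
  filter_upwards [tendsto_ll.eventually_ge_atTop 1] with x hx
  have h1 : ll x ≤ truncOrder x := Nat.le_ceil _
  refine ⟨h1, (Nat.ceil_lt_add_one (by linarith)).le, ?_⟩
  have : (1 : ℝ) ≤ truncOrder x := hx.trans h1
  exact_mod_cast this

lemma eventually_log_log_mainEnd : ∀ᶠ x : ℝ in atTop,
    2 ≤ mainEnd x ∧ mainEnd x ≤ x ∧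
      log (log (mainEnd x)) = ll x - log (8 * truncOrder x) ∧
      log (8 * truncOrder x) ≤ log (ll x) + log 16 := by
  filter_upwards [eventually_truncOrder, eventually_exp_ll, eventually_gt_atTop 1,
    tendsto_ll.eventually_ge_atTop 1,
    ((tendsto_exp_div_pow_atTop 1).comp tendsto_ll).eventually_ge_atTop 16]
    with x ⟨h1, h2, h3⟩ hexp hx hL h4
  have hJ : (1 : ℝ) ≤ truncOrder x := by exact_mod_cast h3
  have hx0 : 0 < x := by linarith
  simp only [Function.comp, pow_one] at h4
  rw [le_div_iff₀ (by linarith)] at h4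
  have hlog : log (mainEnd x) = exp (ll x) / (8 * truncOrder x) := by
    rw [mainEnd, log_rpow hx0, hexp]
    ring
  have hpos : 0 < mainEnd x := rpow_pos_of_pos hx0 _
  have hge : 1 ≤ exp (ll x) / (8 * truncOrder x) := by
    rw [le_div_iff₀ (by positivity)]
    linarith
  refine ⟨?_, ?_, ?_, ?_⟩
  · rw [← exp_log hpos, hlog]
    have := add_one_le_exp (exp (ll x) / (8 * truncOrder x))
    linarith
  · conv_rhs => rw [← rpow_one x]
    refine rpow_le_rpow_of_exponent_le hx.le ?_
    rw [div_le_one (by positivity)]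
    linarith
  · rw [hlog, log_div (exp_pos _).ne' (by positivity), log_exp]
  · rw [← log_mul (by positivity) (by norm_num)]
    exact log_le_log (by positivity) (by linarith)

lemma eventually_sum_primesLE_auxHigh_le {C : ℝ}
    (hC : ∀ y : ℝ, 2 ≤ y → |∑ p ∈ Nat.primesLE ⌊y⌋₊, (1 : ℝ) / p - log (log y)| ≤ C) :
    ∀ᶠ x : ℝ in atTop, ∑ p ∈ Nat.primesLE (auxHigh x), (1 : ℝ) / p ≤ 2 * log (ll x) + C := by
  filter_upwards [tendsto_ll.eventually_ge_atTop 1] with x hx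
  have h1 := hC (exp (ll x ^ 2)) (by
    have := add_one_le_exp (ll x ^ 2)
    nlinarith)
  rw [log_exp, log_pow] at h1
  have h5 := (abs_le.1 h1).2
  push_cast at h5
  change ∑ p ∈ Nat.primesLE (auxHigh x), (1 : ℝ) / p - _ ≤ _ at h5
  linarith

lemma exists_abs_sum_mainPrimes_sub_le : ∃ C : ℝ, 0 ≤ C ∧ ∀ᶠ x : ℝ in atTop,
    |∑ p ∈ mainPrimes x, 1 / (p : ℝ) - ll x| ≤ 3 * log (ll x) + C := by
  obtain ⟨C, hC0, hC⟩ := exists_abs_sum_one_div_sub_loglog_le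
  refine ⟨2 * C + log 16, by have := log_nonneg (show (1 : ℝ) ≤ 16 by norm_num); positivity, ?_⟩
  filter_upwards [eventually_log_log_mainEnd, eventually_sum_primesLE_auxHigh_le hC,
    tendsto_ll.eventually_ge_atTop 1, eventually_truncOrder] with x ⟨h1, _, h2, h3⟩ h4 h5 ⟨_, _, h6⟩
  have hJ : (1 : ℝ) ≤ truncOrder x := by exact_mod_cast h6
  have h7 := abs_le.1 (hC _ h1)
  rw [h2] at h7
  have h8 : ∑ p ∈ Nat.primesLE ⌊mainEnd x⌋₊, (1 : ℝ) / p ≤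
      ∑ p ∈ mainPrimes x, 1 / (p : ℝ) + ∑ p ∈ Nat.primesLE (auxHigh x), (1 : ℝ) / p := by
    rw [← Finset.sum_filter_add_sum_filter_not _ (fun q => auxHigh x < q)]
    refine add_le_add le_rfl (Finset.sum_le_sum_of_subset_of_nonneg (fun p hp => ?_)
      fun _ _ _ => by positivity)
    rw [Finset.mem_filter, Nat.mem_primesLE] at hp
    rw [Nat.mem_primesLE]
    exact ⟨not_lt.1 hp.2, hp.1.2⟩
  have h9 : ∑ p ∈ mainPrimes x, 1 / (p : ℝ) ≤ ∑ p ∈ Nat.primesLE ⌊mainEnd x⌋₊, (1 : ℝ) / p :=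
    Finset.sum_le_sum_of_subset_of_nonneg (Finset.filter_subset _ _) fun _ _ _ => by positivity
  have h10 : 0 ≤ log (8 * truncOrder x) := log_nonneg (by linarith)
  have h11 : 0 ≤ log (ll x) := log_nonneg h5
  have h12 := log_nonneg (show (1 : ℝ) ≤ 16 by norm_num)
  rw [abs_le]
  constructor <;> linarith [h7.1, h7.2]

lemma exists_sum_midPrimes_le : ∃ C : ℝ, 0 ≤ C ∧ ∀ᶠ x : ℝ in atTop,
    ∑ p ∈ midPrimes x, 1 / (p : ℝ) ≤ log (ll x) + C := by
  obtain ⟨C, hC0, hC⟩ := exists_abs_sum_one_div_sub_loglog_le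
  refine ⟨2 * C + log 16, by have := log_nonneg (show (1 : ℝ) ≤ 16 by norm_num); positivity, ?_⟩
  filter_upwards [eventually_log_log_mainEnd, eventually_ge_atTop 2] with x ⟨h1, h1', h2, h3⟩ hx
  have h7 := abs_le.1 (hC _ h1)
  have h8 := abs_le.1 (hC _ hx)
  rw [h2] at h7
  have h9 : ∑ p ∈ midPrimes x, 1 / (p : ℝ) + ∑ p ∈ Nat.primesLE ⌊mainEnd x⌋₊, (1 : ℝ) / p ≤
      ∑ p ∈ Nat.primesLE ⌊x⌋₊, (1 : ℝ) / p := by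
    rw [← Finset.sum_union]
    · refine Finset.sum_le_sum_of_subset_of_nonneg (fun p hp => ?_) fun _ _ _ => by positivity
      rw [Finset.mem_union, midPrimes, Finset.mem_filter, Nat.mem_primesLE, Nat.mem_primesLE] at hp
      rw [Nat.mem_primesLE]
      rcases hp with hp | hp
      · refine ⟨hp.1.1.trans (Nat.floor_le_floor ?_), hp.1.2⟩
        conv_rhs => rw [← rpow_one x]
        exact rpow_le_rpow_of_exponent_le (by linarith) (by norm_num)
      · exact ⟨hp.1.trans (Nat.floor_le_floor h1'), hp.2⟩
    · rw [Finset.disjoint_left]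
      intro p hp hp'
      rw [midPrimes, Finset.mem_filter] at hp
      rw [Nat.mem_primesLE] at hp'
      exact absurd hp'.1 (not_le.2 hp.2.2)
  unfold ll at *
  linarith [h7.1, h8.2]

lemma eventually_card_mainPrimes_pow_le : ∀ᶠ x : ℝ in atTop, ∀ j ≤ truncOrder x,
    ((mainPrimes x).card : ℝ) ^ j ≤ x ^ (1 / 8 : ℝ) := by
  filter_upwards [eventually_log_log_mainEnd, eventually_truncOrder, eventually_gt_atTop 1]
    with x ⟨h1, _⟩ ⟨_, _, h6⟩ hx j hj
  have hJ : (1 : ℝ) ≤ truncOrder x := by exact_mod_cast h6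
  have hc : ((mainPrimes x).card : ℝ) ≤ mainEnd x := by
    refine le_trans ?_ (Nat.floor_le (by linarith))
    exact Nat.cast_le.2 ((Finset.card_filter_le _ _).trans (card_primesLE_le _))
  calc ((mainPrimes x).card : ℝ) ^ j ≤ mainEnd x ^ j := by gcongr
    _ ≤ mainEnd x ^ truncOrder x := pow_le_pow_right₀ (by linarith) hj
    _ = _ := by
      rw [mainEnd, ← rpow_natCast, ← rpow_mul (by linarith)]
      congr 1
      field_simp

lemma norm_prod_sub_prod_le {ι : Type*} (s : Finset ι) (a b : ι → ℂ) (ha : ∀ i ∈ s, ‖a i‖ ≤ 1)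
    (hb : ∀ i ∈ s, ‖b i‖ ≤ 1) : ‖∏ i ∈ s, a i - ∏ i ∈ s, b i‖ ≤ ∑ i ∈ s, ‖a i - b i‖ := by
  classical
  induction s using Finset.induction_on with
  | empty => simp
  | insert i s hi ih =>
    rw [Finset.prod_insert hi, Finset.prod_insert hi, Finset.sum_insert hi]
    have e : a i * ∏ i ∈ s, a i - b i * ∏ i ∈ s, b i =
        (a i - b i) * ∏ i ∈ s, a i + b i * (∏ i ∈ s, a i - ∏ i ∈ s, b i) := by ring
    rw [e]
    have h1 : ‖∏ i ∈ s, a i‖ ≤ 1 := by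
      rw [norm_prod]
      exact Finset.prod_le_one (fun _ _ => norm_nonneg _)
        fun j hj => ha j (Finset.mem_insert_of_mem hj)
    have h2 := ih (fun j hj => ha j (Finset.mem_insert_of_mem hj))
      (fun j hj => hb j (Finset.mem_insert_of_mem hj))
    refine (norm_add_le _ _).trans (add_le_add ?_ ?_)
    · rw [norm_mul]
      exact mul_le_of_le_one_right (norm_nonneg _) h1
    · rw [norm_mul]
      exact (mul_le_of_le_one_left (norm_nonneg _) (hb i (Finset.mem_insert_self _ _))).trans h2

lemma norm_divMean_sub_exp_le {ξ : ℂ} (hξ : ‖1 + ξ‖ ≤ 1) (hξ1 : ‖ξ‖ ≤ 1) (P : Finset ℕ) :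
    ‖divMean P ξ - Complex.exp (ξ * ((∑ p ∈ P, 1 / (p : ℝ) : ℝ) : ℂ))‖ ≤
      ‖ξ‖ ^ 2 * ∑' n : ℕ, 1 / (n : ℝ) ^ 2 := by
  have hre : ξ.re ≤ 0 := by
    have := (Complex.abs_re_le_norm (1 + ξ)).trans hξ
    have := (abs_le.1 this).2
    simp only [Complex.add_re, Complex.one_re] at this
    linarith
  rw [Complex.ofReal_sum, Finset.mul_sum, Complex.exp_sum, divMean]
  refine (norm_prod_sub_prod_le _ _ _ (fun p _ => ?_) (fun p _ => ?_)).trans ?_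
  · exact norm_one_add_mul_le_one hξ (by positivity) (one_div_natCast_le_one p)
  · rw [Complex.norm_exp, Real.exp_le_one_iff, Complex.re_mul_ofReal]
    exact mul_nonpos_of_nonpos_of_nonneg hre (by positivity)
  · calc _ ≤ ∑ p ∈ P, ‖ξ‖ ^ 2 * (1 / (p : ℝ) ^ 2) := by
          refine Finset.sum_le_sum fun p _ => ?_
          have hn : ‖ξ * ((1 / (p : ℝ) : ℝ) : ℂ)‖ = ‖ξ‖ * (1 / p) := by
            rw [norm_mul, Complex.norm_real, Real.norm_of_nonneg (by positivity)]
          have h1 : ‖ξ * ((1 / (p : ℝ) : ℝ) : ℂ)‖ ≤ 1 := by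
            rw [hn]
            exact mul_le_one₀ hξ1 (by positivity) (one_div_natCast_le_one p)
          have h2 := Complex.norm_exp_sub_one_sub_id_le h1
          rw [hn] at h2
          rw [norm_sub_rev]
          refine (le_of_eq ?_).trans (h2.trans (le_of_eq ?_))
          · congr 1
            ring
          · ring
      _ = ‖ξ‖ ^ 2 * ∑ p ∈ P, 1 / (p : ℝ) ^ 2 := by rw [Finset.mul_sum]
      _ ≤ _ := by
        refine mul_le_mul_of_nonneg_left ?_ (by positivity)
        exact (Real.summable_one_div_nat_pow.2 (by norm_num)).sum_le_tsum _
          fun _ _ => by positivity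

lemma norm_exp_I_sub_le {a : ℝ} (ha : |a| ≤ 1) :
    ‖Complex.exp (Complex.I * a) - 1 - Complex.I * a + (a : ℂ) ^ 2 / 2‖ ≤ |a| ^ 3 := by
  have hn : ‖Complex.I * (a : ℂ)‖ = |a| := by simp
  have h := Complex.exp_bound (x := Complex.I * a) (by rw [hn]; exact ha) (n := 3) (by norm_num)
  rw [hn] at h
  have e : Complex.exp (Complex.I * a) - 1 - Complex.I * a + (a : ℂ) ^ 2 / 2 =
      Complex.exp (Complex.I * a) - ∑ m ∈ Finset.range 3, (Complex.I * (a : ℂ)) ^ m / m.factorial := by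
    simp only [Finset.sum_range_succ, Finset.sum_range_zero, Nat.factorial]
    push_cast
    linear_combination ((a : ℂ) ^ 2 / 2) * Complex.I_sq
  rw [e]
  refine h.trans (mul_le_of_le_one_right (by positivity) ?_)
  norm_num [Nat.factorial]

lemma tendsto_log_add_div_sqrt (c d : ℝ) :
    Tendsto (fun L : ℝ => (c * log L + d) / √L) atTop (nhds 0) := by
  have h1 : Tendsto (fun L : ℝ => log L / L ^ (1 / 2 : ℝ)) atTop (nhds 0) :=
    (isLittleO_log_rpow_atTop (by norm_num)).tendsto_div_nhds_zero
  have h2 : Tendsto (fun L : ℝ => d / √L) atTop (nhds 0) :=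
    tendsto_sqrt_atTop.const_div_atTop d
  have := (h1.const_mul c).add h2
  simp only [mul_zero, add_zero] at this
  refine this.congr fun L => ?_
  rw [← Real.sqrt_eq_rpow]
  ring

lemma tendsto_exp_mul_main (t C : ℝ) {μ : ℝ → ℝ}
    (hμ : ∀ᶠ x in atTop, |μ x - ll x| ≤ 3 * log (ll x) + C) :
    Tendsto (fun x => Complex.exp ((Complex.exp (Complex.I * ((t / √(ll x) : ℝ) : ℂ)) - 1) *
      (μ x : ℂ)) * Complex.exp (-(Complex.I * ((t * √(ll x) : ℝ) : ℂ)))) atTop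
      (nhds (Complex.exp (-(t : ℂ) ^ 2 / 2))) := by
  have hE : Tendsto (fun x => (Complex.exp (Complex.I * ((t / √(ll x) : ℝ) : ℂ)) - 1) * (μ x : ℂ) -
      Complex.I * ((t * √(ll x) : ℝ) : ℂ)) atTop (nhds (-(t : ℂ) ^ 2 / 2)) := by
    rw [tendsto_iff_norm_sub_tendsto_zero]
    have hs : Tendsto (fun x => 1 / √(ll x)) atTop (nhds 0) :=
      (tendsto_sqrt_atTop.comp tendsto_ll).const_div_atTop 1
    have hl := (tendsto_log_add_div_sqrt 3 C).comp tendsto_ll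
    have hb : Tendsto (fun x => |t| ^ 3 * (1 / √(ll x)) * (1 + (3 * log (ll x) + C) / √(ll x) *
        (1 / √(ll x))) + (|t| + t ^ 2 * (1 / √(ll x))) * ((3 * log (ll x) + C) / √(ll x)))
        atTop (nhds 0) := by
      have := ((hs.const_mul (|t| ^ 3)).mul ((hl.mul hs).const_add 1)).add
        (((hs.const_mul (t ^ 2)).const_add |t|).mul hl)
      simpa using this
    refine squeeze_zero' (Eventually.of_forall fun _ => norm_nonneg _) ?_ hb
    have ha : ∀ᶠ x in atTop, |t / √(ll x)| ≤ 1 := by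
      have : Tendsto (fun x => |t / √(ll x)|) atTop (nhds 0) := by
        have := ((tendsto_sqrt_atTop.comp tendsto_ll).const_div_atTop t).abs
        simpa using this
      exact (this.eventually_lt_const one_pos).mono fun _ h => h.le
    filter_upwards [hμ, ha, tendsto_ll.eventually_ge_atTop 1] with x hμ ha hL
    set s := √(ll x) with hsdef
    have hs0 : 0 < s := Real.sqrt_pos.2 (by linarith)
    have hs2 : s ^ 2 = ll x := Real.sq_sqrt (by linarith)
    have hs1 : 1 ≤ s := Real.one_le_sqrt.2 hL
    set a : ℝ := t / s with hadef
    set E : ℝ := 3 * log (ll x) + C with hE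
    have hE0 : 0 ≤ E := (abs_nonneg _).trans hμ
    have has : a * s = t := by rw [hadef]; field_simp
    have e : (Complex.exp (Complex.I * (a : ℂ)) - 1) * (μ x : ℂ) - Complex.I * ((t * s : ℝ) : ℂ) -
        (-(t : ℂ) ^ 2 / 2) = (μ x : ℂ) * (Complex.exp (Complex.I * a) - 1 - Complex.I * a +
          (a : ℂ) ^ 2 / 2) + (Complex.I * a - (a : ℂ) ^ 2 / 2) * ((μ x - ll x : ℝ) : ℂ) := by
      rw [← has, ← hs2]
      push_cast
      ring
    rw [e]
    have hμle : |μ x| ≤ s ^ 2 + E := by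
      rw [hs2]
      have := abs_sub_abs_le_abs_sub (μ x) (ll x)
      rw [abs_of_nonneg (show 0 ≤ ll x by linarith)] at this
      linarith
    have habs : |a| = |t| * (1 / s) := by rw [hadef, abs_div, abs_of_pos hs0]; ring
    refine (norm_add_le _ _).trans (add_le_add ?_ ?_)
    · rw [norm_mul, Complex.norm_real, Real.norm_eq_abs]
      calc _ ≤ (s ^ 2 + E) * |a| ^ 3 :=
            mul_le_mul hμle (norm_exp_I_sub_le ha) (norm_nonneg _) (by positivity)
        _ = _ := by rw [habs]; field_simp
    · rw [norm_mul, Complex.norm_real, Real.norm_eq_abs]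
      have h1 : ‖Complex.I * (a : ℂ) - (a : ℂ) ^ 2 / 2‖ ≤ |a| + |a| ^ 2 := by
        refine (norm_sub_le _ _).trans (add_le_add ?_ ?_)
        · simp
        · simp only [norm_div, norm_pow, Complex.norm_real, Real.norm_eq_abs, Complex.norm_ofNat]
          nlinarith [sq_nonneg |a|]
      calc _ ≤ (|a| + |a| ^ 2) * E := mul_le_mul h1 hμ (abs_nonneg _) (by positivity)
        _ = _ := by
          rw [habs, ← sq_abs t]
          field_simp
  have := (Complex.continuous_exp.tendsto _).comp hE
  refine this.congr fun x => ?_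
  simp only [Function.comp]
  rw [← Complex.exp_add, sub_eq_add_neg]

lemma tendsto_truncation (t C : ℝ) :
    Tendsto (fun L : ℝ => exp (-L + 4 * (|t| / √L) * (L + (3 * log L + C)))) atTop (nhds 0) := by
  have h : Tendsto (fun L : ℝ => L * (1 - 4 * |t| * (1 / √L) - 4 * |t| * ((1 / √L) *
      ((3 * log L + C) / √L) * (1 / √L)))) atTop atTop := by
    refine tendsto_id.atTop_mul_pos one_pos ?_
    have hs : Tendsto (fun L : ℝ => 1 / √L) atTop (nhds 0) := tendsto_sqrt_atTop.const_div_atTop 1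
    have hl := tendsto_log_add_div_sqrt 3 C
    have := ((hs.const_mul (4 * |t|)).const_sub 1).sub (((hs.mul hl).mul hs).const_mul (4 * |t|))
    simpa using this
  refine (tendsto_exp_neg_atTop_nhds_zero.comp h).congr' ?_
  filter_upwards [eventually_gt_atTop 0] with L hL
  simp only [Function.comp]
  congr 1
  have hs0 : 0 < √L := Real.sqrt_pos.2 hL
  have hs2 : √L ^ 2 = L := Real.sq_sqrt hL.le
  field_simp
  rw [hs2]
  ring

lemma tendsto_pow_mul_esum_mainPrimes (t : ℝ) : Tendsto (fun x =>
    ‖Complex.exp (Complex.I * ((t / √(ll x) : ℝ) : ℂ)) - 1‖ ^ (truncOrder x) *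
      esum (mainPrimes x) (truncOrder x) (fun p => 1 / (p : ℝ))) atTop (nhds 0) := by
  obtain ⟨C, hC0, hC⟩ := exists_abs_sum_mainPrimes_sub_le
  refine squeeze_zero' (Eventually.of_forall fun x => mul_nonneg (by positivity)
    (esum_nonneg (fun _ => by positivity) _)) ?_
    ((tendsto_truncation t C).comp tendsto_ll)
  filter_upwards [hC, eventually_truncOrder, tendsto_ll.eventually_ge_atTop 1]
    with x hC ⟨h1, _, _⟩ hL
  set J := truncOrder x
  set μ := ∑ p ∈ mainPrimes x, 1 / (p : ℝ) with hμ
  set s := √(ll x)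
  have hs0 : 0 < s := Real.sqrt_pos.2 (by linarith)
  have hμ0 : 0 ≤ μ := Finset.sum_nonneg fun _ _ => by positivity
  have hμle : μ ≤ ll x + (3 * log (ll x) + C) := by linarith [(abs_le.1 hC).2]
  have hξ : ‖Complex.exp (Complex.I * ((t / s : ℝ) : ℂ)) - 1‖ ≤ |t| / s := by
    refine Real.norm_exp_I_mul_ofReal_sub_one_le.trans (le_of_eq ?_)
    rw [Real.norm_eq_abs, abs_div, abs_of_pos hs0]
  have he : esum (mainPrimes x) J (fun p => 1 / (p : ℝ)) ≤ μ ^ J / J.factorial :=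
    esum_le_pow_div_factorial (fun _ => by positivity) _ _
  have h4 : exp J ≤ 4 ^ J := by
    rw [← exp_one_pow]
    exact pow_le_pow_left₀ (exp_pos _).le (by linarith [exp_one_lt_d9]) _
  have hfac := Real.pow_div_factorial_le_exp (4 * (|t| / s) * μ) (by positivity) J
  calc _ ≤ (|t| / s) ^ J * (μ ^ J / J.factorial) := by
        refine mul_le_mul (by gcongr) he (esum_nonneg (fun _ => by positivity) _) (by positivity)
    _ = ((4 * (|t| / s) * μ) ^ J / J.factorial) / 4 ^ J := by
        rw [mul_pow, mul_pow]
        field_simp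
    _ ≤ exp (4 * (|t| / s) * μ) / exp J := by gcongr
    _ = exp (-J + 4 * (|t| / s) * μ) := by rw [← exp_sub]; ring_nf
    _ ≤ _ := by
      simp only [Function.comp]
      refine exp_le_exp.2 ?_
      gcongr

/-- The number of main primes dividing `z`. -/
noncomputable def mainCount (x : ℝ) (z : ℤ) : ℝ := ∑ p ∈ mainPrimes x, dvdInd z p

lemma divWeight_exp_sub_one (P : Finset ℕ) (a : ℝ) (z : ℤ) :
    divWeight P (Complex.exp (Complex.I * a) - 1) z =
      Complex.exp (Complex.I * a * ((∑ p ∈ P, dvdInd z p : ℝ) : ℂ)) := by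
  rw [Complex.ofReal_sum, Finset.mul_sum, Complex.exp_sum, divWeight]
  refine Finset.prod_congr rfl fun p _ => ?_
  rw [dvdInd]
  split_ifs <;> simp

lemma eventually_mem_mainPrimes : ∀ᶠ x : ℝ in atTop, ∀ p ∈ mainPrimes x,
    p.Prime ∧ auxHigh x < p ∧ (p : ℝ) ≤ x := by
  filter_upwards [eventually_log_log_mainEnd] with x ⟨h1, h2, _⟩ p hp
  rw [mainPrimes, Finset.mem_filter, Nat.mem_primesLE] at hp
  exact ⟨hp.1.2, hp.2, ((Nat.le_floor_iff (by linarith)).1 hp.1.1).trans h2⟩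

/-- The characteristic function of the normalised number of main primes dividing `n - τ(n)`
converges to that of the standard Gaussian. -/
theorem tendsto_charFun_mainCount (t : ℝ) : Tendsto (fun x : ℝ =>
    (∑ n ∈ Finset.Ioc 0 ⌊x⌋₊, Complex.exp (Complex.I *
      ((t * ((mainCount x ((n : ℤ) - n.divisors.card) - ll x) / √(ll x)) : ℝ) : ℂ))) / (⌊x⌋₊ : ℂ))
    atTop (nhds (Complex.exp (-(t : ℂ) ^ 2 / 2))) := by
  obtain ⟨C, hC0, hC⟩ := exists_abs_sum_mainPrimes_sub_le
  set ξ : ℝ → ℂ := fun x => Complex.exp (Complex.I * ((t / √(ll x) : ℝ) : ℂ)) - 1 with hξdef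
  have hξle : ∀ x, ‖ξ x‖ ≤ |t / √(ll x)| := fun x => Real.norm_exp_I_mul_ofReal_sub_one_le
  have hξn : ∀ x, ‖1 + ξ x‖ ≤ 1 := fun x => by
    simp only [hξdef, add_sub_cancel]
    rw [Complex.norm_exp_I_mul_ofReal]
  have ha : Tendsto (fun x => |t / √(ll x)|) atTop (nhds 0) := by
    have := ((tendsto_sqrt_atTop.comp tendsto_ll).const_div_atTop t).abs
    simpa using this
  have hξ1 : ∀ᶠ x in atTop, ‖ξ x‖ ≤ 1 :=
    (ha.eventually_lt_const one_pos).mono fun x h => (hξle x).trans h.le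
  have m1 := tendsto_norm_sum_divWeight_sub (P := mainPrimes) (ξ := ξ) (J := truncOrder)
    (Eventually.of_forall hξn) hξ1 eventually_mem_mainPrimes
    (eventually_truncOrder.mono fun x h => by linarith [h.2.1]) eventually_card_mainPrimes_pow_le
    (tendsto_pow_mul_esum_mainPrimes t)
  have m2 := tendsto_exp_mul_main t C hC
  have m3 : Tendsto (fun x => |t / √(ll x)| ^ 2 * ∑' n : ℕ, 1 / (n : ℝ) ^ 2) atTop (nhds 0) := by
    have := (ha.pow 2).mul_const (∑' n : ℕ, 1 / (n : ℝ) ^ 2)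
    simpa using this
  have m4 := m1.add m3
  rw [add_zero] at m4
  refine tendsto_of_tendsto_of_dist m2 (squeeze_zero' (Eventually.of_forall fun _ => dist_nonneg)
    ?_ m4)
  filter_upwards [hξ1, eventually_floor_ge_half, tendsto_ll.eventually_ge_atTop 1]
    with x hξ1 ⟨_, hN⟩ hL
  set s := √(ll x) with hs
  have hs0 : 0 < s := Real.sqrt_pos.2 (by linarith)
  have hs2 : s ^ 2 = ll x := Real.sq_sqrt (by linarith)
  set D := Complex.exp (-(Complex.I * ((t * s : ℝ) : ℂ))) with hD
  have hDn : ‖D‖ = 1 := by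
    have : D = Complex.exp (Complex.I * ((-(t * s) : ℝ) : ℂ)) := by
      rw [hD]; push_cast; ring_nf
    rw [this, Complex.norm_exp_I_mul_ofReal]
  have hterm : ∀ n : ℕ, Complex.exp (Complex.I * ((t * ((mainCount x ((n : ℤ) - n.divisors.card) -
      ll x) / s) : ℝ) : ℂ)) = divWeight (mainPrimes x) (ξ x) ((n : ℤ) - n.divisors.card) * D := by
    intro n
    rw [hξdef, divWeight_exp_sub_one, hD, ← Complex.exp_add]
    congr 1
    change _ = Complex.I * ((t / s : ℝ) : ℂ) * ((mainCount x ((n : ℤ) - n.divisors.card) : ℝ) : ℂ) + _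
    rw [← hs2]
    have : (s : ℂ) ≠ 0 := by exact_mod_cast hs0.ne'
    push_cast
    field_simp
    ring
  have hN' : ((⌊x⌋₊ : ℕ) : ℂ) ≠ 0 := by
    have := hN.ne'
    exact_mod_cast this
  simp only [hterm]
  rw [← Finset.sum_mul, dist_eq_norm]
  have e : Complex.exp (ξ x * ((∑ p ∈ mainPrimes x, 1 / (p : ℝ) : ℝ) : ℂ)) * D -
      (∑ n ∈ Finset.Ioc 0 ⌊x⌋₊, divWeight (mainPrimes x) (ξ x) ((n : ℤ) - n.divisors.card)) * D /
        (⌊x⌋₊ : ℂ) = -(((∑ n ∈ Finset.Ioc 0 ⌊x⌋₊, (divWeight (mainPrimes x) (ξ x)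
          ((n : ℤ) - n.divisors.card) - divMean (mainPrimes x) (ξ x))) / (⌊x⌋₊ : ℂ) +
        (divMean (mainPrimes x) (ξ x) -
          Complex.exp (ξ x * ((∑ p ∈ mainPrimes x, 1 / (p : ℝ) : ℝ) : ℂ)))) * D) := by
    rw [Finset.sum_sub_distrib]
    simp only [Finset.sum_const, Nat.card_Ioc, tsub_zero, nsmul_eq_mul]
    field_simp
    ring
  change ‖Complex.exp (ξ x * ((∑ p ∈ mainPrimes x, 1 / (p : ℝ) : ℝ) : ℂ)) * D - _‖ ≤ _
  rw [e, norm_neg, norm_mul, hDn, mul_one]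
  refine (norm_add_le _ _).trans (add_le_add (le_of_eq ?_) ?_)
  · rw [norm_div, Complex.norm_natCast]
  · refine (norm_divMean_sub_exp_le (hξn x) hξ1 _).trans ?_
    exact mul_le_mul_of_nonneg_right (pow_le_pow_left₀ (norm_nonneg _) (hξle x) 2)
      (tsum_nonneg fun _ => by positivity)

lemma norm_divWeight_neg_le {r : ℝ} (hr : 1 ≤ r) (P : Finset ℕ) (z : ℤ) :
    ‖divWeight P ((-(1 / r) : ℝ) : ℂ) z‖ ≤ exp (-((∑ p ∈ P, dvdInd z p) / r)) := by
  rw [Finset.sum_div, ← Finset.sum_neg_distrib, Real.exp_sum, divWeight, norm_prod]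
  refine Finset.prod_le_prod (fun _ _ => norm_nonneg _) fun p _ => ?_
  have h1 : 1 / r ≤ 1 := by rw [div_le_one (by linarith)]; exact hr
  rw [dvdInd]
  split_ifs
  · have e : (1 : ℂ) + ((-(1 / r) : ℝ) : ℂ) * ((1 : ℝ) : ℂ) = ((1 - 1 / r : ℝ) : ℂ) := by
      push_cast; ring
    rw [e, Complex.norm_real, Real.norm_of_nonneg (by linarith)]
    exact one_sub_le_exp_neg _
  · simp

lemma norm_one_add_neg_le_one {r : ℝ} (hr : 1 ≤ r) : ‖1 + ((-(1 / r) : ℝ) : ℂ)‖ ≤ 1 := by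
  have h0 : 0 ≤ 1 / r := by positivity
  have h1 : 1 / r ≤ 1 := by rw [div_le_one (by linarith)]; exact hr
  have e : (1 : ℂ) + ((-(1 / r) : ℝ) : ℂ) = ((1 - 1 / r : ℝ) : ℂ) := by push_cast; ring
  rw [e, Complex.norm_real, Real.norm_of_nonneg (by linarith)]
  linarith

lemma norm_one_sub_divMean_le {ξ : ℂ} (hξ : ‖1 + ξ‖ ≤ 1) (P : Finset ℕ) :
    ‖1 - divMean P ξ‖ ≤ ‖ξ‖ * ∑ p ∈ P, 1 / (p : ℝ) := by
  have h := norm_prod_sub_prod_le P (fun _ => (1 : ℂ))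
    (fun p => 1 + ξ * ((1 / (p : ℝ) : ℝ) : ℂ)) (fun _ _ => by simp)
    (fun p _ => norm_one_add_mul_le_one hξ (by positivity) (one_div_natCast_le_one p))
  rw [Finset.prod_const_one] at h
  refine h.trans (le_of_eq ?_)
  rw [Finset.mul_sum]
  refine Finset.sum_congr rfl fun p _ => ?_
  rw [sub_add_cancel_left, norm_neg, norm_mul, Complex.norm_real,
    Real.norm_of_nonneg (by positivity)]

lemma card_filter_lt_sum_dvdInd_le {r : ℝ} (hr : 1 ≤ r) (P : Finset ℕ) (S : Finset ℕ)
    (f : ℕ → ℤ) : ((S.filter (fun n => r < ∑ p ∈ P, dvdInd (f n) p)).card : ℝ) ≤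
      2 * (‖∑ n ∈ S, (divWeight P ((-(1 / r) : ℝ) : ℂ) (f n) - divMean P ((-(1 / r) : ℝ) : ℂ))‖ +
        S.card * ((∑ p ∈ P, 1 / (p : ℝ)) / r)) := by
  set ξ : ℂ := ((-(1 / r) : ℝ) : ℂ) with hξdef
  have hξ : ‖1 + ξ‖ ≤ 1 := norm_one_add_neg_le_one hr
  have hξn : ‖ξ‖ = 1 / r := by
    rw [hξdef, Complex.norm_real, norm_neg, Real.norm_of_nonneg (by positivity)]
  have hnn : ∀ n, 0 ≤ (1 - divWeight P ξ (f n)).re := fun n => by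
    have := (Complex.re_le_norm _).trans (norm_divWeight_le_one hξ P (f n))
    simp only [Complex.sub_re, Complex.one_re]
    linarith
  have hbad : ∀ n ∈ S.filter (fun n => r < ∑ p ∈ P, dvdInd (f n) p),
      (1 / 2 : ℝ) ≤ (1 - divWeight P ξ (f n)).re := fun n hn => by
    have h1 := (Complex.re_le_norm _).trans (norm_divWeight_neg_le hr P (f n))
    have h2 : 1 ≤ (∑ p ∈ P, dvdInd (f n) p) / r := by
      rw [one_le_div (by linarith)]
      exact (Finset.mem_filter.1 hn).2.le
    have h3 : exp (-((∑ p ∈ P, dvdInd (f n) p) / r)) ≤ exp (-1) := exp_le_exp.2 (by linarith)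
    have h4 := exp_neg_one_lt_half
    simp only [Complex.sub_re, Complex.one_re]
    linarith
  have h1 : ((S.filter (fun n => r < ∑ p ∈ P, dvdInd (f n) p)).card : ℝ) * (1 / 2) ≤
      ∑ n ∈ S, (1 - divWeight P ξ (f n)).re := by
    rw [← nsmul_eq_mul]
    exact (Finset.card_nsmul_le_sum _ _ _ hbad).trans
      (Finset.sum_le_sum_of_subset_of_nonneg (Finset.filter_subset _ _) fun n _ _ => hnn n)
  have h2 : ∑ n ∈ S, (1 - divWeight P ξ (f n)) =
      S.card * (1 - divMean P ξ) - ∑ n ∈ S, (divWeight P ξ (f n) - divMean P ξ) := by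
    simp only [Finset.sum_sub_distrib, Finset.sum_const, nsmul_eq_mul]
    ring
  have h3 : ∑ n ∈ S, (1 - divWeight P ξ (f n)).re ≤
      ‖∑ n ∈ S, (divWeight P ξ (f n) - divMean P ξ)‖ + S.card * ((∑ p ∈ P, 1 / (p : ℝ)) / r) := by
    rw [← Complex.re_sum, h2]
    refine (Complex.re_le_norm _).trans ((norm_sub_le _ _).trans ?_)
    rw [add_comm, norm_mul, Complex.norm_natCast]
    gcongr
    refine (norm_one_sub_divMean_le hξ P).trans (le_of_eq ?_)
    rw [hξn]
    ring
  linarith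

lemma tendsto_const_mul_sqrt_ll {ε : ℝ} (hε : 0 < ε) :
    Tendsto (fun x => ε * √(ll x)) atTop atTop :=
  (tendsto_sqrt_atTop.comp tendsto_ll).const_mul_atTop hε

/-- Few `n` have many middle primes dividing `n - τ(n)`. -/
theorem tendsto_card_filter_midPrimes {ε : ℝ} (hε : 0 < ε) : Tendsto (fun x : ℝ =>
    (((Finset.Ioc 0 ⌊x⌋₊).filter (fun n : ℕ => ε * √(ll x) <
      ∑ p ∈ midPrimes x, dvdInd ((n : ℤ) - n.divisors.card) p)).card : ℝ) / (⌊x⌋₊ : ℝ))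
    atTop (nhds 0) := by
  obtain ⟨C, hC0, hC⟩ := exists_sum_midPrimes_le
  have hr := (tendsto_const_mul_sqrt_ll hε).eventually_ge_atTop 1
  have hc : Tendsto (fun x => (∑ p ∈ midPrimes x, 1 / (p : ℝ)) / (ε * √(ll x))) atTop (nhds 0) := by
    have h := ((tendsto_log_add_div_sqrt 1 C).comp tendsto_ll).const_mul (1 / ε)
    rw [mul_zero] at h
    refine squeeze_zero' (Eventually.of_forall fun x => by positivity) ?_ h
    filter_upwards [hC] with x hC
    simp only [Function.comp, one_mul]
    calc _ ≤ (log (ll x) + C) / (ε * √(ll x)) := by gcongr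
      _ = _ := by rw [div_mul_div_comm, one_mul]
  have main := tendsto_norm_sum_divWeight_sub (P := midPrimes)
    (ξ := fun x => ((-(1 / (ε * √(ll x))) : ℝ) : ℂ)) (J := fun _ => 1)
    (hr.mono fun x h => norm_one_add_neg_le_one h)
    (hr.mono fun x h => by
      rw [Complex.norm_real, norm_neg, Real.norm_of_nonneg (by positivity)]
      rw [div_le_one (by linarith)]
      exact h)
    (by
      filter_upwards [eventually_ge_atTop 1] with x hx p hp
      rw [midPrimes, Finset.mem_filter, Nat.mem_primesLE] at hp
      refine ⟨hp.1.2, hp.2.1, ((Nat.le_floor_iff (by positivity)).1 hp.1.1).trans ?_⟩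
      conv_rhs => rw [← rpow_one x]
      exact rpow_le_rpow_of_exponent_le hx (by norm_num))
    (by
      filter_upwards [tendsto_ll.eventually_ge_atTop 0] with x hx
      push_cast
      linarith)
    (by
      filter_upwards [eventually_ge_atTop 1] with x hx j hj
      have h1 : (1 : ℝ) ≤ x ^ (1 / 8 : ℝ) := one_le_rpow hx (by norm_num)
      have hcard : ((midPrimes x).card : ℝ) ≤ x ^ (1 / 8 : ℝ) := by
        refine le_trans ?_ (Nat.floor_le (by positivity))
        exact Nat.cast_le.2 ((Finset.card_filter_le _ _).trans (card_primesLE_le _))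
      interval_cases j
      · simpa using h1
      · simpa using hcard)
    (by
      refine hc.congr' ?_
      filter_upwards [hr] with x h
      rw [pow_one, esum_one, Complex.norm_real, norm_neg, Real.norm_of_nonneg (by positivity)]
      ring)
  have tt := (main.add hc).const_mul 2
  simp only [add_zero, mul_zero] at tt
  refine squeeze_zero' (Eventually.of_forall fun x => by positivity) ?_ tt
  filter_upwards [hr, eventually_floor_ge_half] with x h ⟨_, hN⟩
  have := card_filter_lt_sum_dvdInd_le h (midPrimes x) (Finset.Ioc 0 ⌊x⌋₊)
    (fun n : ℕ => (n : ℤ) - n.divisors.card)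
  rw [Nat.card_Ioc, tsub_zero] at this
  rw [div_le_iff₀ hN]
  refine this.trans (le_of_eq ?_)
  field_simp

lemma exists_card_divisors_eq (n : ℕ) : 0 < n → ∃ k t s : ℕ, n.divisors.card = 2 ^ k * t ∧
    0 < t ∧ s ^ 2 ∣ n ∧ t ≤ s ^ 2 := by
  induction n using Nat.recOnPosPrimePosCoprime with
  | zero => intro h; exact absurd h (lt_irrefl 0)
  | one => intro _; exact ⟨0, 1, 1, by simp⟩
  | prime_pow p a hp ha =>
    intro _
    rw [Nat.divisors_prime_pow hp, Finset.card_map, Finset.card_range]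
    rcases Nat.lt_or_ge a 2 with h | h
    · have : a = 1 := by omega
      subst this
      exact ⟨1, 1, 1, by simp⟩
    · refine ⟨0, a + 1, p ^ (a / 2), by simp, by omega, ?_, ?_⟩
      · rw [← pow_mul]
        exact pow_dvd_pow _ (by omega)
      · have h1 : ∀ b : ℕ, 1 ≤ b → 2 * b + 2 ≤ 4 ^ b := fun b hb => by
          induction b, hb using Nat.le_induction with
          | base => norm_num
          | succ b hb ih => rw [pow_succ]; omega
        have h2 : 4 ^ (a / 2) ≤ (p ^ (a / 2)) ^ 2 := by
          rw [← pow_mul, mul_comm, pow_mul]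
          refine Nat.pow_le_pow_left ?_ _
          nlinarith [hp.two_le]
        have := h1 (a / 2) (by omega)
        omega
  | coprime a b ha hb hab iha ihb =>
    intro _
    obtain ⟨k, t, s, h1, h2, h3, h4⟩ := iha (by omega)
    obtain ⟨k', t', s', h1', h2', h3', h4'⟩ := ihb (by omega)
    refine ⟨k + k', t * t', s * s', ?_, Nat.mul_pos h2 h2', ?_, ?_⟩
    · rw [hab.card_divisors_mul, h1, h1', pow_add]
      ring
    · rw [mul_pow]
      exact mul_dvd_mul h3 h3'
    · rw [mul_pow]
      exact Nat.mul_le_mul h4 h4'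

open Classical in
lemma card_filter_exists_sq_dvd_le {R : ℕ} (hR : 0 < R) (N : ℕ) :
    (((Finset.Ioc 0 N).filter (fun n => ∃ s, R < s ∧ s ^ 2 ∣ n)).card : ℝ) ≤ N / R := by
  have hsub : (Finset.Ioc 0 N).filter (fun n => ∃ s, R < s ∧ s ^ 2 ∣ n) ⊆
      (Finset.Ioc R N).biUnion (fun s => (Finset.Ioc 0 N).filter (fun n => s ^ 2 ∣ n)) := by
    intro n hn
    rw [Finset.mem_filter, Finset.mem_Ioc] at hn
    obtain ⟨⟨h0, hN⟩, s, hs, hd⟩ := hn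
    rw [Finset.mem_biUnion]
    refine ⟨s, Finset.mem_Ioc.2 ⟨hs, ?_⟩, Finset.mem_filter.2 ⟨Finset.mem_Ioc.2 ⟨h0, hN⟩, hd⟩⟩
    have := Nat.le_of_dvd h0 hd
    nlinarith
  have h1 : ((((Finset.Ioc R N).biUnion (fun s =>
      (Finset.Ioc 0 N).filter (fun n => s ^ 2 ∣ n))).card : ℕ) : ℝ) ≤
      ∑ s ∈ Finset.Ioc R N, (N : ℝ) * ((s : ℝ) ^ 2)⁻¹ := by
    refine (Nat.cast_le.2 Finset.card_biUnion_le).trans ?_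
    push_cast
    refine Finset.sum_le_sum fun s _ => ?_
    rw [Nat.Ioc_filter_dvd_card_eq_div, ← div_eq_mul_inv]
    exact Nat.cast_div_le.trans (by push_cast; exact le_rfl)
  refine ((Nat.cast_le.2 (Finset.card_le_card hsub)).trans h1).trans ?_
  rw [← Finset.mul_sum, div_eq_mul_inv]
  refine mul_le_mul_of_nonneg_left ?_ (Nat.cast_nonneg _)
  rcases le_or_gt R N with h | h
  · have := sum_Ioc_inv_sq_le_sub (α := ℝ) hR.ne' h
    have h2 : (0 : ℝ) ≤ (N : ℝ)⁻¹ := by positivity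
    linarith
  · rw [Finset.Ioc_eq_empty (by omega), Finset.sum_empty]
    positivity

lemma sum_dvdInd_eq_card (P : Finset ℕ) (z : ℤ) :
    ∑ p ∈ P, dvdInd z p = ((P.filter (fun p : ℕ => (p : ℤ) ∣ z)).card : ℝ) := by
  simp only [dvdInd, Finset.sum_boole]

lemma esum_dvdInd_eq_choose (P : Finset ℕ) (j : ℕ) (z : ℤ) :
    esum P j (fun p => dvdInd z p) =
      (((P.filter (fun p : ℕ => (p : ℤ) ∣ z)).card.choose j : ℕ) : ℝ) := by
  rw [esum, ← Finset.card_powersetCard, Finset.cast_card]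
  have hsub : (P.filter (fun p : ℕ => (p : ℤ) ∣ z)).powersetCard j ⊆ P.powersetCard j :=
    Finset.powersetCard_mono (Finset.filter_subset _ _)
  rw [← Finset.sum_subset_zero_on_sdiff hsub (g := fun s => ∏ p ∈ s, dvdInd z p)
    (f := fun _ => (1 : ℝ))]
  · intro s hs
    rw [Finset.mem_sdiff, Finset.mem_powersetCard, Finset.mem_powersetCard] at hs
    obtain ⟨⟨h1, h2⟩, h3⟩ := hs
    have : ∃ p ∈ s, ¬ (p : ℤ) ∣ z := by
      by_contra! h
      exact h3 ⟨fun p hp => Finset.mem_filter.2 ⟨h1 hp, h p hp⟩, h2⟩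
    obtain ⟨p, hp, hpz⟩ := this
    exact Finset.prod_eq_zero hp (by simp [dvdInd, hpz])
  · intro s hs
    rw [Finset.mem_powersetCard] at hs
    rw [Finset.prod_eq_one]
    intro p hp
    simp [dvdInd, (Finset.mem_filter.1 (hs.1 hp)).2]

lemma sum_esum_dvdInd_sub_le {P : Finset ℕ} (hP : ∀ p ∈ P, p.Prime) (N : ℕ) (v : ℤ) (j : ℕ) :
    ∑ n ∈ Finset.Ioc 0 N, esum P j (fun p => dvdInd ((n : ℤ) - v) p) ≤
      N * (∑ p ∈ P, 1 / (p : ℝ)) ^ j + (P.card : ℝ) ^ j := by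
  have h1 : ∀ s ∈ P.powersetCard j, ∑ n ∈ Finset.Ioc 0 N, ∏ p ∈ s, dvdInd ((n : ℤ) - v) p ≤
      N * ∏ p ∈ s, 1 / (p : ℝ) + 1 := by
    intro s hs
    have hs' : ∀ p ∈ s, p.Prime := fun p hp => hP p ((Finset.mem_powersetCard.1 hs).1 hp)
    have e : ∑ n ∈ Finset.Ioc 0 N, ∏ p ∈ s, dvdInd ((n : ℤ) - v) p =
        (((Finset.Ioc 0 N).filter
          (fun n : ℕ => ((∏ p ∈ s, p : ℕ) : ℤ) ∣ (n : ℤ) - v)).card : ℝ) := by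
      rw [← Finset.sum_boole]
      refine Finset.sum_congr rfl fun n _ => ?_
      rw [prod_dvdInd hs', dvdInd]
    rw [e]
    refine (card_filter_le_of_dvd_sub (Finset.prod_pos fun p hp => (hs' p hp).pos) N _
      fun m n hm hn => ?_).trans (le_of_eq ?_)
    · have := dvd_sub hm hn
      rwa [sub_sub_sub_cancel_right] at this
    · rw [Finset.prod_div_distrib, Finset.prod_const_one]
      push_cast
      ring
  simp only [esum]
  rw [Finset.sum_comm]
  refine (Finset.sum_le_sum h1).trans ?_
  rw [Finset.sum_add_distrib, ← Finset.mul_sum]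
  refine add_le_add (mul_le_mul_of_nonneg_left ?_ (Nat.cast_nonneg _)) ?_
  · have h2 : esum P j (fun p => 1 / (p : ℝ)) ≤ _ :=
      esum_le_pow_div_factorial (fun _ => by positivity) P j
    refine h2.trans (div_le_self (by positivity) ?_)
    exact_mod_cast Nat.one_le_iff_ne_zero.2 (Nat.factorial_ne_zero _)
  · rw [Finset.sum_const, nsmul_eq_mul, mul_one]
    exact card_powersetCard_le_pow P j

lemma card_filter_lt_sum_dvdInd_sub_mul_le {P : Finset ℕ} (hP : ∀ p ∈ P, p.Prime) (N : ℕ) (v : ℤ)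
    (j : ℕ) {r : ℝ} (hr : 2 * (j : ℝ) ≤ r) :
    (((Finset.Ioc 0 N).filter
      (fun n : ℕ => r < ∑ p ∈ P, dvdInd ((n : ℤ) - v) p)).card : ℝ) * ((r / 2) ^ j / j.factorial) ≤
      N * (∑ p ∈ P, 1 / (p : ℝ)) ^ j + (P.card : ℝ) ^ j := by
  refine le_trans ?_ (sum_esum_dvdInd_sub_le hP N v j)
  rw [← nsmul_eq_mul]
  refine (Finset.card_nsmul_le_sum _ (fun n : ℕ => esum P j (fun p => dvdInd ((n : ℤ) - v) p)) _
    ?_).trans (Finset.sum_le_sum_of_subset_of_nonneg (Finset.filter_subset _ _)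
      fun n _ _ => esum_nonneg (fun p => dvdInd_nonneg _ _) _)
  intro n hn
  have h1 := (Finset.mem_filter.1 hn).2
  rw [sum_dvdInd_eq_card] at h1
  rw [esum_dvdInd_eq_choose]
  refine le_trans ?_ (Nat.pow_le_choose j _)
  have hj0 : (0 : ℝ) ≤ j := Nat.cast_nonneg _
  have hle : j ≤ (P.filter (fun p : ℕ => (p : ℤ) ∣ (n : ℤ) - v)).card + 1 := by
    have : (j : ℝ) ≤ (((P.filter (fun p : ℕ => (p : ℤ) ∣ (n : ℤ) - v)).card : ℕ) : ℝ) := by linarith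
    have : j ≤ (P.filter (fun p : ℕ => (p : ℤ) ∣ (n : ℤ) - v)).card := by exact_mod_cast this
    omega
  gcongr
  · linarith
  · rw [Nat.cast_sub hle]
    push_cast
    linarith

open Classical in
lemma card_filter_card_divisors_le {x : ℝ} {R V N : ℕ} (hR : 0 < R) (hL : ll x ≤ R)
    (hV : (V : ℝ) ≤ exp (2 * ll x)) (A : ℕ → ℤ → Prop) [∀ n z, Decidable (A n z)] :
    (((Finset.Ioc 0 N).filter (fun n => A n (n.divisors.card : ℤ))).card : ℝ) ≤
      N / R + ((Finset.Ioc 0 N).filter (fun n => V < 2 * n.divisors.card)).card +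
      ∑ q ∈ Finset.range (3 * R + 1) ×ˢ Finset.Ioc 0 (R ^ 2),
        (((Finset.Ioc 0 N).filter (fun n => A n ((2 ^ q.1 * q.2 : ℕ) : ℤ))).card : ℝ) := by
  have hsub : (Finset.Ioc 0 N).filter (fun n => A n (n.divisors.card : ℤ)) ⊆
      ((Finset.Ioc 0 N).filter (fun n => ∃ s, R < s ∧ s ^ 2 ∣ n) ∪
        (Finset.Ioc 0 N).filter (fun n => V < 2 * n.divisors.card)) ∪
      (Finset.range (3 * R + 1) ×ˢ Finset.Ioc 0 (R ^ 2)).biUnion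
        (fun q => (Finset.Ioc 0 N).filter (fun n => A n ((2 ^ q.1 * q.2 : ℕ) : ℤ))) := by
    intro n hn
    rw [Finset.mem_filter] at hn
    obtain ⟨hn, hA⟩ := hn
    have h0 := (Finset.mem_Ioc.1 hn).1
    rw [Finset.mem_union, Finset.mem_union, Finset.mem_filter, Finset.mem_filter,
      Finset.mem_biUnion]
    by_cases h1 : ∃ s, R < s ∧ s ^ 2 ∣ n
    · exact Or.inl (Or.inl ⟨hn, h1⟩)
    by_cases h2 : V < 2 * n.divisors.card
    · exact Or.inl (Or.inr ⟨hn, h2⟩)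
    right
    obtain ⟨k, t, s, e, ht, hs, hts⟩ := exists_card_divisors_eq n h0
    have hsR : s ≤ R := by
      by_contra! h
      exact h1 ⟨s, h, hs⟩
    refine ⟨(k, t), Finset.mem_product.2 ⟨Finset.mem_range.2 ?_, Finset.mem_Ioc.2 ⟨ht, ?_⟩⟩,
      Finset.mem_filter.2 ⟨hn, ?_⟩⟩
    · have h3 : 2 ^ k ≤ V := by
        have : 2 ^ k * 1 ≤ 2 ^ k * t := Nat.mul_le_mul_left _ ht
        omega
      have h4 : (2 : ℝ) ^ k ≤ exp (2 * ll x) := le_trans (by exact_mod_cast h3) hV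
      have h5 := log_le_log (by positivity) h4
      rw [log_pow, log_exp] at h5
      have h6 := log_two_gt_d9
      have h7 : (k : ℝ) ≤ 3 * R := by
        have : (k : ℝ) * (2 / 3) ≤ k * log 2 :=
          mul_le_mul_of_nonneg_left (by linarith) (Nat.cast_nonneg _)
        linarith
      have : k ≤ 3 * R := by exact_mod_cast h7
      change k < 3 * R + 1
      omega
    · exact hts.trans (Nat.pow_le_pow_left hsR 2)
    · rwa [e] at hA
  refine (Nat.cast_le.2 (Finset.card_le_card hsub)).trans ?_
  refine (Nat.cast_le.2 (Finset.card_union_le _ _)).trans ?_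
  push_cast
  refine add_le_add ((Nat.cast_le.2 (Finset.card_union_le _ _)).trans ?_) ?_
  · push_cast
    exact add_le_add (card_filter_exists_sq_dvd_le hR N) le_rfl
  · exact (Nat.cast_le.2 Finset.card_biUnion_le).trans (by push_cast; exact le_rfl)

lemma eventually_exp_twelve_sq_le : ∀ᶠ x : ℝ in atTop,
    exp (ll x ^ 2) ^ 12 ≤ (⌊x⌋₊ : ℝ) := by
  filter_upwards [eventually_floor_ge_half, eventually_exp_ll, eventually_gt_atTop 1,
    tendsto_ll.eventually_ge_atTop 1,
    ((tendsto_exp_div_pow_atTop 2).comp tendsto_ll).eventually_ge_atTop 13]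
    with x ⟨h1, _⟩ h2 h3 hL h4
  simp only [Function.comp] at h4
  rw [le_div_iff₀ (by positivity)] at h4
  have hx : x = exp (exp (ll x)) := by rw [h2, exp_log (by linarith)]
  rw [← exp_nat_mul]
  have h5 : exp (12 * ll x ^ 2 + 1) ≤ x := by
    conv_rhs => rw [hx]
    exact exp_le_exp.2 (by nlinarith)
  rw [exp_add] at h5
  have h6 := add_one_le_exp (1 : ℝ)
  have h7 := exp_pos (12 * ll x ^ 2)
  push_cast
  nlinarith

lemma tendsto_small_bound (K C : ℝ) : Tendsto (fun L : ℝ =>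
    K * (((2 * log L + C) / √√L) ^ 12 + (1 / √√L) ^ 12)) atTop (nhds 0) := by
  have hq : Tendsto (fun L : ℝ => √√L) atTop atTop := tendsto_sqrt_atTop.comp tendsto_sqrt_atTop
  have h1 : Tendsto (fun L : ℝ => (2 * log L + C) / √√L) atTop (nhds 0) := by
    refine ((tendsto_log_add_div_sqrt 4 C).comp tendsto_sqrt_atTop).congr' ?_
    filter_upwards [eventually_gt_atTop 0] with L hL
    simp only [Function.comp]
    rw [Real.log_sqrt hL.le]
    ring
  have := (((h1.pow 12).add ((hq.const_div_atTop 1).pow 12))).const_mul K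
  simpa using this

lemma small_bound_eq {q ε : ℝ} (hq : q ≠ 0) (hε : ε ≠ 0) (N μ F : ℝ) :
    32 * (q ^ 4) ^ 3 * (N * (μ ^ 12 + 1) * (F * 2 ^ 12 / (ε * q ^ 2) ^ 12)) =
      N * (32 * (F * 2 ^ 12 / ε ^ 12) * ((μ / q) ^ 12 + (1 / q) ^ 12)) := by
  field_simp

/-- Few `n` have many small primes dividing `n - τ(n)`. -/
theorem tendsto_card_filter_small {ε : ℝ} (hε : 0 < ε) : Tendsto (fun x : ℝ =>
    (((Finset.Ioc 0 ⌊x⌋₊).filter (fun n : ℕ => ε * √(ll x) <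
      ∑ p ∈ Nat.primesLE (auxHigh x), dvdInd ((n : ℤ) - n.divisors.card) p)).card : ℝ) / (⌊x⌋₊ : ℝ))
    atTop (nhds 0) := by
  obtain ⟨C, hC0, hC⟩ := exists_abs_sum_one_div_sub_loglog_le
  have t1 : Tendsto (fun x => 1 / ll x) atTop (nhds 0) := tendsto_ll.const_div_atTop 1
  have t2 := tendsto_one_add_exp_div.comp tendsto_ll
  have t3 := (tendsto_small_bound (32 * (Nat.factorial 12 * 2 ^ 12 / ε ^ 12)) C).comp tendsto_ll
  have tt := (t1.add t2).add t3
  simp only [add_zero] at tt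
  refine squeeze_zero' (Eventually.of_forall fun x => by positivity) ?_ tt
  filter_upwards [(tendsto_const_mul_sqrt_ll hε).eventually_ge_atTop 24, eventually_floor_ge_half,
    eventually_truncOrder, eventually_sum_primesLE_auxHigh_le hC, eventually_exp_ll,
    eventually_exp_twelve_sq_le, tendsto_ll.eventually_ge_atTop 1, eventually_ge_atTop 1]
    with x hr ⟨_, hN⟩ ⟨hR1, hR2, hR3⟩ hμ hexp h12 hL hx
  set L := ll x with hLdef
  set R := truncOrder x with hRdef
  set P := Nat.primesLE (auxHigh x) with hPdef
  set μ := ∑ p ∈ P, 1 / (p : ℝ) with hμdef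
  set r := ε * √L with hrdef
  set N : ℝ := (⌊x⌋₊ : ℝ) with hNdef
  have hμ0 : 0 ≤ μ := Finset.sum_nonneg fun _ _ => by positivity
  have hP : ∀ p ∈ P, p.Prime := fun p hp => (Nat.mem_primesLE.1 hp).2
  have hPc : (P.card : ℝ) ^ 12 ≤ N := by
    refine le_trans ?_ h12
    refine pow_le_pow_left₀ (Nat.cast_nonneg _) ?_ _
    exact (Nat.cast_le.2 (card_primesLE_le _)).trans (Nat.floor_le (exp_pos _).le)
  have hVlow : exp (2 * L) - 1 < divBound x := by
    have := Nat.lt_floor_add_one (exp (2 * L))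
    unfold divBound
    linarith
  have hVup : (divBound x : ℝ) ≤ exp (2 * L) := Nat.floor_le (exp_pos _).le
  have hV1 : 0 < exp (2 * L) - 1 := by have := add_one_le_exp (2 * L); linarith
  have hlogN : log N ≤ exp L := by
    rw [hexp]
    exact log_le_log hN (Nat.floor_le (by linarith))
  have hlogN0 : 0 ≤ log N := Real.log_natCast_nonneg _
  have main := card_filter_card_divisors_le (x := x) (R := R) (V := divBound x) (N := ⌊x⌋₊)
    (by omega) hR1 hVup (fun n z => r < ∑ p ∈ P, dvdInd ((n : ℤ) - z) p)
  have b2 : (((Finset.Ioc 0 ⌊x⌋₊).filter (fun n => divBound x < 2 * n.divisors.card)).card : ℝ) ≤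
      N * (4 * (1 + exp L) / (exp (2 * L) - 1)) := by
    have h := card_filter_lt_card_divisors_mul_le ⌊x⌋₊ (divBound x)
    rw [← le_div_iff₀ (by linarith)] at h
    refine h.trans ?_
    rw [← mul_div_assoc]
    refine div_le_div₀ (by positivity) ?_ hV1 hVlow.le
    have : N * (1 + log N) ≤ N * (1 + exp L) := by gcongr
    have h0 : 0 ≤ N * (1 + exp L) := by positivity
    linarith
  set Q : ℝ := N * (μ ^ 12 + 1) * (Nat.factorial 12 * 2 ^ 12 / r ^ 12) with hQ
  have hr0 : 0 < r := by linarith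
  have b3 : ∀ v : ℤ, (((Finset.Ioc 0 ⌊x⌋₊).filter
      (fun n : ℕ => r < ∑ p ∈ P, dvdInd ((n : ℤ) - v) p)).card : ℝ) ≤ Q := fun v => by
    have h := card_filter_lt_sum_dvdInd_sub_mul_le hP ⌊x⌋₊ v 12 (r := r)
      (by push_cast; linarith)
    rw [← le_div_iff₀ (by positivity)] at h
    refine h.trans ?_
    rw [hQ, div_eq_mul_inv, inv_div, div_pow, div_div_eq_mul_div]
    refine mul_le_mul_of_nonneg_right ?_ (by positivity)
    change N * μ ^ 12 + _ ≤ _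
    linarith
  have b4 : ∑ q ∈ Finset.range (3 * R + 1) ×ˢ Finset.Ioc 0 (R ^ 2),
      (((Finset.Ioc 0 ⌊x⌋₊).filter (fun n : ℕ => r < ∑ p ∈ P,
        dvdInd ((n : ℤ) - ((2 ^ q.1 * q.2 : ℕ) : ℤ)) p)).card : ℝ) ≤ 32 * L ^ 3 * Q := by
    refine (Finset.sum_le_card_nsmul _ _ Q fun q _ => b3 _).trans ?_
    rw [Finset.card_product, Finset.card_range, Nat.card_Ioc, tsub_zero, nsmul_eq_mul]
    refine mul_le_mul_of_nonneg_right ?_ (by positivity)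
    have hR' : (R : ℝ) ≤ 2 * L := by linarith
    have hR0 : (1 : ℝ) ≤ R := by exact_mod_cast hR3
    push_cast
    calc (3 * (R : ℝ) + 1) * (R : ℝ) ^ 2 ≤ (4 * R) * R ^ 2 := by gcongr; linarith
      _ = 4 * (R : ℝ) ^ 3 := by ring
      _ ≤ 4 * (2 * L) ^ 3 := by gcongr
      _ = _ := by ring
  have b1 : N / R ≤ N * (1 / L) := by
    rw [← div_eq_mul_one_div]
    gcongr
  simp only [Function.comp]
  rw [div_le_iff₀ hN]
  refine main.trans ((add_le_add (add_le_add b1 b2) b4).trans ?_)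
  have hq0 : 0 < √√L := Real.sqrt_pos.2 (Real.sqrt_pos.2 (by linarith))
  have hq4 : √√L ^ 4 = L := by
    rw [show √√L ^ 4 = (√√L ^ 2) ^ 2 by ring, Real.sq_sqrt (Real.sqrt_nonneg _),
      Real.sq_sqrt (by linarith)]
  have hq2 : √√L ^ 2 = √L := Real.sq_sqrt (Real.sqrt_nonneg _)
  have b5 : 32 * L ^ 3 * Q ≤ N * (32 * (Nat.factorial 12 * 2 ^ 12 / ε ^ 12) *
      (((2 * log L + C) / √√L) ^ 12 + (1 / √√L) ^ 12)) := by
    have e : 32 * L ^ 3 * Q = N * (32 * (Nat.factorial 12 * 2 ^ 12 / ε ^ 12) *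
        ((μ / √√L) ^ 12 + (1 / √√L) ^ 12)) := by
      have h := small_bound_eq hq0.ne' hε.ne' N μ (Nat.factorial 12)
      rw [hq4, hq2] at h
      exact h
    rw [e]
    gcongr
  linarith

lemma card_divisors_lt_self {n : ℕ} (hn : 3 ≤ n) : n.divisors.card < n := by
  have hsub : n.divisors ⊆ (Finset.Ioc 0 n).erase (n - 1) := by
    intro d hd
    rw [Nat.mem_divisors] at hd
    refine Finset.mem_erase.2 ⟨?_, Finset.mem_Ioc.2
      ⟨Nat.pos_of_dvd_of_pos hd.1 (by omega), Nat.le_of_dvd (by omega) hd.1⟩⟩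
    rintro rfl
    have h1 : n - 1 ∣ n - (n - 1) := Nat.dvd_sub hd.1 dvd_rfl
    have h2 := Nat.le_of_dvd (by omega) h1
    omega
  have h1 := Finset.card_le_card hsub
  rw [Finset.card_erase_of_mem (Finset.mem_Ioc.2 ⟨by omega, by omega⟩), Nat.card_Ioc] at h1
  omega

lemma card_large_primeFactors_le {x : ℝ} (hx : 1 < x) {z : ℕ} (hz : 0 < z) (hzx : (z : ℝ) ≤ x) :
    (z.primeFactors.filter (fun p => ⌊x ^ (1 / 8 : ℝ)⌋₊ < p)).card ≤ 8 := by
  set F := z.primeFactors.filter (fun p => ⌊x ^ (1 / 8 : ℝ)⌋₊ < p)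
  have h1 : ∏ p ∈ F, p ≤ z := Nat.le_of_dvd hz
    ((Finset.prod_dvd_prod_of_subset _ _ _ (Finset.filter_subset _ _)).trans
      (Nat.prod_primeFactors_dvd z))
  have h2 : (x ^ (1 / 8 : ℝ)) ^ F.card ≤ ∏ p ∈ F, (p : ℝ) := by
    rw [← Finset.prod_const]
    refine Finset.prod_le_prod (fun _ _ => by positivity) fun p hp => ?_
    exact (Nat.lt_of_floor_lt (Finset.mem_filter.1 hp).2).le
  have h3 : ∏ p ∈ F, (p : ℝ) ≤ x := by
    rw [← Nat.cast_prod]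
    exact (Nat.cast_le.2 h1).trans hzx
  have h4 : x ^ ((1 / 8 : ℝ) * F.card) ≤ x ^ (1 : ℝ) := by
    rw [rpow_mul (by linarith), rpow_natCast, rpow_one]
    exact h2.trans h3
  rw [Real.rpow_le_rpow_left_iff hx] at h4
  have : (F.card : ℝ) ≤ 8 := by linarith
  exact_mod_cast this

lemma abs_card_primeFactors_sub_mainCount_le {x : ℝ} (hx : 1 < x) {z : ℕ} (hz : 0 < z)
    (hzx : (z : ℝ) ≤ x) : |(z.primeFactors.card : ℝ) - mainCount x z| ≤
      ∑ p ∈ Nat.primesLE (auxHigh x), dvdInd z p + ∑ p ∈ midPrimes x, dvdInd z p + 8 := by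
  rw [mainCount, sum_dvdInd_eq_card, sum_dvdInd_eq_card, sum_dvdInd_eq_card]
  simp only [Int.natCast_dvd_natCast]
  set A := (Nat.primesLE (auxHigh x)).filter (fun p => p ∣ z)
  set B := (mainPrimes x).filter (fun p => p ∣ z) with hB
  set D := (midPrimes x).filter (fun p => p ∣ z)
  set F := z.primeFactors.filter (fun p => ⌊x ^ (1 / 8 : ℝ)⌋₊ < p)
  have hF : F.card ≤ 8 := card_large_primeFactors_le hx hz hzx
  have h1 : B.card ≤ z.primeFactors.card := by
    refine Finset.card_le_card fun p hp => ?_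
    rw [hB, Finset.mem_filter, mainPrimes, Finset.mem_filter, Nat.mem_primesLE] at hp
    exact Nat.mem_primeFactors.2 ⟨hp.1.1.2, hp.2, hz.ne'⟩
  have h2 : z.primeFactors ⊆ ((A ∪ B) ∪ D) ∪ F := by
    intro p hp
    have hp' := Nat.mem_primeFactors.1 hp
    simp only [A, B, D, F, mainPrimes, midPrimes, Finset.mem_union, Finset.mem_filter,
      Nat.mem_primesLE]
    by_cases c1 : p ≤ auxHigh x
    · exact Or.inl (Or.inl (Or.inl ⟨⟨c1, hp'.1⟩, hp'.2.1⟩))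
    by_cases c2 : p ≤ ⌊mainEnd x⌋₊
    · exact Or.inl (Or.inl (Or.inr ⟨⟨⟨c2, hp'.1⟩, not_le.1 c1⟩, hp'.2.1⟩))
    by_cases c3 : p ≤ ⌊x ^ (1 / 8 : ℝ)⌋₊
    · exact Or.inl (Or.inr ⟨⟨⟨c3, hp'.1⟩, not_le.1 c1, not_le.1 c2⟩, hp'.2.1⟩)
    · exact Or.inr ⟨hp, not_le.1 c3⟩
  have h3 : z.primeFactors.card ≤ A.card + B.card + D.card + F.card :=
    (Finset.card_le_card h2).trans ((Finset.card_union_le _ _).trans (Nat.add_le_add_right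
      ((Finset.card_union_le _ _).trans (Nat.add_le_add_right (Finset.card_union_le _ _) _)) _))
  have h4 : z.primeFactors.card ≤ A.card + B.card + D.card + 8 := by omega
  have h1' : (B.card : ℝ) ≤ z.primeFactors.card := by exact_mod_cast h1
  have h4' : (z.primeFactors.card : ℝ) ≤ A.card + B.card + D.card + 8 := by exact_mod_cast h4
  rw [abs_of_nonneg (by linarith)]
  linarith

/-- For most `n`, the number of prime factors of `n - τ(n)` is close to the number of main
primes dividing it. -/
theorem tendsto_card_filter_lt_abs_sub {ε : ℝ} (hε : 0 < ε) : Tendsto (fun x : ℝ =>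
    (((Finset.Ioc 0 ⌊x⌋₊).filter (fun n : ℕ => ε * √(ll x) <
      |((n - n.divisors.card).primeFactors.card : ℝ) -
        mainCount x ((n : ℤ) - n.divisors.card)|)).card : ℝ) / (⌊x⌋₊ : ℝ)) atTop (nhds 0) := by
  have hε3 : 0 < ε / 3 := by positivity
  have t3 : Tendsto (fun x : ℝ => 2 / (⌊x⌋₊ : ℝ)) atTop (nhds 0) :=
    (tendsto_natCast_atTop_atTop.comp tendsto_nat_floor_atTop).const_div_atTop 2
  have tt := ((tendsto_card_filter_small hε3).add (tendsto_card_filter_midPrimes hε3)).add t3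
  simp only [add_zero] at tt
  refine squeeze_zero' (Eventually.of_forall fun x => by positivity) ?_ tt
  filter_upwards [(tendsto_const_mul_sqrt_ll hε3).eventually_ge_atTop 8, eventually_gt_atTop 1]
    with x h8 hx
  rw [← add_div, ← add_div]
  refine div_le_div_of_nonneg_right ?_ (Nat.cast_nonneg _)
  set S := (Finset.Ioc 0 ⌊x⌋₊).filter (fun n : ℕ => ε / 3 * √(ll x) <
      ∑ p ∈ Nat.primesLE (auxHigh x), dvdInd ((n : ℤ) - n.divisors.card) p) with hS
  set M := (Finset.Ioc 0 ⌊x⌋₊).filter (fun n : ℕ => ε / 3 * √(ll x) <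
      ∑ p ∈ midPrimes x, dvdInd ((n : ℤ) - n.divisors.card) p) with hM
  have hsub : (Finset.Ioc 0 ⌊x⌋₊).filter (fun n : ℕ => ε * √(ll x) <
      |((n - n.divisors.card).primeFactors.card : ℝ) -
        mainCount x ((n : ℤ) - n.divisors.card)|) ⊆ (S ∪ M) ∪ Finset.Ioc 0 2 := by
    intro n hn
    rw [Finset.mem_filter] at hn
    obtain ⟨hn, hlt⟩ := hn
    have hn' := Finset.mem_Ioc.1 hn
    rw [Finset.mem_union, Finset.mem_union]
    by_cases h2 : n ≤ 2
    · exact Or.inr (Finset.mem_Ioc.2 ⟨hn'.1, h2⟩)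
    left
    by_contra! hcon
    have hlt' := card_divisors_lt_self (n := n) (by omega)
    have hz : ((n - n.divisors.card : ℕ) : ℤ) = (n : ℤ) - n.divisors.card := by omega
    have hzx : ((n - n.divisors.card : ℕ) : ℝ) ≤ x := by
      refine le_trans ?_ (Nat.floor_le (by linarith : (0 : ℝ) ≤ x))
      exact_mod_cast (Nat.sub_le _ _).trans hn'.2
    have key := abs_card_primeFactors_sub_mainCount_le hx (by omega) hzx
    rw [hz] at key
    have k1 : ∑ p ∈ Nat.primesLE (auxHigh x), dvdInd ((n : ℤ) - n.divisors.card) p ≤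
        ε / 3 * √(ll x) := not_lt.1 fun h => hcon.1 (Finset.mem_filter.2 ⟨hn, h⟩)
    have k2 : ∑ p ∈ midPrimes x, dvdInd ((n : ℤ) - n.divisors.card) p ≤
        ε / 3 * √(ll x) := not_lt.1 fun h => hcon.2 (Finset.mem_filter.2 ⟨hn, h⟩)
    linarith
  have hcard : ((Finset.Ioc 0 ⌊x⌋₊).filter (fun n : ℕ => ε * √(ll x) <
      |((n - n.divisors.card).primeFactors.card : ℝ) -
        mainCount x ((n : ℤ) - n.divisors.card)|)).card ≤ S.card + M.card + 2 :=
    (Finset.card_le_card hsub).trans ((Finset.card_union_le _ _).trans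
      (Nat.add_le_add (Finset.card_union_le _ _) (by simp)))
  exact_mod_cast hcard

lemma norm_exp_I_mul_sub_exp_I_mul_le (a b : ℝ) :
    ‖Complex.exp (Complex.I * a) - Complex.exp (Complex.I * b)‖ ≤ |a - b| := by
  have e : Complex.exp (Complex.I * a) - Complex.exp (Complex.I * b) =
      Complex.exp (Complex.I * b) * (Complex.exp (Complex.I * ((a - b : ℝ) : ℂ)) - 1) := by
    rw [mul_sub, ← Complex.exp_add, mul_one]
    congr 2
    push_cast
    ring
  rw [e, norm_mul, Complex.norm_exp_I_mul_ofReal, one_mul]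
  exact Real.norm_exp_I_mul_ofReal_sub_one_le

lemma norm_sum_exp_sub_sum_exp_le {S : Finset ℕ} {a b : ℕ → ℝ} {η : ℝ} (hη : 0 ≤ η) :
    ‖∑ n ∈ S, Complex.exp (Complex.I * a n) - ∑ n ∈ S, Complex.exp (Complex.I * b n)‖ ≤
      S.card * η + 2 * (S.filter (fun n => η < |a n - b n|)).card := by
  rw [← Finset.sum_sub_distrib]
  have h : ∀ n ∈ S, ‖Complex.exp (Complex.I * a n) - Complex.exp (Complex.I * b n)‖ ≤
      η + 2 * (if η < |a n - b n| then 1 else 0) := by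
    intro n _
    split_ifs with hc
    · refine (norm_sub_le _ _).trans ?_
      rw [Complex.norm_exp_I_mul_ofReal, Complex.norm_exp_I_mul_ofReal]
      linarith
    · refine (norm_exp_I_mul_sub_exp_I_mul_le _ _).trans ?_
      linarith
  refine (norm_sum_le _ _).trans ((Finset.sum_le_sum h).trans (le_of_eq ?_))
  rw [Finset.sum_add_distrib, Finset.sum_const, nsmul_eq_mul, ← Finset.mul_sum, Finset.sum_boole]

/-- The characteristic function of the normalised number of prime factors of `n - τ(n)`
converges to that of the standard Gaussian. -/
theorem tendsto_charFun_card_primeFactors (t : ℝ) : Tendsto (fun x : ℝ =>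
    (∑ n ∈ Finset.Ioc 0 ⌊x⌋₊, Complex.exp (Complex.I *
      ((t * ((((n - n.divisors.card).primeFactors.card : ℝ) - ll x) / √(ll x)) : ℝ) : ℂ))) /
        (⌊x⌋₊ : ℂ)) atTop (nhds (Complex.exp (-(t : ℂ) ^ 2 / 2))) := by
  refine tendsto_of_tendsto_of_dist (tendsto_charFun_mainCount t) ?_
  rw [Metric.tendsto_nhds]
  intro δ hδ
  set ε := δ / (2 * (|t| + 1)) with hεdef
  have hε : 0 < ε := by positivity
  have hεt : |t| * ε ≤ δ / 2 := by
    rw [hεdef, ← mul_div_assoc, div_le_iff₀ (by positivity)]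
    nlinarith [abs_nonneg t]
  filter_upwards [(tendsto_card_filter_lt_abs_sub hε).eventually_lt_const
    (show (0 : ℝ) < δ / 4 by positivity), eventually_floor_ge_half,
    tendsto_ll.eventually_ge_atTop 1] with x hbad ⟨_, hN⟩ hL
  rw [Real.dist_0_eq_abs, abs_of_nonneg dist_nonneg, dist_eq_norm, ← sub_div, norm_div,
    Complex.norm_natCast, div_lt_iff₀ hN]
  rw [div_lt_iff₀ hN] at hbad
  have hs0 : 0 < √(ll x) := Real.sqrt_pos.2 (by linarith)
  refine (norm_sum_exp_sub_sum_exp_le (S := Finset.Ioc 0 ⌊x⌋₊) (η := |t| * ε)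
    (by positivity)).trans_lt ?_
  have hcard : (((Finset.Ioc 0 ⌊x⌋₊).filter (fun n : ℕ => |t| * ε <
      |t * ((mainCount x ((n : ℤ) - n.divisors.card) - ll x) / √(ll x)) -
        t * ((((n - n.divisors.card).primeFactors.card : ℝ) - ll x) / √(ll x))|)).card : ℝ) ≤
      (((Finset.Ioc 0 ⌊x⌋₊).filter (fun n : ℕ => ε * √(ll x) <
      |((n - n.divisors.card).primeFactors.card : ℝ) -
        mainCount x ((n : ℤ) - n.divisors.card)|)).card : ℝ) := by
    refine Nat.cast_le.2 (Finset.card_le_card fun n hn => ?_)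
    rw [Finset.mem_filter] at hn ⊢
    refine ⟨hn.1, ?_⟩
    have h := hn.2
    rw [← mul_sub, abs_mul, ← sub_div, sub_sub_sub_cancel_right, abs_div, abs_of_pos hs0] at h
    have h2 := lt_of_mul_lt_mul_left h (abs_nonneg t)
    rw [lt_div_iff₀ hs0, abs_sub_comm] at h2
    exact h2
  rw [Nat.card_Ioc, tsub_zero]
  have : (⌊x⌋₊ : ℝ) * (|t| * ε) ≤ ⌊x⌋₊ * (δ / 2) := by gcongr
  linarith

open MeasureTheory ProbabilityTheory ENNReal in
/-- **Lévy's continuity theorem** for empirical distributions with Gaussian limit. -/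
theorem tendsto_card_filter_le_div_of_tendsto_charFun {N : ℕ → ℕ} (hN : ∀ k, 0 < N k)
    {f : ℕ → ℕ → ℝ} (h : ∀ t : ℝ, Tendsto (fun k => (∑ n ∈ Finset.Ioc 0 (N k),
      Complex.exp (Complex.I * ((t * f k n : ℝ) : ℂ))) / (N k : ℂ)) atTop
      (nhds (Complex.exp (-(t : ℂ) ^ 2 / 2)))) (u : ℝ) :
    Tendsto (fun k => (((Finset.Ioc 0 (N k)).filter (fun n => f k n ≤ u)).card : ℝ) / (N k : ℝ))
      atTop (nhds ((√(2 * π))⁻¹ * ∫ t in Set.Iic u, exp (-t ^ 2 / 2))) := by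
  set m : ℕ → Measure ℝ := fun k =>
    ∑ n ∈ Finset.Ioc 0 (N k), (N k : ℝ≥0∞)⁻¹ • Measure.dirac (f k n) with hm
  have hprob : ∀ k, IsProbabilityMeasure (m k) := fun k => ⟨by
    have hk : (N k : ℝ≥0∞) ≠ 0 := by exact_mod_cast (hN k).ne'
    simp only [hm, Measure.coe_finsetSum, Finset.sum_apply, Measure.smul_apply, measure_univ,
      smul_eq_mul, mul_one, Finset.sum_const, Nat.card_Ioc, tsub_zero, nsmul_eq_mul]
    exact ENNReal.mul_inv_cancel hk (ENNReal.natCast_ne_top _)⟩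
  have hchar : ∀ t : ℝ, Tendsto (fun k => charFun (m k) t) atTop
      (nhds (charFun (gaussianReal 0 1) t)) := fun t => by
    have e : charFun (gaussianReal 0 1) t = Complex.exp (-(t : ℂ) ^ 2 / 2) := by
      rw [charFun_gaussianReal]
      congr 1
      push_cast
      ring
    rw [e]
    refine (h t).congr fun k => ?_
    rw [charFun_apply_real, hm, integral_finsetSum_measure
      fun n _ => (integrable_dirac (by simp)).smul_measure (by
        rw [Ne, ENNReal.inv_eq_top]; exact_mod_cast (hN k).ne')]
    rw [Finset.sum_div]
    refine Finset.sum_congr rfl fun n _ => ?_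
    rw [integral_smul_measure, integral_dirac, ENNReal.toReal_inv, ENNReal.toReal_natCast,
      Complex.real_smul, div_eq_inv_mul]
    push_cast
    congr 2
    ring
  have hlim := ProbabilityMeasure.tendsto_of_tendsto_charFun
    (μ := fun k => ⟨m k, hprob k⟩) (μ₀ := ⟨gaussianReal 0 1, inferInstance⟩) hchar
  have hfr := ProbabilityMeasure.tendsto_measure_of_null_frontier_of_tendsto' hlim
    (E := Set.Iic u) (by
      change gaussianReal 0 1 (frontier (Set.Iic u)) = 0
      rw [frontier_Iic]
      have := nullSingletonClass_gaussianReal (μ := 0) (v := 1) one_ne_zero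
      exact measure_singleton u)
  change Tendsto (fun k => m k (Set.Iic u)) atTop (nhds (gaussianReal 0 1 (Set.Iic u))) at hfr
  have hval : (gaussianReal 0 1 (Set.Iic u)).toReal =
      (√(2 * π))⁻¹ * ∫ t in Set.Iic u, exp (-t ^ 2 / 2) := by
    rw [gaussianReal_apply_eq_integral 0 one_ne_zero, ENNReal.toReal_ofReal
      (integral_nonneg fun x => gaussianPDFReal_nonneg 0 1 x), ← integral_const_mul]
    simp [gaussianPDFReal]
  rw [← hval]
  refine ((ENNReal.tendsto_toReal (measure_ne_top _ _)).comp hfr).congr fun k => ?_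
  simp only [Function.comp, hm, Measure.coe_finsetSum, Finset.sum_apply, Measure.smul_apply,
    smul_eq_mul]
  rw [← Finset.mul_sum, ENNReal.toReal_mul, ENNReal.toReal_inv, ENNReal.toReal_natCast,
    div_eq_inv_mul]
  congr 1
  simp only [Measure.dirac_apply' _ measurableSet_Iic, Set.indicator_apply, Set.mem_Iic,
    Pi.one_apply]
  rw [Finset.sum_boole, ENNReal.toReal_natCast]

lemma tendsto_card_filter_Ioc (u : ℝ) : Tendsto (fun x : ℝ =>
    (((Finset.Ioc 0 ⌊x⌋₊).filter (fun n : ℕ =>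
      (((n - n.divisors.card).primeFactors.card : ℝ) - ll x) / √(ll x) ≤ u)).card : ℝ) /
        (⌊x⌋₊ : ℝ)) atTop (nhds ((√(2 * π))⁻¹ * ∫ t in Set.Iic u, exp (-t ^ 2 / 2))) := by
  refine tendsto_of_seq_tendsto fun v hv => ?_
  have hw : ∀ᶠ k in atTop, max (v k) 1 = v k :=
    (hv.eventually_ge_atTop 1).mono fun k hk => max_eq_left hk
  have hw' : Tendsto (fun k => max (v k) 1) atTop atTop := hv.congr' (hw.mono fun _ h => h.symm)
  have h := tendsto_card_filter_le_div_of_tendsto_charFun (N := fun k => ⌊max (v k) 1⌋₊)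
    (fun k => Nat.floor_pos.2 (le_max_right _ _))
    (f := fun k n => (((n - n.divisors.card).primeFactors.card : ℝ) - ll (max (v k) 1)) /
      √(ll (max (v k) 1)))
    (fun t => (tendsto_charFun_card_primeFactors t).comp hw') u
  refine h.congr' (hw.mono fun k hk => ?_)
  simp only [hk, Function.comp]

end DivisorShift

open DivisorShift in
/-- Erdős–Kac law for ω(n − τ(n)), where τ(n) is the number of divisors of n.
(Natural subtraction: the finitely many n with n ≤ τ(n) get n − τ(n) = 0 and ω(0) = 0,
which does not affect the limit.) -/
theorem erdosKac_sub_divisor_count (u : ℝ) :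
    Tendsto (fun x : ℝ =>
      (((Finset.Icc 2 ⌊x⌋₊).filter (fun n : ℕ =>
        ((((n - n.divisors.card).primeFactors.card : ℝ) : ℝ)) - Real.log (Real.log x)
          ≤ u * Real.sqrt (Real.log (Real.log x)))).card : ℝ) / x)
      atTop
      (nhds ((Real.sqrt (2 * Real.pi))⁻¹ * ∫ t in Set.Iic u, Real.exp (-t ^ 2 / 2))) := by
  have h1 := (tendsto_card_filter_Ioc u).mul tendsto_nat_floor_div_atTop
  rw [mul_one] at h1
  refine tendsto_of_tendsto_of_dist h1 (squeeze_zero' (Eventually.of_forall fun _ => dist_nonneg)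
    ?_ (tendsto_inv_atTop_zero (𝕜 := ℝ)))
  filter_upwards [eventually_floor_ge_half, tendsto_ll.eventually_ge_atTop 1,
    eventually_gt_atTop 0] with x ⟨_, hN⟩ hL hx
  have hs0 : 0 < Real.sqrt (ll x) := Real.sqrt_pos.2 (by linarith)
  rw [div_mul_div_cancel₀ hN.ne', Real.dist_eq, ← sub_div, abs_div, abs_of_pos hx, ← one_div]
  refine div_le_div_of_nonneg_right ?_ hx.le
  change |_ - (((Finset.Icc 2 ⌊x⌋₊).filter (fun n : ℕ =>
    ((n - n.divisors.card).primeFactors.card : ℝ) - ll x ≤ u * Real.sqrt (ll x))).card : ℝ)| ≤ 1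
  simp only [div_le_iff₀ hs0]
  set A := (Finset.Ioc 0 ⌊x⌋₊).filter (fun n : ℕ =>
    ((n - n.divisors.card).primeFactors.card : ℝ) - ll x ≤ u * Real.sqrt (ll x)) with hA
  set B := (Finset.Icc 2 ⌊x⌋₊).filter (fun n : ℕ =>
    ((n - n.divisors.card).primeFactors.card : ℝ) - ll x ≤ u * Real.sqrt (ll x)) with hB
  have hBA : B ⊆ A := Finset.filter_subset_filter _ fun n hn => by
    rw [Finset.mem_Icc] at hn
    exact Finset.mem_Ioc.2 ⟨by omega, hn.2⟩
  have hAB : A ⊆ insert 1 B := fun n hn => by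
    rw [hA, Finset.mem_filter, Finset.mem_Ioc] at hn
    rw [Finset.mem_insert, hB, Finset.mem_filter, Finset.mem_Icc]
    by_cases h : n = 1
    · exact Or.inl h
    · exact Or.inr ⟨⟨by omega, hn.1.2⟩, hn.2⟩
  have c1 : (B.card : ℝ) ≤ A.card := by exact_mod_cast Finset.card_le_card hBA
  have c2 : (A.card : ℝ) ≤ B.card + 1 := by
    exact_mod_cast (Finset.card_le_card hAB).trans (Finset.card_insert_le _ _)
  rw [abs_of_nonneg (by linarith)]
  linarith
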